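/- Let p be a prime and let G be a finite p-group acting continuously on a contractible topological manifold M. If the fixed-point set M^G = {x ∈ M | g·x = x for all g ∈ G} is compact, then M^G consists of exactly one point. -/

import Mathlib

/-- A topological manifold: a second-countable Hausdorff space in which every
point has an open neighborhood homeomorphic to an open subset of `ℝⁿ` for some `n`. -/
def IsTopologicalManifold (M : Type) [TopologicalSpace M] : Prop :=
  SecondCountableTopology M ∧ T2Space M ∧
    ∀ x : M, ∃ (n : ℕ) (U : Set M) (V : Set (Fin n → ℝ)),
      IsOpen U ∧ x ∈ U ∧ IsOpen V ∧ Nonempty (U ≃ₜ V)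

namespace AlexanderSpanier

open Set Filter Topology

section Differential

variable {X Y R : Type*} [AddCommGroup R]

/-- The augmented ordered coboundary: `∑ i, (-1) ^ i f (l with its i-th entry removed)`. -/
def d : (List X → R) → List X → R
  | _, [] => 0
  | f, a :: l => f l - d (fun l' => f (a :: l')) l

@[simp] lemma d_nil (f : List X → R) : d f [] = 0 := by simp [d]

lemma d_cons (f : List X → R) (a : X) (l : List X) :
    d f (a :: l) = f l - d (fun l' => f (a :: l')) l := by simp [d]

lemma d_congr (l : List X) : ∀ {f g : List X → R},
    (∀ l' : List X, l'.Sublist l → l'.length + 1 = l.length → f l' = g l') → d f l = d g l := by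
  induction l with
  | nil => intro f g _; simp
  | cons a l ih =>
    intro f g h
    rw [d_cons, d_cons, h l (List.sublist_cons_self a l) (by simp)]
    congr 1
    exact ih fun l' hl hn => h (a :: l') (hl.cons_cons a) (by simp [hn])

lemma d_eq_zero {l : List X} {f : List X → R}
    (h : ∀ l' : List X, l'.Sublist l → l'.length + 1 = l.length → f l' = 0) : d f l = 0 := by
  have h0 : ∀ l : List X, d (fun _ => (0 : R)) l = 0 := by
    intro l; induction l with
    | nil => simp
    | cons a l ih => rw [d_cons, ih]; simp
  rw [d_congr (g := fun _ => 0) l h, h0]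

lemma d_add (f g : List X → R) (l : List X) : d (f + g) l = d f l + d g l := by
  induction l generalizing f g with
  | nil => simp
  | cons a l ih =>
    have := ih (fun l' => f (a :: l')) (fun l' => g (a :: l'))
    simp only [d_cons, Pi.add_apply] at this ⊢
    rw [show (fun l' => f (a :: l') + g (a :: l'))
      = (fun l' => f (a :: l')) + (fun l' => g (a :: l')) from rfl, this]; abel

/-- The coboundary as an additive map. -/
def dHom : (List X → R) →+ (List X → R) :=
  AddMonoidHom.mk' d fun f g => funext fun l => d_add f g l

lemma d_zero : d (0 : List X → R) = 0 := dHom.map_zero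
lemma d_neg (f : List X → R) : d (-f) = -d f := dHom.map_neg f
lemma d_sub (f g : List X → R) : d (f - g) = d f - d g := dHom.map_sub f g
lemma d_add' (f g : List X → R) : d (f + g) = d f + d g := dHom.map_add f g
lemma d_sum {ι : Type*} (s : Finset ι) (f : ι → List X → R) :
    d (∑ i ∈ s, f i) = ∑ i ∈ s, d (f i) := map_sum dHom f s

lemma d_smul {𝕜 : Type*} [Ring 𝕜] [Module 𝕜 R] (c : 𝕜) (f : List X → R) :
    d (c • f) = c • d f := by
  funext l
  induction l generalizing f with
  | nil => simp
  | cons a l ih =>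
    have := ih (fun l' => f (a :: l'))
    simp only [d_cons, Pi.smul_apply] at this ⊢
    rw [show (fun l' => c • f (a :: l')) = c • (fun l' => f (a :: l')) from rfl, this, smul_sub]

lemma d_d (f : List X → R) : d (d f) = 0 := by
  funext l
  induction l generalizing f with
  | nil => simp
  | cons a l ih =>
    have h : (fun l' => d f (a :: l')) = f - d (fun l' => f (a :: l')) := by
      funext l'; simp [d_cons]
    rw [d_cons, h, d_sub, Pi.sub_apply, ih]; simp

lemma d_map (φ : X → Y) (f : List Y → R) (l : List X) :
    d (fun l' => f (l'.map φ)) l = d f (l.map φ) := by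
  induction l generalizing f with
  | nil => simp
  | cons a l ih =>
    rw [d_cons, List.map_cons, d_cons, ← ih]; simp

/-- The prism operator of a pair of maps. -/
def prism (φ ψ : X → Y) : (List Y → R) → List X → R
  | _, [] => 0
  | f, a :: l => f (φ a :: (a :: l).map ψ) - prism φ ψ (fun l' => f (φ a :: l')) l

@[simp] lemma prism_nil (φ ψ : X → Y) (f : List Y → R) : prism φ ψ f [] = 0 := by simp [prism]

lemma prism_cons (φ ψ : X → Y) (f : List Y → R) (a : X) (l : List X) :
    prism φ ψ f (a :: l) = f (φ a :: ψ a :: l.map ψ) - prism φ ψ (fun l' => f (φ a :: l')) l := by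
  simp [prism]

lemma prism_congr (φ ψ : X → Y) (l : List X) : ∀ {f g : List Y → R},
    (∀ l' : List Y, l'.length = l.length + 1 → (∀ b ∈ l', ∃ a ∈ l, b = φ a ∨ b = ψ a) →
      f l' = g l') → prism φ ψ f l = prism φ ψ g l := by
  induction l with
  | nil => intros; simp
  | cons a l ih =>
    intro f g h
    rw [prism_cons, prism_cons]
    congr 1
    · refine h _ (by simp) ?_
      intro b hb
      simp only [List.mem_cons, List.mem_map] at hb
      rcases hb with rfl | rfl | ⟨x, hx, rfl⟩
      · exact ⟨a, by simp, Or.inl rfl⟩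
      · exact ⟨a, by simp, Or.inr rfl⟩
      · exact ⟨x, by simp [hx], Or.inr rfl⟩
    · refine ih fun l' hl' hb => h _ (by simp [hl']) ?_
      intro b hb'
      rcases List.mem_cons.1 hb' with rfl | hb'
      · exact ⟨a, by simp, Or.inl rfl⟩
      · obtain ⟨x, hx, h⟩ := hb b hb'
        exact ⟨x, by simp [hx], h⟩

lemma prism_zero (φ ψ : X → Y) (l : List X) : prism φ ψ (fun _ => (0 : R)) l = 0 := by
  induction l with
  | nil => simp
  | cons a l ih => rw [prism_cons, ih]; simp

lemma prism_eq_zero (φ ψ : X → Y) {l : List X} {f : List Y → R}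
    (h : ∀ l' : List Y, l'.length = l.length + 1 → (∀ b ∈ l', ∃ a ∈ l, b = φ a ∨ b = ψ a) →
      f l' = 0) : prism φ ψ f l = 0 := by
  rw [prism_congr φ ψ l (g := fun _ => 0) h, prism_zero]

lemma prism_sub (φ ψ : X → Y) (f g : List Y → R) (l : List X) :
    prism φ ψ (fun l' => f l' - g l') l = prism φ ψ f l - prism φ ψ g l := by
  induction l generalizing f g with
  | nil => simp
  | cons a l ih => rw [prism_cons, prism_cons, prism_cons, ih]; abel

lemma d_prism (φ ψ : X → Y) (f : List Y → R) (l : List X) :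
    d (prism φ ψ f) l + prism φ ψ (d f) l = f (l.map ψ) - f (l.map φ) := by
  induction l generalizing f with
  | nil => simp
  | cons a l ih =>
    have h1 : (fun l' => prism φ ψ f (a :: l')) =
        (fun l' => f (φ a :: ψ a :: l'.map ψ)) - prism φ ψ (fun l' => f (φ a :: l')) := by
      funext l'; rw [prism_cons]; rfl
    have h2 : (fun l' => d f (φ a :: l')) = fun l' => f l' - d (fun l'' => f (φ a :: l'')) l' := by
      funext l'; rw [d_cons]
    have h3 := d_map ψ (fun l' => f (φ a :: ψ a :: l')) l
    have h4 := ih (fun l' => f (φ a :: l'))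
    rw [d_cons, h1, d_sub, Pi.sub_apply, prism_cons, h2, prism_sub, h3, d_cons, d_cons,
      List.map_cons, List.map_cons]
    have h5 := eq_sub_of_add_eq h4
    rw [h5]
    abel

end Differential

section Cup

variable {X 𝕜 : Type*} [CommRing 𝕜]

/-- The sum of the cup products of all components of two inhomogeneous cochains. -/
def cup : (List X → 𝕜) → (List X → 𝕜) → List X → 𝕜
  | _, _, [] => 0
  | f, g, a :: l => f [a] * g (a :: l) + cup (fun l' => f (a :: l')) g l

@[simp] lemma cup_nil (f g : List X → 𝕜) : cup f g [] = 0 := by simp [cup]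

lemma cup_cons (f g : List X → 𝕜) (a : X) (l : List X) :
    cup f g (a :: l) = f [a] * g (a :: l) + cup (fun l' => f (a :: l')) g l := by simp [cup]

lemma cup_add_left (f f' g : List X → 𝕜) (l : List X) :
    cup (f + f') g l = cup f g l + cup f' g l := by
  induction l generalizing f f' with
  | nil => simp
  | cons a l ih =>
    have := ih (fun l' => f (a :: l')) (fun l' => f' (a :: l'))
    simp only [cup_cons, Pi.add_apply]
    rw [show (fun l' => f (a :: l') + f' (a :: l'))
      = (fun l' => f (a :: l')) + (fun l' => f' (a :: l')) from rfl, this]; ring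

lemma cup_smul_left (c : 𝕜) (f g : List X → 𝕜) (l : List X) :
    cup (c • f) g l = c * cup f g l := by
  induction l generalizing f with
  | nil => simp
  | cons a l ih =>
    have := ih (fun l' => f (a :: l'))
    simp only [cup_cons, Pi.smul_apply, smul_eq_mul] at this ⊢
    rw [show (fun l' => c * f (a :: l')) = c • (fun l' => f (a :: l')) from rfl, this]; ring

lemma cup_add_right (f g g' : List X → 𝕜) (l : List X) :
    cup f (g + g') l = cup f g l + cup f g' l := by
  induction l generalizing f with
  | nil => simp
  | cons a l ih => simp only [cup_cons, Pi.add_apply, ih]; ring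

lemma cup_smul_right (c : 𝕜) (f g : List X → 𝕜) (l : List X) :
    cup f (c • g) l = c * cup f g l := by
  induction l generalizing f with
  | nil => simp
  | cons a l ih => simp only [cup_cons, Pi.smul_apply, ih, smul_eq_mul]; ring

/-- The cup product as a bilinear map. -/
def cupₗ : (List X → 𝕜) →ₗ[𝕜] (List X → 𝕜) →ₗ[𝕜] (List X → 𝕜) :=
  LinearMap.mk₂ 𝕜 cup
    (fun f f' g => funext fun l => cup_add_left f f' g l)
    (fun c f g => funext fun l => cup_smul_left c f g l)
    (fun f g g' => funext fun l => cup_add_right f g g' l)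
    (fun c f g => funext fun l => cup_smul_right c f g l)

@[simp] lemma cupₗ_apply (f g : List X → 𝕜) : cupₗ f g = cup f g := rfl

lemma cup_eq_zero {f g : List X → 𝕜} {l : List X}
    (h : ∀ l₁ l₂ : List X, ∀ a : X, l = l₁ ++ a :: l₂ → f (l₁ ++ [a]) * g (a :: l₂) = 0) :
    cup f g l = 0 := by
  induction l generalizing f with
  | nil => simp
  | cons a l ih =>
    have := h [] l a rfl
    simp only [List.nil_append] at this
    rw [cup_cons, this, ih, add_zero]
    intro l₁ l₂ b hl
    exact h (a :: l₁) l₂ b (by simp [hl])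

lemma cup_congr {f f' g g' : List X → 𝕜} {l : List X}
    (h : ∀ l₁ l₂ : List X, ∀ a : X, l = l₁ ++ a :: l₂ →
      f (l₁ ++ [a]) * g (a :: l₂) = f' (l₁ ++ [a]) * g' (a :: l₂)) :
    cup f g l = cup f' g' l := by
  induction l generalizing f f' with
  | nil => simp
  | cons a l ih =>
    have := h [] l a rfl
    simp only [List.nil_append] at this
    rw [cup_cons, cup_cons, this, ih]
    intro l₁ l₂ b hl
    exact h (a :: l₁) l₂ b (by simp [hl])

/-- The sign operator `(-1) ^ degree`. -/
def sgn : (List X → 𝕜) →ₗ[𝕜] (List X → 𝕜) where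
  toFun f l := (-1) ^ (l.length + 1) * f l
  map_add' f g := by funext l; simp [mul_add]
  map_smul' c f := by funext l; simp; ring

lemma sgn_apply (f : List X → 𝕜) (l : List X) : sgn f l = (-1) ^ (l.length + 1) * f l := rfl

lemma sgn_sgn (f : List X → 𝕜) : sgn (sgn f) = f := by
  funext l; rw [sgn_apply, sgn_apply, ← mul_assoc, ← mul_pow]; simp

lemma d_sgn (f : List X → 𝕜) : d (sgn f) = -sgn (d f) := by
  funext l
  rw [Pi.neg_apply, sgn_apply]
  cases l with
  | nil => simp
  | cons a l =>
    have : d (sgn f) (a :: l) = d ((-1 : 𝕜) ^ (l.length + 1) • f) (a :: l) := by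
      refine d_congr _ fun l' _ hl => ?_
      have : l'.length = l.length := by simpa using hl
      simp [sgn_apply, this]
    rw [this, d_smul, Pi.smul_apply, smul_eq_mul, List.length_cons, pow_succ (-1 : 𝕜) (l.length + 1)]
    ring

lemma d_cup (f g : List X → 𝕜) (hg : g [] = 0) (l : List X) :
    d (cup f g) l = cup (d f) g l + cup (sgn f) (d g) l - f [] * g l := by
  induction l generalizing f with
  | nil => simp [hg]
  | cons a l ih =>
    have h1 : (fun l' => cup f g (a :: l')) =
        f [a] • (fun l' => g (a :: l')) + cup (fun l' => f (a :: l')) g := by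
      funext l'; simp [cup_cons]
    have h2 : (fun l' => d f (a :: l')) = f + (-1 : 𝕜) • d (fun l'' => f (a :: l'')) := by
      funext l'; simp [d_cons, sub_eq_add_neg]
    have h3 : (fun l' => sgn f (a :: l')) = (-1 : 𝕜) • sgn (fun l' => f (a :: l')) := by
      funext l'; simp [sgn_apply, pow_succ]
    rw [d_cons, h1, d_add', Pi.add_apply, d_smul, Pi.smul_apply, ih, cup_cons (d f), h2,
      cup_add_left, cup_smul_left, cup_cons (sgn f), h3, cup_smul_left, d_cons, d_cons g]
    simp [sgn_apply]
    ring

end Cup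

/-- A family of classes of small lists, closed under passing to lists of entries. -/
structure Germ (X : Type*) where
  /-- The lists of size `ε`. -/
  C : ℝ → List X → Prop
  mono : ∀ {ε ε' : ℝ} {l : List X}, ε ≤ ε' → C ε l → C ε' l
  sub : ∀ {ε : ℝ} {l l' : List X}, l' ⊆ l → C ε l → C ε l'

/-- A cochain vanishes on all sufficiently small lists of length `k`. -/
def Null {X R : Type*} [AddCommGroup R] (G : Germ X) (k : ℕ) (f : List X → R) : Prop :=
  ∃ ε > 0, ∀ l : List X, l.length = k → G.C ε l → f l = 0

section Null

variable {X Y R : Type*} [AddCommGroup R] {G : Germ X} {H : Germ Y} {k : ℕ} {f g : List X → R}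

lemma Null.zero : Null G k (0 : List X → R) := ⟨1, one_pos, fun _ _ _ => rfl⟩

lemma Null.add (hf : Null G k f) (hg : Null G k g) : Null G k (f + g) := by
  obtain ⟨ε, hε, hf⟩ := hf
  obtain ⟨ε', hε', hg⟩ := hg
  refine ⟨min ε ε', lt_min hε hε', fun l hl hC => ?_⟩
  rw [Pi.add_apply, hf l hl (G.mono (min_le_left _ _) hC), hg l hl (G.mono (min_le_right _ _) hC),
    add_zero]

lemma Null.neg (hf : Null G k f) : Null G k (-f) := by
  obtain ⟨ε, hε, hf⟩ := hf
  exact ⟨ε, hε, fun l hl hC => by rw [Pi.neg_apply, hf l hl hC, neg_zero]⟩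

lemma Null.sub (hf : Null G k f) (hg : Null G k g) : Null G k (f - g) := by
  rw [sub_eq_add_neg]; exact hf.add hg.neg

lemma Null.smul {𝕜 : Type*} [Ring 𝕜] [Module 𝕜 R] (c : 𝕜) (hf : Null G k f) :
    Null G k (c • f) := by
  obtain ⟨ε, hε, hf⟩ := hf
  exact ⟨ε, hε, fun l hl hC => by rw [Pi.smul_apply, hf l hl hC, smul_zero]⟩

lemma Null.sum {ι : Type*} (s : Finset ι) {F : ι → List X → R} (h : ∀ i ∈ s, Null G k (F i)) :
    Null G k (∑ i ∈ s, F i) := by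
  classical
  induction s using Finset.induction_on with
  | empty => simpa using Null.zero
  | insert i s hi ih =>
    rw [Finset.sum_insert hi]
    exact (h i (by simp)).add (ih fun j hj => h j (by simp [hj]))

lemma Null.d (hf : Null G k f) : Null G (k + 1) (d f) := by
  obtain ⟨ε, hε, hf⟩ := hf
  refine ⟨ε, hε, fun l hl hC => d_eq_zero fun l' hs hl' => hf l' (by omega) (G.sub hs.subset hC)⟩

lemma Null.d_succ_sub (hf : Null G (k + 1) (AlexanderSpanier.d f)) (w : List X → R) :
    Null G (k + 1) (AlexanderSpanier.d (f - AlexanderSpanier.d w)) := by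
  rwa [d_sub, d_d, sub_zero]

lemma Null.closed (w : List X → R) (hf : Null G k (f - AlexanderSpanier.d w)) :
    Null G (k + 1) (AlexanderSpanier.d f) := by
  have := hf.d
  rwa [d_sub, d_d, sub_zero] at this

lemma Null.of_le {G' : Germ X} (hf : Null G k f)
    (h : ∀ ε > 0, ∃ δ > 0, ∀ l, G'.C δ l → G.C ε l) : Null G' k f := by
  obtain ⟨ε, hε, hf⟩ := hf
  obtain ⟨δ, hδ, h⟩ := h ε hε
  exact ⟨δ, hδ, fun l hl hC => hf l hl (h l hC)⟩

lemma Null.map {φ : X → Y} {f : List Y → R} (hf : Null H k f)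
    (h : ∀ ε > 0, ∃ δ > 0, ∀ l, G.C δ l → H.C ε (l.map φ)) : Null G k (fun l => f (l.map φ)) := by
  obtain ⟨ε, hε, hf⟩ := hf
  obtain ⟨δ, hδ, h⟩ := h ε hε
  exact ⟨δ, hδ, fun l hl hC => hf _ (by simpa using hl) (h l hC)⟩

lemma Null.congr (hf : Null G k f) (h : ∀ l, l.length = k → g l = f l) : Null G k g := by
  obtain ⟨ε, hε, hf⟩ := hf
  exact ⟨ε, hε, fun l hl hC => by rw [h l hl, hf l hl hC]⟩

lemma Null.of_eq_on (hf : Null G k f)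
    (h : ∀ l, l.length = k → G.C 1 l → g l = f l) : Null G k g := by
  obtain ⟨ε, hε, hf⟩ := hf
  exact ⟨min ε 1, by positivity, fun l hl hC => by
    rw [h l hl (G.mono (min_le_right _ _) hC), hf l hl (G.mono (min_le_left _ _) hC)]⟩

/-- Close maps induce cohomologous cochains. -/
lemma Null.prism {φ ψ : X → Y} {f : List Y → R} (hf : Null H (k + 1) (AlexanderSpanier.d f))
    (h : ∀ ε > 0, ∃ δ > 0, ∀ l, G.C δ l → H.C ε (l.map φ ++ l.map ψ)) :
    Null G k ((fun l => f (l.map ψ)) - (fun l => f (l.map φ)) -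
      AlexanderSpanier.d (AlexanderSpanier.prism φ ψ f)) := by
  obtain ⟨ε, hε, hf⟩ := hf
  obtain ⟨δ, hδ, h⟩ := h ε hε
  refine ⟨δ, hδ, fun l hl hC => ?_⟩
  have h1 := d_prism φ ψ f l
  rw [prism_eq_zero φ ψ (f := AlexanderSpanier.d f), add_zero] at h1
  · simp [h1]
  · intro l' hl' hb
    refine hf l' (by omega) (H.sub ?_ (h l hC))
    intro b hbl
    obtain ⟨a, ha, h | h⟩ := hb b hbl
    · exact List.mem_append_left _ (List.mem_map.2 ⟨a, ha, h.symm⟩)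
    · exact List.mem_append_right _ (List.mem_map.2 ⟨a, ha, h.symm⟩)

end Null

section Metric

variable {X : Type*} [MetricSpace X]

/-- The small lists in `T` close to `A`. -/
def Germ.near (T A : Set X) : Germ X where
  C ε l := (∀ a ∈ l, a ∈ T) ∧ (∀ a ∈ l, ∃ b ∈ A, dist a b < ε) ∧ ∀ a ∈ l, ∀ b ∈ l, dist a b < ε
  mono h hC := ⟨hC.1, fun a ha => (hC.2.1 a ha).imp fun _ hb => ⟨hb.1, hb.2.trans_le h⟩,
    fun a ha b hb => (hC.2.2 a ha b hb).trans_le h⟩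
  sub h hC := ⟨fun a ha => hC.1 a (h ha), fun a ha => hC.2.1 a (h ha),
    fun a ha b hb => hC.2.2 a (h ha) b (h hb)⟩

/-- The small lists in `S`. -/
def Germ.on (S : Set X) : Germ X where
  C ε l := (∀ a ∈ l, a ∈ S) ∧ ∀ a ∈ l, ∀ b ∈ l, dist a b < ε
  mono h hC := ⟨hC.1, fun a ha b hb => (hC.2 a ha b hb).trans_le h⟩
  sub h hC := ⟨fun a ha => hC.1 a (h ha), fun a ha b hb => hC.2 a (h ha) b (h hb)⟩

variable {R : Type*} [AddCommGroup R]

lemma Null.on_mono {S T : Set X} {k : ℕ} {f : List X → R} (h : S ⊆ T)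
    (hf : Null (Germ.on T) k f) : Null (Germ.on S) k f :=
  hf.of_le fun ε hε => ⟨ε, hε, fun _ hl => ⟨fun a ha => h (hl.1 a ha), hl.2⟩⟩

lemma Null.near_of_on {T A : Set X} {k : ℕ} {f : List X → R}
    (hf : Null (Germ.on T) k f) : Null (Germ.near T A) k f :=
  hf.of_le fun ε hε => ⟨ε, hε, fun _ hl => ⟨hl.1, hl.2.2⟩⟩

lemma Null.on_of_near {S T A : Set X} {k : ℕ} {f : List X → R} (hS : S ⊆ A) (hT : S ⊆ T)
    (hf : Null (Germ.near T A) k f) : Null (Germ.on S) k f :=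
  hf.of_le fun ε hε => ⟨ε, hε, fun _ hl => ⟨fun a ha => hT (hl.1 a ha),
    fun a ha => ⟨a, hS (hl.1 a ha), by simpa using hε⟩, hl.2⟩⟩

lemma null_on_zero {S : Set X} {f : List X → R} : Null (Germ.on S) 0 f ↔ f [] = 0 := by
  refine ⟨fun ⟨ε, _, h⟩ => h [] rfl ⟨by simp, by simp⟩, fun h => ⟨1, one_pos, fun l hl _ => ?_⟩⟩
  rw [List.length_eq_zero_iff.1 hl, h]

variable (R) in
/-- Cocycles of length `k` on `K'` become coboundaries on `K`. -/
def KillsAt (K' K : Set X) (k : ℕ) : Prop :=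
  ∀ f : List X → R, Null (Germ.on K') (k + 1) (d f) → ∃ w, Null (Germ.on K) k (f - d w)

variable (R) in
/-- Cocycles on `K'` become coboundaries on `K`. -/
def Kills (K' K : Set X) : Prop := ∀ k, KillsAt R K' K k

lemma KillsAt.mono {K' K L' L : Set X} {k : ℕ} (h : KillsAt R K' K k) (h' : K' ⊆ L') (hL : L ⊆ K) :
    KillsAt R L' L k := fun f hf =>
  let ⟨w, hw⟩ := h f (hf.on_mono h')
  ⟨w, hw.on_mono hL⟩

lemma Kills.mono {K' K L' L : Set X} (h : Kills R K' K) (h' : K' ⊆ L') (hL : L ⊆ K) :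
    Kills R L' L := fun k => (h k).mono h' hL

lemma kills_singleton (x : X) : Kills R {x} {x} := by
  rintro k f ⟨ε, hε, hf⟩
  refine ⟨fun l => f (x :: l), ε, hε, fun l hl hC => ?_⟩
  have hx : ∀ a ∈ x :: l, a = x := by
    intro a ha
    rcases List.mem_cons.1 ha with rfl | ha
    · rfl
    · exact hC.1 a ha
  have := hf (x :: l) (by simp [hl]) ⟨hx, fun a ha b hb => by rw [hx a ha, hx b hb]; simpa⟩
  rw [d_cons] at this
  simpa using this

lemma Kills.nonempty [Nontrivial R] {K' K : Set X} (h : KillsAt R K' K 0) : K'.Nonempty := by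
  by_contra hne
  rw [not_nonempty_iff_eq_empty] at hne
  obtain ⟨r, hr⟩ := exists_ne (0 : R)
  obtain ⟨w, hw⟩ := h (fun _ => r) ⟨1, one_pos, fun l hl hC => by
    obtain ⟨a, rfl⟩ := List.length_eq_one_iff.1 hl
    have := hC.1 a (by simp)
    rw [hne] at this
    exact this.elim⟩
  rw [null_on_zero] at hw
  simp [hr] at hw

/-- Homotopy invariance. -/
lemma exists_null_homotopy {S T : Set X} (hS : IsCompact S) (h : ℝ → X → X)
    (hc : ContinuousOn (Function.uncurry h) (Icc 0 1 ×ˢ S))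
    (hm : ∀ t ∈ Icc (0 : ℝ) 1, ∀ x ∈ S, h t x ∈ T) {k : ℕ} {f : List X → R}
    (hf : Null (Germ.on T) (k + 1) (d f)) :
    ∃ w, Null (Germ.on S) k ((fun l => f (l.map (h 1))) - (fun l => f (l.map (h 0))) - d w) := by
  have hK : IsCompact (Icc (0 : ℝ) 1 ×ˢ S) := isCompact_Icc.prod hS
  have hu := Metric.uniformContinuousOn_iff.1 (hK.uniformContinuousOn_of_continuous hc)
  obtain ⟨ε, hε, hf⟩ := hf
  obtain ⟨η, hη, hu⟩ := hu ε hε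
  obtain ⟨N, hN⟩ := exists_nat_one_div_lt hη
  set t : ℕ → ℝ := fun i => i / (N + 1) with ht
  have hN0 : (0 : ℝ) < N + 1 := by positivity
  have ht0 : ∀ i ≤ N + 1, t i ∈ Icc (0 : ℝ) 1 := fun i hi =>
    ⟨by positivity, by rw [ht]; simp only; rw [div_le_one hN0]; exact_mod_cast hi⟩
  have key : ∀ n ≤ N + 1, ∃ w, ∀ l : List X, l.length = k → (Germ.on S).C η l →
      f (l.map (h (t n))) - f (l.map (h 0)) - d w l = 0 := by
    intro n
    induction n with
    | zero =>
      intro _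
      exact ⟨0, fun l _ _ => by simp [ht, d_zero]⟩
    | succ n ih =>
      intro hn
      obtain ⟨w, hw⟩ := ih (by omega)
      refine ⟨w + prism (h (t n)) (h (t (n + 1))) f, fun l hl hC => ?_⟩
      have h1 := d_prism (h (t n)) (h (t (n + 1))) f l
      rw [prism_eq_zero _ _ (f := d f), add_zero] at h1
      · rw [d_add', Pi.add_apply, h1, ← hw l hl hC]; abel
      · have h2 : ∀ i j, (i = n ∨ i = n + 1) → (j = n ∨ j = n + 1) → dist (t i) (t j) < η := by
          intro i j hi hj
          have h3 : |t i - t j| ≤ 1 / (N + 1) := by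
            rw [ht]; simp only
            rw [← sub_div, abs_div, abs_of_pos hN0]
            gcongr
            rcases hi with rfl | rfl <;> rcases hj with rfl | rfl <;> simp
          rw [Real.dist_eq]
          exact h3.trans_lt hN
        have h4 : ∀ b a : X, b = h (t n) a ∨ b = h (t (n + 1)) a →
            ∃ i, (i = n ∨ i = n + 1) ∧ b = h (t i) a := by
          rintro b a (h | h)
          · exact ⟨n, Or.inl rfl, h⟩
          · exact ⟨n + 1, Or.inr rfl, h⟩
        intro l' hl' hb
        refine hf l' (by omega) ⟨fun b hbl => ?_, fun b hbl c hcl => ?_⟩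
        · obtain ⟨a, ha, h'⟩ := hb b hbl
          obtain ⟨i, hi, rfl⟩ := h4 b a h'
          exact hm _ (ht0 i (by omega)) a (hC.1 a ha)
        · obtain ⟨a, ha, h'⟩ := hb b hbl
          obtain ⟨i, hi, rfl⟩ := h4 b a h'
          obtain ⟨a', ha', h'⟩ := hb c hcl
          obtain ⟨j, hj, rfl⟩ := h4 c a' h'
          refine hu (t i, a) ⟨ht0 i (by omega), hC.1 a ha⟩ (t j, a')
            ⟨ht0 j (by omega), hC.1 a' ha'⟩ ?_
          rw [Prod.dist_eq]
          exact max_lt (h2 i j hi hj) (hC.2 a ha a' ha')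
  obtain ⟨w, hw⟩ := key (N + 1) le_rfl
  refine ⟨w, η, hη, fun l hl hC => ?_⟩
  have h1 : t (N + 1) = 1 := by rw [ht]; simp only; push_cast; exact div_self hN0.ne'
  rw [h1] at hw
  exact hw l hl hC

lemma map_on_of_continuousOn {S T : Set X} (hS : IsCompact S) {φ : X → X} (hφ : ContinuousOn φ S)
    (hm : ∀ x ∈ S, φ x ∈ T) : ∀ ε > 0, ∃ δ > 0, ∀ l, (Germ.on S).C δ l →
      (Germ.on T).C ε (l.map φ) := by
  intro ε hε
  obtain ⟨δ, hδ, h⟩ := Metric.uniformContinuousOn_iff.1 (hS.uniformContinuousOn_of_continuous hφ)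
    ε hε
  refine ⟨δ, hδ, fun l hl => ⟨?_, ?_⟩⟩
  · simp only [List.mem_map]
    rintro _ ⟨a, ha, rfl⟩
    exact hm a (hl.1 a ha)
  · simp only [List.mem_map]
    rintro _ ⟨a, ha, rfl⟩ _ ⟨b, hb, rfl⟩
    exact h a (hl.1 a ha) b (hl.1 b hb) (hl.2 a ha b hb)

/-- A set that deforms into an acyclic one is acyclic. -/
lemma KillsAt.of_homotopy {A A' D D' : Set X} (hA : IsCompact A) {k : ℕ} (hD : KillsAt R D' D k)
    (hDA : D' ⊆ A')
    (h : ℝ → X → X) (hc : ContinuousOn (Function.uncurry h) (Icc 0 1 ×ˢ A))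
    (hm : ∀ t ∈ Icc (0 : ℝ) 1, ∀ x ∈ A, h t x ∈ A') (h0 : ∀ x ∈ A, h 0 x = x)
    (h1 : ∀ x ∈ A, h 1 x ∈ D) : KillsAt R A' A k := by
  intro f hf
  obtain ⟨w, hw⟩ := exists_null_homotopy hA h hc hm hf
  obtain ⟨v, hv⟩ := hD f (hf.on_mono hDA)
  have hc1 : ContinuousOn (h 1) A :=
    hc.comp (f := fun x => ((1 : ℝ), x)) (by fun_prop) fun x hx => ⟨by simp, hx⟩
  obtain ⟨ε, hε, h2⟩ := (hv.map (map_on_of_continuousOn hA hc1 h1)).sub hw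
  refine ⟨(fun l => v (l.map (h 1))) - w, ε, hε, fun l hl hC => ?_⟩
  have h3 := h2 l hl hC
  have h4 : l.map (h 0) = l := by
    conv_rhs => rw [← List.map_id l]
    exact List.map_congr_left fun a ha => h0 a (hC.1 a ha)
  simp only [Pi.sub_apply, h4, d_sub, d_map] at h3 ⊢
  rw [← h3]; abel

lemma exists_nearest {A : Set X} (hA : IsCompact A) : ∃ r : X → X, (∀ x ∈ A, r x = x) ∧
    ∀ x ε, (∃ b ∈ A, dist x b < ε) → r x ∈ A ∧ dist x (r x) < ε := by
  classical
  rcases A.eq_empty_or_nonempty with rfl | hne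
  · exact ⟨id, by simp, by simp⟩
  · choose r hr hd using fun x => hA.exists_infDist_eq_dist hne x
    have hr2 : ∀ x ε, (∃ b ∈ A, dist x b < ε) → r x ∈ A ∧ dist x (r x) < ε :=
      fun x ε ⟨b, hb, h⟩ => ⟨hr x, by rw [← hd]; exact (Metric.infDist_le_dist_of_mem hb).trans_lt h⟩
    refine ⟨r, fun x hx => ?_, hr2⟩
    by_contra hne
    have := (hr2 x (dist x (r x)) ⟨x, hx, by simpa using fun h => hne h.symm⟩).2
    exact lt_irrefl _ this

/-- Tautness: a primitive on a compact set extends to a neighbourhood. -/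
lemma Null.exists_near {T A : Set X} (hA : IsCompact A) (hAT : A ⊆ T) {k : ℕ} {f w : List X → R}
    (hf : Null (Germ.near T A) (k + 1) (AlexanderSpanier.d f))
    (hw : Null (Germ.on A) k (f - AlexanderSpanier.d w)) :
    ∃ w', Null (Germ.near T A) k (f - AlexanderSpanier.d w') := by
  obtain ⟨r, _, hr⟩ := exists_nearest hA
  have hd : ∀ (ε : ℝ) (x y : X), (∃ b ∈ A, dist x b < ε / 3) → (∃ b ∈ A, dist y b < ε / 3) →
      dist x y < ε / 3 → dist (r x) y < ε ∧ dist (r x) (r y) < ε := by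
    intro ε x y hx hy hxy
    have h1 := (hr x _ hx).2
    have h2 := (hr y _ hy).2
    have h3 := dist_triangle (r x) x y
    have h4 := dist_triangle (r x) y (r y)
    have h5 := dist_nonneg (x := x) (y := y)
    rw [dist_comm x] at h1
    constructor <;> linarith [dist_nonneg (x := r x) (y := x)]
  have h1 : Null (Germ.near T A) k (fun l => (f - AlexanderSpanier.d w) (l.map r)) := by
    refine hw.map fun ε hε => ⟨ε / 3, by positivity, fun l hl => ⟨?_, ?_⟩⟩
    · simp only [List.mem_map]
      rintro _ ⟨a, ha, rfl⟩
      exact (hr a _ (hl.2.1 a ha)).1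
    · simp only [List.mem_map]
      rintro _ ⟨a, ha, rfl⟩ _ ⟨b, hb, rfl⟩
      exact (hd ε a b (hl.2.1 a ha) (hl.2.1 b hb) (hl.2.2 a ha b hb)).2
  have h2 : Null (Germ.near T A) k ((fun l => f (l.map id)) - (fun l => f (l.map r)) -
      AlexanderSpanier.d (AlexanderSpanier.prism r id f)) := by
    refine hf.prism fun ε hε => ⟨ε / 3, by positivity, fun l hl => ⟨?_, ?_, ?_⟩⟩
    · simp only [List.mem_append, List.mem_map]
      rintro _ (⟨a, ha, rfl⟩ | ⟨a, ha, rfl⟩)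
      · exact hAT (hr a _ (hl.2.1 a ha)).1
      · exact hl.1 a ha
    · simp only [List.mem_append, List.mem_map]
      rintro _ (⟨a, ha, rfl⟩ | ⟨a, ha, rfl⟩)
      · exact ⟨r a, (hr a _ (hl.2.1 a ha)).1, by simpa using hε⟩
      · obtain ⟨b, hb, h⟩ := hl.2.1 a ha
        exact ⟨b, hb, by simp only [id]; linarith⟩
    · simp only [List.mem_append, List.mem_map]
      rintro _ (⟨a, ha, rfl⟩ | ⟨a, ha, rfl⟩) _ (⟨b, hb, rfl⟩ | ⟨b, hb, rfl⟩)
      · exact (hd ε a b (hl.2.1 a ha) (hl.2.1 b hb) (hl.2.2 a ha b hb)).2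
      · exact (hd ε a b (hl.2.1 a ha) (hl.2.1 b hb) (hl.2.2 a ha b hb)).1
      · rw [dist_comm]
        exact (hd ε b a (hl.2.1 b hb) (hl.2.1 a ha) (hl.2.2 b hb a ha)).1
      · have := hl.2.2 a ha b hb
        simp only [id]; linarith
  refine ⟨(fun l => w (l.map r)) + AlexanderSpanier.prism r id f, (h1.add h2).congr fun l _ => ?_⟩
  simp only [Pi.sub_apply, Pi.add_apply, d_add', d_map, List.map_id]
  abel

lemma exists_near_inter {A B : Set X} (hA : IsCompact A) (hB : IsCompact B) {ε : ℝ} (hε : 0 < ε) :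
    ∃ δ > 0, ∀ x, (∃ a ∈ A, dist x a < δ) → (∃ b ∈ B, dist x b < δ) →
      ∃ c ∈ A ∩ B, dist x c < ε := by
  have h1 : IsCompact (A \ Metric.thickening (ε / 2) (A ∩ B)) := hA.diff Metric.isOpen_thickening
  have h2 : Disjoint (A \ Metric.thickening (ε / 2) (A ∩ B)) B := by
    rw [disjoint_left]
    exact fun x hx hxB => hx.2 (Metric.self_subset_thickening (by positivity) _ ⟨hx.1, hxB⟩)
  obtain ⟨δ, hδ, h⟩ := h2.exists_thickenings h1 hB.isClosed
  refine ⟨min δ (ε / 2), by positivity, ?_⟩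
  rintro x ⟨a, ha, hxa⟩ ⟨b, hb, hxb⟩
  by_cases hat : a ∈ Metric.thickening (ε / 2) (A ∩ B)
  · obtain ⟨c, hc, hac⟩ := Metric.mem_thickening_iff.1 hat
    refine ⟨c, hc, ?_⟩
    have := dist_triangle x a c
    have := hxa.trans_le (min_le_right _ _)
    linarith
  · exact (disjoint_left.1 h (Metric.mem_thickening_iff.2 ⟨a, ⟨ha, hat⟩, hxa.trans_le (min_le_left _ _)⟩)
      (Metric.mem_thickening_iff.2 ⟨b, hb, hxb.trans_le (min_le_left _ _)⟩)).elim

end Metric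

section MayerVietoris

variable {X : Type*} [MetricSpace X] {R : Type*} [AddCommGroup R]

open Classical in
/-- The Mayer–Vietoris gluing of two primitives. -/
lemma exists_primitive_union {A A' : Set X} (hA : IsCompact A) (hA' : IsCompact A') {k : ℕ}
    (KA : KillsAt R A A k) (KA' : KillsAt R A' A' k) {f w w' v : List X → R}
    (hf : Null (Germ.on (A ∪ A')) (k + 2) (d f))
    (hw : Null (Germ.on A) (k + 1) (f - d w)) (hw' : Null (Germ.on A') (k + 1) (f - d w'))
    (hv : Null (Germ.on (A ∩ A')) k (w - w' - d v)) :
    ∃ u, Null (Germ.on (A ∪ A')) (k + 1) (f - d u) := by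
  obtain ⟨w₁, hw₁⟩ := hf.near_of_on.exists_near hA subset_union_left hw
  obtain ⟨w₂, hw₂⟩ := hf.near_of_on.exists_near hA' subset_union_right hw'
  obtain ⟨y, hy⟩ := KA (w₁ - w) ((hw.sub (hw₁.on_of_near subset_rfl subset_union_left)).congr
    fun l _ => by simp [d_sub])
  obtain ⟨y', hy'⟩ := KA' (w₂ - w') ((hw'.sub (hw₂.on_of_near subset_rfl subset_union_right)).congr
    fun l _ => by simp [d_sub])
  have h1 : Null (Germ.on (A ∩ A')) k (w₁ - w₂ - d (v + y - y')) :=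
    (((hv.add (hy.on_mono inter_subset_left)).sub (hy'.on_mono inter_subset_right))).congr
      fun l _ => by simp only [d_sub, d_add', Pi.sub_apply, Pi.add_apply]; abel
  have h2 : Null (Germ.near (A ∪ A') (A ∩ A')) (k + 1) (d (w₁ - w₂)) := by
    have h3 : Null (Germ.near (A ∪ A') (A ∩ A')) (k + 1) (f - d w₁) := hw₁.of_le fun ε hε =>
      ⟨ε, hε, fun l hl => ⟨hl.1, fun a ha => (hl.2.1 a ha).imp fun b hb => ⟨hb.1.1, hb.2⟩, hl.2.2⟩⟩
    have h4 : Null (Germ.near (A ∪ A') (A ∩ A')) (k + 1) (f - d w₂) := hw₂.of_le fun ε hε =>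
      ⟨ε, hε, fun l hl => ⟨hl.1, fun a ha => (hl.2.1 a ha).imp fun b hb => ⟨hb.1.2, hb.2⟩, hl.2.2⟩⟩
    exact (h4.sub h3).congr fun l _ => by simp [d_sub]
  obtain ⟨v₁, ε₁, hε₁, hv₁⟩ := h2.exists_near (hA.inter hA')
    (inter_subset_left.trans subset_union_left) h1
  obtain ⟨ε₂, hε₂, hw₁⟩ := hw₁
  obtain ⟨ε₃, hε₃, hw₂⟩ := hw₂
  obtain ⟨δ, hδ, hnear⟩ := exists_near_inter hA hA' hε₁
  refine ⟨fun l => if ∃ a ∈ l, a ∈ A then (w₁ - d v₁) l else w₂ l, min (min ε₁ ε₂) (min ε₃ δ),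
    by positivity, fun l hl hC => ?_⟩
  by_cases hlA : ∃ a ∈ l, a ∈ A
  · obtain ⟨a, ha, haA⟩ := hlA
    have h3 := hw₁ l hl ⟨hC.1, fun b hb => ⟨a, haA, (hC.2 b hb a ha).trans_le (by simp)⟩,
      fun b hb c hc => (hC.2 b hb c hc).trans_le (by simp)⟩
    rw [← h3]
    simp only [Pi.sub_apply]
    congr 1
    have h4 : d w₁ l = d (w₁ - d v₁) l := by rw [d_sub, d_d, sub_zero]
    rw [h4]
    refine d_congr _ fun l' hl' hlen => ?_
    split_ifs with h5
    · rfl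
    · push Not at h5
      have h6 := hv₁ l' (by omega) ⟨fun b hb => hC.1 b (hl'.subset hb), fun b hb => hnear b
        ⟨a, haA, (hC.2 b (hl'.subset hb) a ha).trans_le (by simp)⟩
        ⟨b, (hC.1 b (hl'.subset hb)).resolve_left (h5 b hb), by simpa using hδ⟩,
        fun b hb c hc => (hC.2 b (hl'.subset hb) c (hl'.subset hc)).trans_le (by simp)⟩
      simp only [Pi.sub_apply] at h6 ⊢
      rw [sub_right_comm, sub_eq_zero] at h6
      exact h6.symm
  · push Not at hlA
    have hlA' : ∀ a ∈ l, a ∈ A' := fun a ha => (hC.1 a ha).resolve_left (hlA a ha)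
    have h3 := hw₂ l hl ⟨hC.1, fun b hb => ⟨b, hlA' b hb, by simpa using hε₃⟩,
      fun b hb c hc => (hC.2 b hb c hc).trans_le (by simp)⟩
    rw [← h3]
    simp only [Pi.sub_apply]
    congr 1
    refine d_congr _ fun l' hl' hlen => ?_
    rw [if_neg]
    push Not
    exact fun b hb => hlA b (hl'.subset hb)

end MayerVietoris

section Sphere

variable {X : Type*} [MetricSpace X] (𝕜 : Type*) [Field 𝕜]

/-- `S` has the reduced cohomology of a sphere, concentrated on lists of length `N`. -/
def Sph (N : ℕ) (S : Set X) : Prop :=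
  (∀ m, m ≠ N → KillsAt 𝕜 S S m) ∧ ∃ v : List X → 𝕜, Null (Germ.on S) (N + 1) (d v) ∧
    (¬ ∃ w, Null (Germ.on S) N (v - d w)) ∧
    ∀ f : List X → 𝕜, Null (Germ.on S) (N + 1) (d f) →
      ∃ c : 𝕜, ∃ w, Null (Germ.on S) N (f - c • v - d w)

lemma sph_empty : Sph 𝕜 0 (∅ : Set X) := by
  have h : ∀ (m : ℕ) (f : List X → 𝕜), m ≠ 0 → Null (Germ.on ∅) m f := by
    intro m f hm
    refine ⟨1, one_pos, fun l hl hC => ?_⟩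
    cases l with
    | nil => exact absurd hl.symm hm
    | cons a l => exact (hC.1 a (by simp)).elim
  refine ⟨fun m hm f _ => ⟨0, h m _ hm⟩, fun _ => 1, h _ _ (by simp), ?_, fun f _ => ⟨f [], 0, ?_⟩⟩
  · rintro ⟨w, hw⟩
    simp [null_on_zero] at hw
  · simp [null_on_zero]

open Classical in
lemma Sph.union {N : ℕ} {A A' : Set X} (hA : IsCompact A) (hA' : IsCompact A')
    (KA : Kills 𝕜 A A) (KA' : Kills 𝕜 A' A') (hS : Sph 𝕜 N (A ∩ A')) :
    Sph 𝕜 (N + 1) (A ∪ A') := by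
  obtain ⟨hS0, v, hv, hvne, hgen⟩ := hS
  refine ⟨fun m hm => ?_, ?_⟩
  · cases m with
    | zero =>
      intro f hf
      obtain ⟨w, hw⟩ := KA 0 f (hf.on_mono subset_union_left)
      rw [null_on_zero] at hw
      exact ⟨w, null_on_zero.2 hw⟩
    | succ m =>
      intro f hf
      obtain ⟨w, hw⟩ := KA (m + 1) f (hf.on_mono subset_union_left)
      obtain ⟨w', hw'⟩ := KA' (m + 1) f (hf.on_mono subset_union_right)
      obtain ⟨u, hu⟩ := hS0 m (by simpa using hm) (w - w')
        (((hw'.on_mono inter_subset_right).sub (hw.on_mono inter_subset_left)).congr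
          fun l _ => by simp [d_sub])
      exact exists_primitive_union hA hA' (KA m) (KA' m) hf hw hw' hu
  obtain ⟨r, hr1, hr2⟩ := exists_nearest (hA.inter hA')
  set v' : List X → 𝕜 := fun l => v (l.map r) with hv'
  have hvv' : ∀ l : List X, (∀ a ∈ l, a ∈ A ∩ A') → v' l = v l := by
    intro l hl
    have : l.map r = l := by
      conv_rhs => rw [← List.map_id l]
      exact List.map_congr_left fun a ha => hr1 a (hl a ha)
    rw [hv']; simp only [this]
  have hdv' : Null (Germ.near (A ∪ A') (A ∩ A')) (N + 1) (d v') := by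
    refine (hv.map (G := Germ.near (A ∪ A') (A ∩ A')) (φ := r) fun ε hε =>
      ⟨ε / 3, by positivity, fun l hl => ⟨?_, ?_⟩⟩).congr fun l _ => by rw [hv', d_map]
    · simp only [List.mem_map]
      rintro _ ⟨a, ha, rfl⟩
      exact (hr2 a _ (hl.2.1 a ha)).1
    · simp only [List.mem_map]
      rintro _ ⟨a, ha, rfl⟩ _ ⟨b, hb, rfl⟩
      have h1 := (hr2 a _ (hl.2.1 a ha)).2
      have h2 := (hr2 b _ (hl.2.1 b hb)).2
      have h3 := dist_triangle (r a) a (r b)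
      have h4 := dist_triangle a b (r b)
      have h5 := hl.2.2 a ha b hb
      rw [dist_comm a] at h1
      linarith
  obtain ⟨ε₁, hε₁, hdv'⟩ := hdv'
  obtain ⟨δ, hδ, hnear⟩ := exists_near_inter hA hA' hε₁
  set e : List X → 𝕜 := fun l => if ∀ a ∈ l, a ∈ A then v' l else 0 with he
  set f₀ : List X → 𝕜 := fun l => if ∀ a ∈ l, a ∈ A then 0 else d e l with hf₀
  have hde : ∀ l : List X, l.length = N + 1 → (Germ.near (A ∪ A') (A ∩ A')).C ε₁ l →
      (∀ a ∈ l, a ∈ A) → d e l = 0 := by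
    intro l hl hC hlA
    rw [← hdv' l hl hC]
    refine d_congr _ fun l' hl' _ => ?_
    rw [he]; simp only
    rw [if_pos fun a ha => hlA a (hl'.subset ha)]
  have hfA : Null (Germ.on A) (N + 1) f₀ := ⟨1, one_pos, fun l _ hC => by
    rw [hf₀]; simp only; rw [if_pos hC.1]⟩
  have hfA' : Null (Germ.on A') (N + 1) (f₀ - d e) := by
    refine ⟨ε₁, hε₁, fun l hl hC => ?_⟩
    rw [Pi.sub_apply, hf₀]
    simp only
    split_ifs with h
    · rw [hde l hl ⟨fun a ha => Or.inl (h a ha), fun a ha => ⟨a, ⟨h a ha, hC.1 a ha⟩,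
        by simpa using hε₁⟩, hC.2⟩ h, sub_zero]
    · rw [sub_self]
  have hev : Null (Germ.on (A ∩ A')) N (e - v) := ⟨1, one_pos, fun l hl hC => by
    rw [Pi.sub_apply, he]; simp only; rw [if_pos fun a ha => (hC.1 a ha).1, hvv' l hC.1, sub_self]⟩
  have hf₀c : Null (Germ.on (A ∪ A')) (N + 2) (d f₀) := by
    refine ⟨min ε₁ δ, by positivity, fun l hl hC => ?_⟩
    by_cases hlA : ∀ a ∈ l, a ∈ A
    · refine d_eq_zero fun l' hl' _ => ?_
      rw [hf₀]; simp only
      rw [if_pos fun a ha => hlA a (hl'.subset ha)]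
    · push Not at hlA
      obtain ⟨a, ha, haA⟩ := hlA
      have haA' := (hC.1 a ha).resolve_left haA
      have h0 : d (d e) l = 0 := by rw [d_d]; rfl
      rw [← h0]
      refine d_congr _ fun l' hl' hlen => ?_
      rw [hf₀]; simp only
      split_ifs with h
      · rw [hde l' (by omega) ⟨fun b hb => Or.inl (h b hb), fun b hb => hnear b
          ⟨b, h b hb, by simpa using hδ⟩
          ⟨a, haA', (hC.2 b (hl'.subset hb) a ha).trans_le (by simp)⟩,
          fun b hb c hc => (hC.2 b (hl'.subset hb) c (hl'.subset hc)).trans_le (by simp)⟩ h]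
      · rfl
  refine ⟨f₀, hf₀c, ?_, fun f hf => ?_⟩
  · rintro ⟨w, hw⟩
    obtain ⟨y, hy⟩ := KA N w ((hfA.sub (hw.on_mono subset_union_left)).congr fun l _ => by simp)
    obtain ⟨y', hy'⟩ := KA' N (w - e) ((hfA'.sub (hw.on_mono subset_union_right)).congr
      fun l _ => by simp [d_sub])
    refine hvne ⟨y - y', (((hy.on_mono inter_subset_left).sub
      (hy'.on_mono inter_subset_right)).sub hev).congr fun l _ => ?_⟩
    simp only [Pi.sub_apply, d_sub]
    ring
  · obtain ⟨w, hw⟩ := KA (N + 1) f (hf.on_mono subset_union_left)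
    obtain ⟨w', hw'⟩ := KA' (N + 1) f (hf.on_mono subset_union_right)
    obtain ⟨c, u, hu⟩ := hgen (w - w')
      (((hw'.on_mono inter_subset_right).sub (hw.on_mono inter_subset_left)).congr
        fun l _ => by simp [d_sub])
    refine ⟨-c, exists_primitive_union hA hA' (KA N) (KA' N) (f := f - (-c) • f₀) (w := w)
      (w' := w' - (-c) • e) (v := u) ?_ ?_ ?_ ?_⟩
    · rw [d_sub, d_smul]
      exact hf.sub (hf₀c.smul _)
    · exact (hw.sub (hfA.smul (-c))).congr fun l _ => by simp; ring
    · exact (hw'.sub (hfA'.smul (-c))).congr fun l _ => by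
        simp only [d_sub, d_smul, Pi.sub_apply, Pi.smul_apply, smul_eq_mul]; ring
    · exact (hu.sub (hev.smul c)).congr fun l _ => by simp; ring

end Sphere

section Alternating

variable {V R : Type*} [AddCommGroup R]

/-- A predicate on lists that is inherited by lists of entries. -/
def Hereditary (P : List V → Prop) : Prop := ∀ l l' : List V, l' ⊆ l → P l → P l'

/-- A cochain is alternating on the lists satisfying `P`. -/
def Alt (P : List V → Prop) (f : List V → R) : Prop :=
  (∀ u v a b, P (u ++ a :: b :: v) → f (u ++ a :: b :: v) = -f (u ++ b :: a :: v)) ∧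
    ∀ u v a, P (u ++ a :: a :: v) → f (u ++ a :: a :: v) = 0

lemma Hereditary.cons {P : List V → Prop} (hP : Hereditary P) (c : V) :
    Hereditary (fun l => P (c :: l)) :=
  fun _ _ h hl => hP _ _ (List.cons_subset_cons _ h) hl

lemma Alt.cons {P : List V → Prop} {f : List V → R} (h : Alt P f) (c : V) :
    Alt (fun l => P (c :: l)) (fun l => f (c :: l)) :=
  ⟨fun u v a b => h.1 (c :: u) v a b, fun u v a => h.2 (c :: u) v a⟩

lemma Alt.d {f : List V → R} {P : List V → Prop} (hP : Hereditary P) (h : Alt P f) :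
    Alt P (d f) := by
  constructor
  · intro u
    induction u generalizing f P with
    | nil =>
      intro v a b hp
      simp only [List.nil_append] at hp ⊢
      rw [d_cons f, d_cons f, d_cons, d_cons]
      have : AlexanderSpanier.d (fun l' => f (a :: b :: l')) v =
          AlexanderSpanier.d (-fun l' => f (b :: a :: l')) v := by
        refine d_congr _ fun l' hl' _ => h.1 [] l' a b (hP _ _ ?_ hp)
        exact List.cons_subset_cons _ (List.cons_subset_cons _ hl'.subset)
      rw [this, d_neg, Pi.neg_apply]; abel
    | cons c u ih =>
      intro v a b hp
      rw [List.cons_append, List.cons_append, d_cons, d_cons, ih (hP.cons c) (h.cons c) v a b hp,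
        h.1 u v a b (hP _ _ (List.subset_cons_self _ _) hp)]
      abel
  · intro u
    induction u generalizing f P with
    | nil =>
      intro v a hp
      simp only [List.nil_append] at hp ⊢
      rw [d_cons f, d_cons]
      have : AlexanderSpanier.d (fun l' => f (a :: a :: l')) v = 0 := by
        refine d_eq_zero fun l' hl' _ => h.2 [] l' a (hP _ _ ?_ hp)
        exact List.cons_subset_cons _ (List.cons_subset_cons _ hl'.subset)
      rw [this]; abel
    | cons c u ih =>
      intro v a hp
      rw [List.cons_append, d_cons, ih (hP.cons c) (h.cons c) v a hp,
        h.2 u v a (hP _ _ (List.subset_cons_self _ _) hp), sub_zero]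

lemma Alt.perm {l l' : List V} (hl : l.Perm l') : ∀ {f : List V → R} {P : List V → Prop},
    Hereditary P → Alt P f → P l → f l = f l' ∨ f l = -f l' := by
  induction hl with
  | nil => intros; exact Or.inl rfl
  | cons a _ ih => intro f P hP h hp; exact ih (hP.cons a) (h.cons a) hp
  | swap a b l => intro f P hP h hp; exact Or.inr (h.1 [] l b a hp)
  | trans h1 h2 ih1 ih2 =>
    intro f P hP h hp
    have := ih2 hP h (hP _ _ h1.symm.subset hp)
    rcases ih1 hP h hp with h | h <;> rcases this with h' | h' <;> simp [h, h']

lemma Alt.eq_zero_of_not_nodup {l : List V} {f : List V → R} {P : List V → Prop}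
    (hP : Hereditary P) (h : Alt P f) (hp : P l) (hl : ¬ l.Nodup) : f l = 0 := by
  classical
  rw [← List.exists_duplicate_iff_not_nodup] at hl
  obtain ⟨a, ha⟩ := hl
  have h1 : l.Perm (a :: a :: (l.erase a).erase a) := by
    refine (List.perm_cons_erase ha.mem).trans (List.Perm.cons _ (List.perm_cons_erase ?_))
    rw [List.duplicate_iff_two_le_count] at ha
    rw [← List.count_pos_iff, List.count_erase_self]
    omega
  have h2 := h.2 [] ((l.erase a).erase a) a (hP _ _ h1.symm.subset hp)
  rw [List.nil_append] at h2
  rcases Alt.perm h1 hP h hp with h | h <;> simp [h, h2]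

end Alternating

section Colours

variable {p : ℕ}

/-- Lists of coloured residues with at most one residue of each colour. -/
def Good (l : List (ℕ × ZMod p)) : Prop := ∀ a ∈ l, ∀ b ∈ l, a.1 = b.1 → a.2 = b.2

/-- Rotation of the residues. -/
def rot (i : ZMod p) (v : ℕ × ZMod p) : ℕ × ZMod p := (v.1, v.2 + i)

lemma hereditary_good : Hereditary (Good (p := p)) :=
  fun _ _ h hl a ha b hb => hl a (h ha) b (h hb)

lemma Good.rot {l : List (ℕ × ZMod p)} (h : Good l) (i : ZMod p) : Good (l.map (rot i)) := by
  unfold Good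
  simp only [List.mem_map]
  rintro _ ⟨a, ha, rfl⟩ _ ⟨b, hb, rfl⟩ hab
  simp only [AlexanderSpanier.rot] at hab ⊢
  rw [h a ha b hb hab]

lemma map_rot_rot (i j : ZMod p) (l : List (ℕ × ZMod p)) :
    (l.map (rot i)).map (rot j) = l.map (rot (i + (j : ZMod p))) := by
  rw [List.map_map]
  refine List.map_congr_left fun a _ => ?_
  simp [rot, add_assoc]

lemma map_rot_zero (l : List (ℕ × ZMod p)) : l.map (rot 0) = l := by
  conv_rhs => rw [← List.map_id l]
  exact List.map_congr_left fun a _ => by simp [rot]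

open Classical in
/-- The residue of the least colour in a list. -/
noncomputable def leastRes (l : List (ℕ × ZMod p)) : ZMod p :=
  if h : ∃ v ∈ l, ∀ u ∈ l, v.1 ≤ u.1 then h.choose.2 else 0

lemma leastRes_eq {l : List (ℕ × ZMod p)} (hl : Good l) {v : ℕ × ZMod p} (hv : v ∈ l)
    (hmin : ∀ u ∈ l, v.1 ≤ u.1) : leastRes l = v.2 := by
  have h : ∃ v ∈ l, ∀ u ∈ l, v.1 ≤ u.1 := ⟨v, hv, hmin⟩
  rw [leastRes, dif_pos h]
  exact hl _ h.choose_spec.1 _ hv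
    (le_antisymm (h.choose_spec.2 v hv) (hmin _ h.choose_spec.1))

lemma exists_least {l : List (ℕ × ZMod p)} (hl : l ≠ []) : ∃ v ∈ l, ∀ u ∈ l, v.1 ≤ u.1 := by
  obtain ⟨v, hv, h⟩ := l.toFinset.exists_min_image Prod.fst (List.toFinset_nonempty_iff _ |>.2 hl)
  exact ⟨v, by simpa using hv, fun u hu => h u (by simpa using hu)⟩

lemma leastRes_rot {l : List (ℕ × ZMod p)} (hl : Good l) (hne : l ≠ []) (i : ZMod p) :
    leastRes (l.map (rot i)) = leastRes l + i := by
  obtain ⟨v, hv, hmin⟩ := exists_least hne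
  rw [leastRes_eq hl hv hmin, leastRes_eq (hl.rot i) (v := rot i v) (List.mem_map_of_mem hv)]
  · rfl
  · simp only [List.mem_map]
    rintro _ ⟨u, hu, rfl⟩
    exact hmin u hu

lemma leastRes_perm {l l' : List (ℕ × ZMod p)} (hl : Good l) (hne : l ≠ []) (h : l.Perm l') :
    leastRes l = leastRes l' := by
  obtain ⟨v, hv, hmin⟩ := exists_least hne
  rw [leastRes_eq hl hv hmin, leastRes_eq (hereditary_good _ _ h.symm.subset hl)
    (h.subset hv) fun u hu => hmin u (h.symm.subset hu)]

variable [NeZero p] {𝕜 : Type*} [CommRing 𝕜]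

/-- A cochain on coloured residues that is alternating and homogeneous on good lists. -/
def Nice (s : ℕ) (F : List (ℕ × ZMod p) → 𝕜) : Prop :=
  Alt Good F ∧ ∀ l, Good l → l.length ≠ s → F l = 0

lemma map_append_swap {V : Type*} (φ : V → V) (u v : List V) (a b : V) :
    (u ++ a :: b :: v).map φ = u.map φ ++ φ a :: φ b :: v.map φ := by simp

lemma exists_norm_preimage {s : ℕ} (hs : s ≠ 0) {F : List (ℕ × ZMod p) → 𝕜} (hF : Nice s F)
    (hinv : ∀ l, Good l → F (l.map (rot 1)) = F l) :
    ∃ h : List (ℕ × ZMod p) → 𝕜, Nice s h ∧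
      ∀ l, Good l → ∑ i ∈ Finset.range p, h (l.map (rot i)) = F l := by
  classical
  refine ⟨fun l => if leastRes l = 0 then F l else 0, ⟨⟨?_, ?_⟩, ?_⟩, ?_⟩
  · intro u v a b hp
    have := leastRes_perm hp (by simp) (l' := u ++ b :: a :: v)
      (List.Perm.append_left u (List.Perm.swap b a v))
    simp only [this]
    split_ifs
    · exact hF.1.1 u v a b hp
    · simp
  · intro u v a hp
    simp only [hF.1.2 u v a hp, ite_self]
  · intro l hl hls
    simp only [hF.2 l hl hls, ite_self]
  · intro l hl
    have hinv' : ∀ n : ℕ, F (l.map (rot (n : ZMod p))) = F l := by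
      intro n
      induction n with
      | zero => rw [Nat.cast_zero, map_rot_zero]
      | succ n ih => rw [Nat.cast_succ, ← map_rot_rot, hinv _ (hl.rot _), ih]
    by_cases hne : l = []
    · subst hne
      have h0 : F [] = 0 := hF.2 [] hl (by simpa using hs.symm)
      simp [h0]
    · simp only [leastRes_rot hl hne, hinv']
      rw [Finset.sum_eq_single (-leastRes l).val]
      · simp
      · intro i hi hne'
        rw [if_neg]
        intro h
        apply hne'
        rw [← eq_neg_of_add_eq_zero_right h, ZMod.val_natCast_of_lt (Finset.mem_range.1 hi)]
      · intro h
        exact (h (Finset.mem_range.2 (ZMod.val_lt _))).elim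

lemma exists_diff_preimage {s : ℕ} (hs : s ≠ 0) {F : List (ℕ × ZMod p) → 𝕜} (hF : Nice s F)
    (hsum : ∀ l, Good l → ∑ i ∈ Finset.range p, F (l.map (rot i)) = 0) :
    ∃ h : List (ℕ × ZMod p) → 𝕜, Nice s h ∧
      ∀ l, Good l → h l - h (l.map (rot 1)) = F l := by
  classical
  refine ⟨fun l =>
    -∑ j ∈ Finset.range (leastRes l).val, F (l.map (rot (-leastRes l + (j : ZMod p)))),
    ⟨⟨?_, ?_⟩, ?_⟩, ?_⟩
  · intro u v a b hp
    have := leastRes_perm hp (by simp) (l' := u ++ b :: a :: v)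
      (List.Perm.append_left u (List.Perm.swap b a v))
    simp only [this]
    congr 1
    rw [← Finset.sum_neg_distrib]
    refine Finset.sum_congr rfl fun j _ => ?_
    have h1 := hp.rot (-leastRes (u ++ b :: a :: v) + (j : ZMod p))
    rw [map_append_swap] at h1 ⊢
    rw [map_append_swap]
    exact hF.1.1 _ _ _ _ h1
  · intro u v a hp
    simp only
    refine neg_eq_zero.2 (Finset.sum_eq_zero fun j _ => ?_)
    have h1 := hp.rot (-leastRes (u ++ a :: a :: v) + (j : ZMod p))
    rw [map_append_swap] at h1 ⊢
    exact hF.1.2 _ _ _ h1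
  · intro l hl hls
    simp only
    refine neg_eq_zero.2 (Finset.sum_eq_zero fun j _ => ?_)
    exact hF.2 _ (hl.rot _) (by simpa using hls)
  · intro l hl
    by_cases hne : l = []
    · subst hne
      have h0 : F [] = 0 := hF.2 [] hl (by simpa using hs.symm)
      simp [h0]
    · have h1 : ∀ j : ℕ, ((l.map (rot 1)).map (rot (-leastRes (l.map (rot 1)) + (j : ZMod p)))) =
          l.map (rot (-leastRes l + (j : ZMod p))) := by
        intro j
        rw [map_rot_rot, leastRes_rot hl hne]
        congr 2; ring
      simp only [h1]
      rw [leastRes_rot hl hne]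
      have h2 : F (l.map (rot (-leastRes l + ((leastRes l).val : ℕ)))) = F l := by
        rw [ZMod.natCast_zmod_val, neg_add_cancel, map_rot_zero]
      have hlt := ZMod.val_lt (leastRes l)
      rcases Nat.lt_or_ge ((leastRes l).val + 1) p with h3 | h3
      · have h4 : (leastRes l + 1).val = (leastRes l).val + 1 := by
          rw [ZMod.val_add_of_lt]
          · rw [ZMod.val_one'' (by omega)]
          · rwa [ZMod.val_one'' (by omega)]
        rw [h4, Finset.sum_range_succ, h2]; ring
      · have h4 : leastRes l + 1 = 0 := by
          rw [← ZMod.natCast_zmod_val (leastRes l), ← Nat.cast_succ,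
            show (leastRes l).val.succ = p by omega, ZMod.natCast_self]
        have h5 := hsum (l.map (rot (-leastRes l))) (hl.rot _)
        simp only [map_rot_rot] at h5
        rw [show Finset.range p = Finset.range ((leastRes l).val + 1) from
          congrArg _ (by omega), Finset.sum_range_succ, h2] at h5
        rw [h4]
        simp only [ZMod.val_zero, Finset.range_zero, Finset.sum_empty, neg_zero, sub_zero]
        linear_combination -h5

end Colours

section Resolution

variable {p : ℕ} {𝕜 : Type*} [CommRing 𝕜]

lemma Nice.d {s : ℕ} {F : List (ℕ × ZMod p) → 𝕜} (hF : Nice s F) : Nice (s + 1) (d F) :=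
  ⟨hF.1.d hereditary_good, fun _ hl hs => d_eq_zero fun l' hl' hlen =>
    hF.2 l' (hereditary_good _ _ hl'.subset hl) (by omega)⟩

lemma Nice.eq_zero {s N : ℕ} {F : List (ℕ × ZMod p) → 𝕜} (hF : Nice s F) (hs : N < s)
    {l : List (ℕ × ZMod p)} (hl : Good l) (hN : ∀ a ∈ l, a.1 < N) : F l = 0 := by
  by_cases hlen : l.length = s
  · refine hF.1.eq_zero_of_not_nodup hereditary_good hl fun hnd => ?_
    have h1 : (l.map Prod.fst).Nodup := hnd.map_on fun a ha b hb hab => Prod.ext hab (hl a ha b hb hab)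
    have h2 : l.map Prod.fst ⊆ List.range N := by
      intro n hn
      obtain ⟨a, ha, rfl⟩ := List.mem_map.1 hn
      exact List.mem_range.2 (hN a ha)
    have := (List.subperm_of_subset h1 h2).length_le
    simp only [List.length_map, List.length_range] at this
    omega
  · exact hF.2 l hl hlen

/-- An alternating periodic resolution on lists of coloured residues. -/
lemma exists_resolution [NeZero p] : ∃ η : ℕ → List (ℕ × ZMod p) → 𝕜, (∀ s, Nice s (η s)) ∧
    (η 0 = fun l => if l = [] then 1 else 0) ∧
    ∀ s l, Good l → d (η s) l = if Even s then ∑ i ∈ Finset.range p, η (s + 1) (l.map (rot i))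
      else η (s + 1) l - η (s + 1) (l.map (rot 1)) := by
  set Q : ℕ → (List (ℕ × ZMod p) → 𝕜) → Prop := fun s F => Nice s F ∧ ∀ l, Good l →
    if Even s then d F (l.map (rot 1)) = d F l
      else ∑ i ∈ Finset.range p, d F (l.map (rot i)) = 0 with hQ
  have step : ∀ (s : ℕ) (F : List (ℕ × ZMod p) → 𝕜), ∃ F', Q s F → (Q (s + 1) F' ∧
      ∀ l, Good l → d F l = if Even s then ∑ i ∈ Finset.range p, F' (l.map (rot i))
        else F' l - F' (l.map (rot 1))) := by
    intro s F
    by_cases hF : Q s F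
    swap
    · exact ⟨0, fun h => (hF h).elim⟩
    by_cases hs : Even s
    · have hs' : ¬ Even (s + 1) := by simpa [Nat.even_add_one] using hs
      obtain ⟨F', h1, h2⟩ := exists_norm_preimage (by omega) hF.1.d fun l hl => by
        simpa [hs] using hF.2 l hl
      refine ⟨F', fun _ => ⟨⟨h1, fun l hl => ?_⟩, fun l hl => by simp [hs, h2 l hl]⟩⟩
      rw [if_neg hs']
      have h3 : ∑ i ∈ Finset.range p, d F' (l.map (rot i)) =
          d (∑ i ∈ Finset.range p, fun l => F' (l.map (rot (i : ZMod p)))) l := by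
        rw [d_sum, Finset.sum_apply]
        exact Finset.sum_congr rfl fun i _ => by rw [d_map]
      have h4 : d (d F) l = 0 := by rw [d_d]; rfl
      rw [h3, ← h4]
      refine d_congr _ fun l' hl' _ => ?_
      rw [Finset.sum_apply, h2 l' (hereditary_good _ _ hl'.subset hl)]
    · have hs' : Even (s + 1) := by simpa [Nat.even_add_one] using hs
      obtain ⟨F', h1, h2⟩ := exists_diff_preimage (by omega) hF.1.d fun l hl => by
        simpa [hs] using hF.2 l hl
      refine ⟨F', fun _ => ⟨⟨h1, fun l hl => ?_⟩, fun l hl => by simp [hs, h2 l hl]⟩⟩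
      rw [if_pos hs', ← d_map, eq_comm, ← sub_eq_zero, ← Pi.sub_apply, ← d_sub]
      have h4 : d (d F) l = 0 := by rw [d_d]; rfl
      rw [← h4]
      refine d_congr _ fun l' hl' _ => ?_
      rw [Pi.sub_apply, h2 l' (hereditary_good _ _ hl'.subset hl)]
  choose nxt hnxt using step
  set η : ℕ → List (ℕ × ZMod p) → 𝕜 := fun s => Nat.rec (fun l => if l = [] then 1 else 0) nxt s
    with hη
  have h0 : Q 0 (η 0) := by
    refine ⟨⟨⟨fun u v a b _ => ?_, fun u v a _ => ?_⟩, fun l _ hl => ?_⟩, fun l _ => ?_⟩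
    · simp [hη]
    · simp [hη]
    · have : l ≠ [] := by rintro rfl; exact hl rfl
      simp [hη, this]
    · rw [if_pos Even.zero, ← d_map]
      congr 1
      funext l'
      simp [hη]
  have hall : ∀ s, Q s (η s) := by
    intro s
    induction s with
    | zero => exact h0
    | succ s ih => exact (hnxt s (η s) ih).1
  exact ⟨η, fun s => (hall s).1, rfl, fun s => (hnxt s (η s) (hall s)).2⟩

end Resolution

section Zigzag

variable {X : Type*} {𝕜 : Type*} [CommRing 𝕜]

lemma cup_map {Y : Type*} (φ : X → Y) (f g : List Y → 𝕜) (l : List X) :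
    cup f g (l.map φ) = cup (fun l => f (l.map φ)) (fun l => g (l.map φ)) l := by
  induction l generalizing f with
  | nil => simp
  | cons a l ih => rw [List.map_cons, cup_cons, cup_cons, ih]; simp

/-- The alternating operators: the norm for even `s`, the difference for odd `s`. -/
def per (p : ℕ) (g : X → X) (s : ℕ) (f : List X → 𝕜) : List X → 𝕜 := fun l =>
  if Even s then ∑ i ∈ Finset.range p, f (l.map g^[i]) else f l - f (l.map g)

lemma d_per (p : ℕ) (g : X → X) (s : ℕ) (f : List X → 𝕜) :
    d (per p g s f) = per p g s (d f) := by
  funext l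
  by_cases hs : Even s
  · have : per p g s f = ∑ i ∈ Finset.range p, fun l => f (l.map g^[i]) := by
      funext l; simp [per, hs]
    rw [this, d_sum, Finset.sum_apply]
    simp only [per, hs, if_true]
    exact Finset.sum_congr rfl fun i _ => by rw [d_map]
  · have : per p g s f = f - fun l => f (l.map g) := by
      funext l; simp [per, hs]
    rw [this, d_sub, Pi.sub_apply, d_map]
    simp [per, hs]

lemma per_sub (p : ℕ) (g : X → X) (s : ℕ) (f f' : List X → 𝕜) :
    per p g s (f - f') = per p g s f - per p g s f' := by
  funext l
  by_cases hs : Even s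
  · simp [per, hs]
  · simp [per, hs]; ring

lemma per_per (p : ℕ) (g : X → X) (s : ℕ) (f : List X → 𝕜) (l : List X)
    (hl : ∀ a ∈ l, g^[p] a = a) : per p g s (per p g (s + 1) f) l = 0 := by
  have h0 : l.map g^[0] = l := by simp
  have h1 : l.map g^[p] = l := by
    conv_rhs => rw [← List.map_id l]
    exact List.map_congr_left fun a ha => hl a ha
  have h2 : ∀ i, (l.map g^[i]).map g = l.map g^[i + 1] := fun i => by
    rw [List.map_map, Function.iterate_succ']
  have h3 : ∀ i, (l.map g).map g^[i] = l.map g^[i + 1] := fun i => by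
    rw [List.map_map, Function.iterate_succ]
  by_cases hs : Even s
  · have hs' : ¬ Even (s + 1) := by simpa [Nat.even_add_one] using hs
    simp only [per, hs, hs', if_true, if_false, h2]
    rw [Finset.sum_range_sub' (fun i => f (l.map g^[i])), h0, h1, sub_self]
  · have hs' : Even (s + 1) := by simpa [Nat.even_add_one] using hs
    simp only [per, hs, hs', if_true, if_false, h3]
    rw [← Finset.sum_sub_distrib, Finset.sum_range_sub' (fun i => f (l.map g^[i])), h0, h1, sub_self]

variable [MetricSpace X]

lemma Null.per {p : ℕ} {g : X → X} {S : Set X} (hS : IsCompact S) (hg : ContinuousOn g S)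
    (hm : ∀ x ∈ S, g x ∈ S) (s : ℕ) {k : ℕ} {f : List X → 𝕜} (hf : Null (Germ.on S) k f) :
    Null (Germ.on S) k (per p g s f) := by
  have hi : ∀ i, ContinuousOn g^[i] S ∧ ∀ x ∈ S, g^[i] x ∈ S := by
    intro i
    induction i with
    | zero => exact ⟨continuousOn_id, fun x hx => hx⟩
    | succ i ih =>
      rw [Function.iterate_succ]
      exact ⟨ih.1.comp hg hm, fun x hx => ih.2 _ (hm x hx)⟩
  by_cases hs : Even s
  · refine (Null.sum (Finset.range p) (F := fun i l => f (l.map g^[i])) fun i _ =>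
      hf.map (map_on_of_continuousOn hS (hi i).1 (hi i).2)).congr fun l _ => ?_
    simp [AlexanderSpanier.per, hs]
  · refine (hf.sub (hf.map (map_on_of_continuousOn hS hg hm))).congr fun l _ => ?_
    simp [AlexanderSpanier.per, hs]

/-- Solving a periodic system of coboundary equations downwards along a tower. -/
lemma exists_zigzag {p : ℕ} {g : X → X} {T : Set X} {Tm : ℕ → Set X} {k : ℕ}
    (hTm : ∀ m, IsCompact (Tm m)) (hTT : ∀ m, Tm m ⊆ T) (hg : ContinuousOn g T)
    (hmT : ∀ m, ∀ x ∈ Tm m, g x ∈ Tm m) (hp : ∀ x ∈ T, g^[p] x = x)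
    (hK : ∀ m ≥ k, ∀ f : List X → 𝕜, Null (Germ.on (Tm (m + 1))) (m + 1) (d f) →
      ∃ w, Null (Germ.on (Tm m)) m (f - d w))
    {α : ℕ → List X → 𝕜} {N : ℕ}
    (hα : ∀ s, Null (Germ.on T) (k + s + 1) (d (α s) - per p g s (α (s + 1))))
    (hN : ∀ s > N, Null (Germ.on T) (k + s) (α s)) (s : ℕ) :
    ∃ w w', Null (Germ.on (Tm (k + s))) (k + s) (α s - per p g s w' - d w) := by
  obtain ⟨j, hj⟩ : ∃ j, N < s + j := ⟨N + 1, by omega⟩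
  induction j generalizing s with
  | zero =>
    refine ⟨0, 0, ((hN s hj).on_mono (hTT _)).congr fun l _ => ?_⟩
    have : per p g s (0 : List X → 𝕜) = 0 := by funext l; simp [per]
    simp [d_zero, this]
  | succ j ih =>
    obtain ⟨w, w', hw⟩ := ih (s + 1) (by omega)
    have h2 := hw.per (p := p) (hTm _) (hg.mono (hTT _)) (hmT _) s
    have h3 : Null (Germ.on (Tm (k + s + 1))) (k + s + 1) (d (α s - per p g s w)) := by
      refine (((hα s).on_mono (hTT _)).add h2).of_eq_on fun l hl hC => ?_
      have h4 := per_per p g s w' l fun a ha => hp a (hTT _ (hC.1 a ha))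
      simp only [per_sub, d_sub, d_per, Pi.add_apply, Pi.sub_apply, h4]
      ring
    obtain ⟨v, hv⟩ := hK (k + s) (by omega) _ h3
    exact ⟨v, w, hv⟩

end Zigzag

section Periodic

variable {X : Type*} {p : ℕ} {g : X → X}

lemma iterate_mul_eq {x : X} (hx : g^[p] x = x) (m : ℕ) : g^[p * m] x = x := by
  rw [Function.iterate_mul]
  exact Function.iterate_fixed hx m

lemma iterate_mod_eq {x : X} (hx : g^[p] x = x) (m : ℕ) : g^[m % p] x = g^[m] x := by
  conv_rhs => rw [← Nat.mod_add_div m p, Function.iterate_add_apply, iterate_mul_eq hx]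

lemma iterate_ne_of_not_dvd (hp : p.Prime) {x : X} (hx : g^[p] x = x) (hg : g x ≠ x) {m : ℕ}
    (hm : ¬ p ∣ m) : g^[m] x ≠ x := fun h => hg <| by
  have := Function.IsPeriodicPt.gcd (f := g) (x := x) (m := p) (n := m) hx h
  rw [(Nat.Prime.coprime_iff_not_dvd hp).2 hm] at this
  exact this

lemma maps_iterate {T : Set X} (hm : ∀ x ∈ T, g x ∈ T) (i : ℕ) : ∀ x ∈ T, g^[i] x ∈ T := by
  intro x hx
  induction i with
  | zero => exact hx
  | succ i ih => rw [Function.iterate_succ_apply']; exact hm _ ih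

variable [MetricSpace X]

lemma exists_iterate_close {T : Set X} (hT : IsCompact T) (hg : Continuous g) (p : ℕ) :
    ∀ ε > 0, ∃ δ > 0, ∀ x ∈ T, ∀ y ∈ T, dist x y < δ → ∀ i < p, dist (g^[i] x) (g^[i] y) < ε := by
  intro ε hε
  induction p with
  | zero => exact ⟨1, one_pos, fun x _ y _ _ i hi => by omega⟩
  | succ p ih =>
    obtain ⟨δ, hδ, h⟩ := ih
    have := Metric.uniformContinuousOn_iff.1
      (hT.uniformContinuousOn_of_continuous (hg.iterate p).continuousOn) ε hε
    obtain ⟨δ', hδ', h'⟩ := this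
    refine ⟨min δ δ', lt_min hδ hδ', fun x hx y hy hd i hi => ?_⟩
    rcases Nat.lt_succ_iff_lt_or_eq.1 hi with hi | rfl
    · exact h x hx y hy (hd.trans_le (min_le_left _ _)) i hi
    · exact h' x hx y hy (hd.trans_le (min_le_right _ _))

/-- Near a free orbit there is a ball which is disjoint from its translates. -/
lemma exists_free_ball (hp : p.Prime) (hg : Continuous g) {T : Set X}
    (hpT : ∀ x ∈ T, g^[p] x = x) {x : X} (hx : g^[p] x = x) (hgx : g x ≠ x) :
    ∃ r > 0, ∀ y ∈ T, ∀ m, y ∈ Metric.ball x (2 * r) → g^[m] y ∈ Metric.ball x (2 * r) → p ∣ m := by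
  have h1 : ∀ m, m < p → ∃ r > 0, ¬ p ∣ m →
      ∀ y, y ∈ Metric.ball x r → g^[m] y ∉ Metric.ball x r := by
    intro m _
    by_cases hm : p ∣ m
    · exact ⟨1, one_pos, fun h => (h hm).elim⟩
    have hne := iterate_ne_of_not_dvd hp hx hgx hm
    have hd : 0 < dist (g^[m] x) x / 2 := by have := dist_pos.2 hne; positivity
    obtain ⟨δ, hδ, h⟩ := Metric.continuous_iff.1 (hg.iterate m) x _ hd
    refine ⟨min δ (dist (g^[m] x) x / 2), lt_min hδ hd, fun _ y hy hy' => ?_⟩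
    have h2 := h y (hy.trans_le (min_le_left _ _))
    have h3 := (Metric.mem_ball.1 hy').trans_le (min_le_right _ _)
    have := dist_triangle_left (g^[m] x) x (g^[m] y)
    linarith
  choose! r hr h1 using h1
  obtain ⟨ρ, hρ, hρr⟩ : ∃ ρ > 0, ∀ m < p, ρ ≤ r m := by
    have hne : (Finset.range p).Nonempty := ⟨0, by simpa using hp.pos⟩
    refine ⟨(Finset.range p).inf' hne r, ?_, fun m hm => Finset.inf'_le _ (by simpa using hm)⟩
    rw [gt_iff_lt, Finset.lt_inf'_iff]
    intro m hm
    exact hr m (by simpa using hm)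
  refine ⟨ρ / 2, by positivity, fun y hy m hy1 hy2 => ?_⟩
  rw [mul_div_cancel₀ _ two_ne_zero] at hy1 hy2
  by_contra hm
  have hmp := Nat.mod_lt m hp.pos
  rw [← iterate_mod_eq (hpT y hy)] at hy2
  refine h1 _ hmp (fun h => hm ?_) y (Metric.ball_subset_ball (hρr _ hmp) hy1)
    (Metric.ball_subset_ball (hρr _ hmp) hy2)
  exact (Nat.dvd_mod_iff dvd_rfl).1 h

/-- An equivariant colouring of a free part by coloured residues. -/
lemma exists_colouring (hp : p.Prime) (hg : Continuous g) {T T₀ : Set X} (hT : IsCompact T)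
    (hmT : ∀ x ∈ T, g x ∈ T) (hpT : ∀ x ∈ T, g^[p] x = x) (hT₀ : IsCompact T₀) (h₀ : T₀ ⊆ T)
    (hfree : ∀ x ∈ T₀, g x ≠ x) : ∃ (N : ℕ) (π : X → ℕ × ZMod p),
      (∀ x ∈ T₀, ∀ i : ℕ, π (g^[i] x) = rot (i : ZMod p) (π x)) ∧ (∀ x ∈ T₀, (π x).1 < N) ∧
      ∃ δ > 0, ∀ l : List X, (∀ a ∈ l, a ∈ T₀) → (∀ a ∈ l, ∀ b ∈ l, dist a b < δ) →
        Good (l.map π) := by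
  classical
  have := Fact.mk hp
  have h1 : ∀ x, ∃ r, 0 < r ∧ (x ∈ T₀ → ∀ y ∈ T, ∀ m, y ∈ Metric.ball x (2 * r) →
      g^[m] y ∈ Metric.ball x (2 * r) → p ∣ m) := by
    intro x
    by_cases hx : x ∈ T₀
    · obtain ⟨r, hr, h⟩ := exists_free_ball hp hg hpT (hpT x (h₀ hx)) (hfree x hx)
      exact ⟨r, hr, fun _ => h⟩
    · exact ⟨1, one_pos, fun h => (hx h).elim⟩
  choose r hr hfr using h1
  obtain ⟨t, htT, htc⟩ := hT₀.elim_nhds_subcover (fun x => Metric.ball x (r x))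
    fun x _ => Metric.ball_mem_nhds x (hr x)
  set e := t.equivFin with he
  set N := t.card
  set c : Fin N → X := fun j => (e.symm j : X) with hc
  have hcT : ∀ j, c j ∈ T₀ := fun j => htT _ (e.symm j).2
  have hcov : ∀ x ∈ T₀, ∃ j, x ∈ Metric.ball (c j) (r (c j)) := fun x hx => by
    obtain ⟨y, hy, hxy⟩ := mem_iUnion₂.1 (htc hx)
    exact ⟨e ⟨y, hy⟩, by simpa [hc] using hxy⟩
  set B : ℕ → Set X := fun j => {x | ∃ h : j < N, x ∈ Metric.ball (c ⟨j, h⟩) (r (c ⟨j, h⟩))} with hB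
  set O : Set X := {x | x ∈ T ∧ ∃ j i, g^[i] x ∈ B j} with hO
  have hT₀O : T₀ ⊆ O := fun x hx => by
    obtain ⟨j, hj⟩ := hcov x hx
    exact ⟨h₀ hx, j, 0, j.2, hj⟩
  have hj : ∀ x, ∃ j, x ∈ O → (∃ i < p, g^[i] x ∈ B j) ∧ ∀ j' i, g^[i] x ∈ B j' → j ≤ j' := by
    intro x
    by_cases hx : x ∈ O
    · have hx' := hx.2
      refine ⟨Nat.find hx', fun _ => ⟨?_, fun j' i hi => Nat.find_min' hx' ⟨i, hi⟩⟩⟩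
      obtain ⟨i, hi⟩ := Nat.find_spec hx'
      exact ⟨i % p, Nat.mod_lt _ hp.pos, by rwa [iterate_mod_eq (hpT x hx.1)]⟩
    · exact ⟨0, fun h => (hx h).elim⟩
  choose j hj using hj
  have hi : ∀ x, ∃ i, x ∈ O → i < p ∧ g^[i] x ∈ B (j x) := by
    intro x
    by_cases hx : x ∈ O
    · obtain ⟨i, h⟩ := (hj x hx).1
      exact ⟨i, fun _ => h⟩
    · exact ⟨0, fun h => (hx h).elim⟩
  choose i hi using hi
  have huniq : ∀ x ∈ T, ∀ q ∈ T₀, ∀ a b : ℕ, g^[a] x ∈ Metric.ball q (2 * r q) →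
      g^[b] x ∈ Metric.ball q (2 * r q) → (a : ZMod p) = b := by
    intro x hx q hq a b ha hb
    have h2 : g^[b + (p - 1) * a] (g^[a] x) = g^[b] x := by
      rw [← Function.iterate_add_apply, show b + (p - 1) * a + a = b + p * a by
        obtain ⟨q, rfl⟩ : ∃ q, p = q + 1 := ⟨p - 1, by have := hp.pos; omega⟩
        simp; ring, Function.iterate_add_apply, iterate_mul_eq (hpT x hx)]
    have h3 := hfr q hq (g^[a] x) (maps_iterate hmT a x hx) (b + (p - 1) * a) ha (by rwa [h2])
    have h4 : ((b + (p - 1) * a : ℕ) : ZMod p) = 0 := (ZMod.natCast_eq_zero_iff _ _).2 h3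
    rw [Nat.cast_add, Nat.cast_mul, Nat.cast_sub hp.one_le] at h4
    simp only [CharP.cast_eq_zero, Nat.cast_one] at h4
    linear_combination -h4
  have hball : ∀ j x, x ∈ B j → ∃ h : j < N, x ∈ Metric.ball (c ⟨j, h⟩) (2 * r (c ⟨j, h⟩)) := by
    rintro j x ⟨h, hx⟩
    exact ⟨h, Metric.ball_subset_ball (by linarith [hr (c ⟨j, h⟩)]) hx⟩
  have hOg : ∀ x ∈ O, ∀ m, g^[m] x ∈ O := by
    rintro x ⟨hx, j, i, h⟩ m
    refine ⟨maps_iterate hmT m x hx, j, i + (p - 1) * m, ?_⟩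
    rw [← Function.iterate_add_apply, show i + (p - 1) * m + m = i + p * m by
      obtain ⟨q, rfl⟩ : ∃ q, p = q + 1 := ⟨p - 1, by have := hp.pos; omega⟩
      simp; ring, Function.iterate_add_apply, iterate_mul_eq (hpT x hx)]
    exact h
  refine ⟨N, fun x => (j x, -(i x : ZMod p)), ?_, ?_, ?_⟩
  · intro x hx m
    have hxO := hT₀O hx
    have hmO := hOg x hxO m
    have h2 : j (g^[m] x) = j x := by
      apply le_antisymm
      · refine (hj _ hmO).2 _ (i x + (p - 1) * m) ?_
        rw [← Function.iterate_add_apply, show i x + (p - 1) * m + m = i x + p * m by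
          obtain ⟨q, rfl⟩ : ∃ q, p = q + 1 := ⟨p - 1, by have := hp.pos; omega⟩
          simp; ring, Function.iterate_add_apply, iterate_mul_eq (hpT x hxO.1)]
        exact (hi x hxO).2
      · refine (hj _ hxO).2 _ (i (g^[m] x) + m) ?_
        rw [Function.iterate_add_apply]
        exact (hi _ hmO).2
    have h3 := (hi _ hmO).2
    rw [h2, ← Function.iterate_add_apply] at h3
    obtain ⟨h, h4⟩ := hball _ _ h3
    obtain ⟨_, h5⟩ := hball _ _ (hi _ hxO).2
    have h6 := huniq x hxO.1 _ (hcT _) _ _ h4 h5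
    refine Prod.ext h2 ?_
    push_cast at h6
    simp only [rot]
    linear_combination -h6
  · intro x hx
    obtain ⟨h, _⟩ := (hi x (hT₀O hx)).2
    exact h
  · obtain ⟨ρ, hρ, hρr⟩ : ∃ ρ > 0, ∀ j, ρ ≤ r (c j) := by
      rcases Nat.eq_zero_or_pos N with hN | hN
      · exact ⟨1, one_pos, fun j => by have := j.2; omega⟩
      · have : Nonempty (Fin N) := ⟨⟨0, hN⟩⟩
        refine ⟨Finset.univ.inf' Finset.univ_nonempty fun j => r (c j), ?_, fun j =>
          Finset.inf'_le _ (Finset.mem_univ j)⟩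
        rw [gt_iff_lt, Finset.lt_inf'_iff]
        exact fun j _ => hr _
    obtain ⟨δ, hδ, hcl⟩ := exists_iterate_close hT hg p ρ hρ
    refine ⟨δ, hδ, fun l hl hd => ?_⟩
    intro a' ha' b' hb' hab
    obtain ⟨a, ha, rfl⟩ := List.mem_map.1 ha'
    obtain ⟨b, hb, rfl⟩ := List.mem_map.1 hb'
    have haO := hT₀O (hl a ha)
    have hbO := hT₀O (hl b hb)
    simp only at hab ⊢
    obtain ⟨hj1, h2⟩ := hball _ _ (hi a haO).2
    have h3 := (hi b hbO).2
    rw [← hab] at h3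
    obtain ⟨_, h3⟩ := h3
    have h4 := hcl a haO.1 b hbO.1 (hd a ha b hb) (i b) (hi b hbO).1
    have h5 : g^[i b] a ∈ Metric.ball (c ⟨j a, hj1⟩) (2 * r (c ⟨j a, hj1⟩)) := by
      rw [Metric.mem_ball] at h3 ⊢
      have := dist_triangle (g^[i b] a) (g^[i b] b) (c ⟨j a, hj1⟩)
      have := hρr ⟨j a, hj1⟩
      linarith
    rw [huniq a haO.1 _ (hcT _) _ _ h2 h5]

end Periodic

section Smith

variable {X : Type*} [MetricSpace X] {p : ℕ} {g : X → X}

/-- An invariant retraction onto the fixed points, continuous along the fixed points. -/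
lemma exists_invariant_retraction (hp : p.Prime) (hg : Continuous g) {T : Set X}
    (hT : IsCompact T) (hpT : ∀ x ∈ T, g^[p] x = x) :
    ∃ r : X → X, (∀ x ∈ T ∩ {x | g x = x}, r x = x) ∧ (∀ x ∈ T, ∀ i, r (g^[i] x) = r x) ∧
      ∀ ε > 0, ∃ δ > 0, ∀ x ∈ T, (∃ y ∈ T ∩ {x | g x = x}, dist x y < δ) →
        r x ∈ T ∩ {x | g x = x} ∧ dist x (r x) < ε := by
  have hF : IsCompact (T ∩ {x | g x = x}) := hT.inter_right (isClosed_eq hg continuous_id)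
  obtain ⟨r, hr, hr'⟩ := exists_nearest hF
  rcases isEmpty_or_nonempty X with hX | hX
  · exact ⟨r, hr, fun x => (hX.false x).elim, fun ε _ => ⟨1, one_pos, fun x => (hX.false x).elim⟩⟩
  set o : X → Set X := fun x => {y | ∃ i, g^[i] x = y} with ho
  set rep : X → X := fun x => Classical.epsilon fun y => y ∈ o x with hrep
  have hrepo : ∀ x, rep x ∈ o x := fun x => Classical.epsilon_spec (p := fun y => y ∈ o x) ⟨x, 0, rfl⟩
  have hog : ∀ x ∈ T, ∀ m, o (g^[m] x) = o x := by
    intro x hx m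
    ext y
    constructor
    · rintro ⟨i, rfl⟩
      exact ⟨i + m, Function.iterate_add_apply ..⟩
    · rintro ⟨i, rfl⟩
      refine ⟨i + (p - 1) * m, ?_⟩
      rw [← Function.iterate_add_apply, show i + (p - 1) * m + m = i + p * m by
        obtain ⟨q, rfl⟩ : ∃ q, p = q + 1 := ⟨p - 1, by have := hp.pos; omega⟩
        simp; ring, Function.iterate_add_apply, iterate_mul_eq (hpT x hx)]
  refine ⟨fun x => r (rep x), fun x hx => ?_, fun x hx i => ?_, fun ε hε => ?_⟩
  · obtain ⟨i, hi⟩ := hrepo x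
    have : g^[i] x = x := Function.iterate_fixed hx.2 i
    simp only
    rw [this] at hi
    rw [← hi, hr x hx]
  · simp only [hrep]
    rw [hog x hx]
  · obtain ⟨δ, hδ, h⟩ := exists_iterate_close hT hg p (ε / 3) (by positivity)
    refine ⟨min δ (ε / 3), by positivity, fun x hx ⟨y, hy, hxy⟩ => ?_⟩
    obtain ⟨i, hi⟩ := hrepo x
    rw [← iterate_mod_eq (hpT x hx)] at hi
    have h1 := h x hx y hy.1 (hxy.trans_le (min_le_left _ _)) (i % p) (Nat.mod_lt _ hp.pos)
    rw [hi, Function.iterate_fixed hy.2] at h1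
    obtain ⟨h2, h3⟩ := hr' (rep x) (ε / 3) ⟨y, hy, h1⟩
    refine ⟨h2, ?_⟩
    have h4 := dist_triangle x y (rep x)
    have h5 := dist_triangle x (rep x) (r (rep x))
    rw [dist_comm y] at h4
    have := hxy.trans_le (min_le_right _ _)
    linarith

/-- Smith theory: along a sufficiently long tower of invariant compact sets on which cocycles die,
cocycles on the fixed points die. -/
theorem KillsAt.fixed (hp : p.Prime) (hg : Continuous g) {T : Set X} {Tm : ℕ → Set X} {k : ℕ}
    (hT : IsCompact T) (hmT : ∀ x ∈ T, g x ∈ T) (hpT : ∀ x ∈ T, g^[p] x = x)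
    (hTm : ∀ m, IsCompact (Tm m)) (hTT : ∀ m, Tm m ⊆ T) (hmTm : ∀ m, ∀ x ∈ Tm m, g x ∈ Tm m)
    (hK : ∀ m ≥ k, KillsAt (ZMod p) (Tm (m + 1)) (Tm m) m) :
    KillsAt (ZMod p) (T ∩ {x | g x = x}) (Tm k ∩ {x | g x = x}) k := by
  classical
  have := Fact.mk hp
  have hF : IsCompact (T ∩ {x | g x = x}) := hT.inter_right (isClosed_eq hg continuous_id)
  set F := T ∩ {x | g x = x} with hFdef
  rintro f ⟨ε₀, hε₀, hf⟩
  obtain ⟨r, hrF, hrg, hr⟩ := exists_invariant_retraction hp hg hT hpT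
  set f' : List X → ZMod p := fun l => if l.length = k then f l else 0 with hf'
  set b : List X → ZMod p := fun l => d f' (l.map r) with hb
  have hbd : b = d fun l => f' (l.map r) := by funext l; rw [d_map]
  have hdb : d b = 0 := by rw [hbd, d_d]
  have hb_len : ∀ l, l.length ≠ k + 1 → b l = 0 := by
    intro l hl
    refine d_eq_zero fun l' _ hl' => ?_
    simp only [hf']
    rw [if_neg]
    simp at hl'
    omega
  have hb_inv : ∀ i : ℕ, ∀ l : List X, (∀ a ∈ l, a ∈ T) → b (l.map g^[i]) = b l := by
    intro i l hl
    simp only [hb, List.map_map]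
    congr 1
    exact List.map_congr_left fun a ha => hrg a (hl a ha) i
  obtain ⟨ρ, hρ, hnear⟩ := hr (ε₀ / 3) (by positivity)
  set T₀ := T \ Metric.thickening (ρ / 2) F with hT₀
  have hT₀c : IsCompact T₀ := hT.diff Metric.isOpen_thickening
  have hfree : ∀ x ∈ T₀, g x ≠ x := fun x hx h => hx.2 <|
    Metric.mem_thickening_iff.2 ⟨x, ⟨hx.1, h⟩, by simpa using hρ⟩
  obtain ⟨N, π, hπ, hπN, δ₁, hδ₁, hgood⟩ := exists_colouring hp hg hT hmT hpT hT₀c sdiff_subset hfree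
  obtain ⟨η, hη, hη0, hdη⟩ := exists_resolution (p := p) (𝕜 := ZMod p)
  set δ := min δ₁ (min (ρ / 2) (ε₀ / 3)) with hδ
  have hδ0 : 0 < δ := by positivity
  have hbT₀ : ∀ l : List X, (Germ.on T).C δ l →
      (∀ l', l' ⊆ l → b l' = 0) ∨ ∀ a ∈ l, a ∈ T₀ := by
    intro l hC
    by_cases hl : ∀ a ∈ l, a ∈ T₀
    · exact Or.inr hl
    left
    push Not at hl
    obtain ⟨a, ha, haT⟩ := hl
    intro l' hl'
    by_cases hlen : l'.length = k + 1
    swap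
    · exact hb_len l' hlen
    have h1 : a ∈ Metric.thickening (ρ / 2) F := by
      by_contra h
      exact haT ⟨hC.1 a ha, h⟩
    obtain ⟨y, hy, hay⟩ := Metric.mem_thickening_iff.1 h1
    have h2 : ∀ c ∈ l, r c ∈ F ∧ dist c (r c) < ε₀ / 3 := fun c hc => hnear c (hC.1 c hc) ⟨y, hy, by
      have := dist_triangle c a y
      have := hC.2 c hc a ha
      have : δ ≤ ρ / 2 := (min_le_right _ _).trans (min_le_left _ _)
      linarith⟩
    simp only [hb]
    rw [d_congr (g := f) (l'.map r) fun l'' _ hl'' => by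
      simp only [hf']; rw [if_pos]; simp at hl''; omega]
    refine hf _ (by simpa using hlen) ⟨?_, ?_⟩
    · intro x hx
      obtain ⟨c, hc, rfl⟩ := List.mem_map.1 hx
      exact (h2 c (hl' hc)).1
    · intro x hx z hz
      obtain ⟨c, hc, rfl⟩ := List.mem_map.1 hx
      obtain ⟨e, he, rfl⟩ := List.mem_map.1 hz
      have h3 := (h2 c (hl' hc)).2
      have h4 := (h2 e (hl' he)).2
      have h5 := hC.2 c (hl' hc) e (hl' he)
      have : δ ≤ ε₀ / 3 := (min_le_right _ _).trans (min_le_right _ _)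
      have h6 := dist_triangle4 (r c) c e (r e)
      rw [dist_comm (r c) c] at h6
      linarith
  have hparts : ∀ l : List X, (Germ.on T).C δ l →
      ∀ l₁ l₂ : List X, ∀ a : X, l = l₁ ++ a :: l₂ → b (a :: l₂) = 0 ∨
        ((∀ x ∈ l₁ ++ [a], x ∈ T₀) ∧ Good ((l₁ ++ [a]).map π)) := by
    rintro l hC l₁ l₂ a rfl
    have hsub : l₁ ++ [a] ⊆ l₁ ++ a :: l₂ := by
      intro x hx
      simp only [List.mem_append, List.mem_cons, List.not_mem_nil, or_false] at hx ⊢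
      tauto
    rcases hbT₀ _ hC with h | h
    · exact Or.inl (h _ fun x hx => List.mem_append_right _ hx)
    · exact Or.inr ⟨fun x hx => h x (hsub hx), hgood _ (fun x hx => h x (hsub hx))
        fun x hx y hy => (hC.2 x (hsub hx) y (hsub hy)).trans_le (min_le_left _ _)⟩
  set α : ℕ → List X → ZMod p := fun s => if s = 0 then fun l => f' (l.map r)
    else cup (fun l => η s (l.map π)) b with hα
  have hb_nil : b [] = 0 := hb_len _ (by simp)
  have hdα : ∀ s l, d (α s) l = cup (fun l => d (η s) (l.map π)) b l := by
    intro s l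
    have h1 := d_cup (fun l => η s (l.map π)) b hb_nil l
    have h2 : d (fun l => η s (l.map π)) = fun l => d (η s) (l.map π) := by
      funext l; rw [d_map]
    have h3 : cup (sgn fun l => η s (l.map π)) (0 : List X → ZMod p) = 0 := by
      funext l
      exact cup_eq_zero fun _ _ _ _ => by simp
    rw [hdb, h2, h3, Pi.zero_apply, add_zero] at h1
    by_cases hs : s = 0
    · subst hs
      have h4 : cup (fun l => η 0 (l.map π)) b = 0 := by
        funext l
        exact cup_eq_zero fun _ _ _ _ => by simp [hη0]
      rw [h4, d_zero, hη0] at h1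
      simp only [List.map_nil, if_true, Pi.zero_apply, one_mul] at h1
      simp only [hα, if_true]
      rw [hη0, ← hbd]
      linear_combination h1
    · have h5 : η s ([].map π) = 0 := (hη s).2 _ (by simp [Good]) (by simpa using Ne.symm hs)
      simp only [hα, if_neg hs]
      rw [h1, h5]
      ring
  have hα1 : ∀ s, Null (Germ.on T) (k + s + 1) (d (α s) - per p g s (α (s + 1))) := by
    intro s
    refine ⟨δ, hδ0, fun l _ hC => ?_⟩
    rw [Pi.sub_apply, hdα, sub_eq_zero]
    have hαs : α (s + 1) = cup (fun l => η (s + 1) (l.map π)) b := by simp [hα]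
    have h6 : ∀ i : ℕ, α (s + 1) (l.map g^[i]) =
        cup (fun l => η (s + 1) ((l.map π).map (rot (i : ZMod p)))) b l := by
      intro i
      rw [hαs, cup_map]
      refine cup_congr fun l₁ l₂ a hl => ?_
      rw [hb_inv i (a :: l₂) fun x hx => hC.1 x (by rw [hl]; exact List.mem_append_right _ hx)]
      rcases hparts l hC l₁ l₂ a hl with h | ⟨h, _⟩
      · rw [h]; simp
      · congr 2
        rw [List.map_map, List.map_map]
        exact List.map_congr_left fun x hx => hπ x (h x hx) i
    by_cases hs : Even s
    · simp only [per, if_pos hs, h6]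
      have h7 : ∑ i ∈ Finset.range p,
          cup (fun l => η (s + 1) ((l.map π).map (rot (i : ZMod p)))) b l =
          cup (∑ i ∈ Finset.range p, fun l => η (s + 1) ((l.map π).map (rot (i : ZMod p)))) b l := by
        simp only [← cupₗ_apply, map_sum, LinearMap.sum_apply, Finset.sum_apply]
      rw [h7]
      refine cup_congr fun l₁ l₂ a hl => ?_
      rcases hparts l hC l₁ l₂ a hl with h | ⟨_, h⟩
      · rw [h]; simp
      · rw [hdη s _ h, if_pos hs, Finset.sum_apply]
    · simp only [per, if_neg hs]
      have h8 := h6 1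
      rw [Function.iterate_one] at h8
      rw [h8, hαs]
      have h7 : ∀ F F' : List X → ZMod p, cup F b l - cup F' b l = cup (F - F') b l := by
        intro F F'
        simp only [← cupₗ_apply, map_sub, LinearMap.sub_apply, Pi.sub_apply]
      rw [h7]
      refine cup_congr fun l₁ l₂ a hl => ?_
      rcases hparts l hC l₁ l₂ a hl with h | ⟨_, h⟩
      · rw [h]; simp
      · rw [hdη s _ h, if_neg hs, Pi.sub_apply, Nat.cast_one]
  have hα2 : ∀ s > N, Null (Germ.on T) (k + s) (α s) := by
    intro s hs
    refine ⟨δ, hδ0, fun l _ hC => ?_⟩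
    simp only [hα]
    rw [if_neg (by omega)]
    refine cup_eq_zero fun l₁ l₂ a hl => ?_
    rcases hparts l hC l₁ l₂ a hl with h | ⟨h0, h⟩
    · rw [h]; simp
    · rw [(hη s).eq_zero hs h, zero_mul]
      intro c hc
      obtain ⟨x, hx, rfl⟩ := List.mem_map.1 hc
      exact hπN x (h0 x hx)
  obtain ⟨w, w', hw⟩ := exists_zigzag hTm hTT hg.continuousOn hmTm hpT hK hα1 hα2 0
  refine ⟨w, (hw.on_mono inter_subset_left).of_eq_on fun l hl hC => ?_⟩
  have h9 : ∀ i : ℕ, l.map g^[i] = l := by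
    intro i
    conv_rhs => rw [← List.map_id l]
    exact List.map_congr_left fun a ha => Function.iterate_fixed (hC.1 a ha).2 i
  have h10 : l.map r = l := by
    conv_rhs => rw [← List.map_id l]
    exact List.map_congr_left fun a ha => hrF a ⟨hTT _ (hC.1 a ha).1, (hC.1 a ha).2⟩
  simp only [per, Even.zero, if_true, h9, hα, h10, hf', Pi.sub_apply, Finset.sum_const,
    Finset.card_range, nsmul_eq_mul, CharP.cast_eq_zero, zero_mul, sub_zero]
  rw [if_pos (by simpa using hl)]

end Smith

section Fixed

variable {X : Type*} [MetricSpace X]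

/-- The compact subsets of `A` form a pro-acyclic system. -/
def Acyc (𝕜 : Type*) [AddCommGroup 𝕜] (A : Set X) : Prop :=
  ∀ K, IsCompact K → K ⊆ A → ∃ K', IsCompact K' ∧ K' ⊆ A ∧ K ⊆ K' ∧ Kills 𝕜 K' K

/-- The compact subsets have no cohomology above degree `n`. -/
def CohDimLE (𝕜 : Type*) [AddCommGroup 𝕜] (X : Type*) [MetricSpace X] (n : ℕ) : Prop :=
  ∀ K : Set X, IsCompact K → ∀ m ≥ n + 2, KillsAt 𝕜 K K m

lemma Acyc.fixed {p : ℕ} (hp : p.Prime) {g : X → X} (hg : Continuous g) {A : Set X} {n : ℕ}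
    (hA : Acyc (ZMod p) A) (hn : CohDimLE (ZMod p) X n) (hgA : ∀ x ∈ A, g x ∈ A)
    (hpA : ∀ x ∈ A, g^[p] x = x) : Acyc (ZMod p) (A ∩ {x | g x = x}) := by
  have step : ∀ L, ∃ L', (IsCompact L ∧ L ⊆ A) → IsCompact L' ∧ L' ⊆ A ∧ (∀ x ∈ L', g x ∈ L') ∧
      L ⊆ L' ∧ Kills (ZMod p) L' L := by
    intro L
    by_cases hL : IsCompact L ∧ L ⊆ A
    swap
    · exact ⟨L, fun h => (hL h).elim⟩
    obtain ⟨K', hK', hKA, hLK, hk⟩ := hA L hL.1 hL.2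
    have hsub : K' ⊆ ⋃ i ∈ Finset.range p, g^[i] '' K' := fun x hx =>
      mem_iUnion₂.2 ⟨0, by simpa using hp.pos, x, hx, rfl⟩
    refine ⟨⋃ i ∈ Finset.range p, g^[i] '' K', fun _ => ⟨?_, ?_, ?_, hLK.trans hsub,
      hk.mono hsub le_rfl⟩⟩
    · exact (Finset.range p).isCompact_biUnion fun i _ => hK'.image (hg.iterate i)
    · intro y hy
      obtain ⟨i, _, x, hx, rfl⟩ := mem_iUnion₂.1 hy
      exact maps_iterate hgA i x (hKA hx)
    · intro y hy
      obtain ⟨i, hi, x, hx, rfl⟩ := mem_iUnion₂.1 hy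
      refine mem_iUnion₂.2 ⟨(i + 1) % p, by simpa using Nat.mod_lt _ hp.pos, x, hx, ?_⟩
      rw [iterate_mod_eq (hpA x (hKA hx)), Function.iterate_succ_apply']
  choose S hS using step
  intro K hK hKA
  set L : ℕ → Set X := fun i => S^[i] K with hL
  have hL1 : ∀ i, IsCompact (L i) ∧ L i ⊆ A ∧ ∀ x ∈ L i, g x ∈ L i := by
    intro i
    induction i with
    | zero => exact ⟨hK, fun x hx => (hKA hx).1, fun x hx => by
        have : g x = x := (hKA hx).2
        rw [this]; exact hx⟩
    | succ i ih =>
      obtain ⟨h1, h2, h3, _⟩ := hS (L i) ⟨ih.1, ih.2.1⟩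
      simp only [hL, Function.iterate_succ_apply']
      exact ⟨h1, h2, h3⟩
  have hL2 : ∀ i, L i ⊆ L (i + 1) ∧ Kills (ZMod p) (L (i + 1)) (L i) := by
    intro i
    obtain ⟨_, _, _, h4, h5⟩ := hS (L i) ⟨(hL1 i).1, (hL1 i).2.1⟩
    simp only [hL, Function.iterate_succ_apply'] at h4 h5 ⊢
    exact ⟨h4, h5⟩
  have hmono : Monotone L := monotone_nat_of_le_succ fun i => (hL2 i).1
  have hT := hL1 (n + 2)
  refine ⟨L (n + 2) ∩ {x | g x = x}, hT.1.inter_right (isClosed_eq hg continuous_id),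
    inter_subset_inter_left _ hT.2.1, fun x hx => ⟨hmono (Nat.zero_le _) hx, (hKA hx).2⟩,
    fun k => ?_⟩
  have := KillsAt.fixed hp hg (Tm := fun m => L (min m (n + 2))) (k := k) hT.1 hT.2.2
    (fun x hx => hpA x (hT.2.1 hx)) (fun m => (hL1 _).1) (fun m => hmono (min_le_right _ _))
    (fun m => (hL1 _).2.2) ?_
  · exact this.mono le_rfl fun x hx => ⟨hmono (Nat.zero_le _) hx, (hKA hx).2⟩
  · intro m _
    rcases Nat.lt_or_ge m (n + 2) with h | h
    · rw [min_eq_left (show m + 1 ≤ n + 2 by omega), min_eq_left h.le]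
      exact (hL2 m).2 m
    · rw [min_eq_right (show n + 2 ≤ m + 1 by omega), min_eq_right h]
      exact hn _ hT.1 m h

lemma Acyc.fixed_group {p : ℕ} (hp : p.Prime) {G : Type*} [Group G] [Finite G] (hG : IsPGroup p G)
    (act : G →* Equiv.Perm X) (hact : ∀ g, Continuous (act g)) {A : Set X} {n : ℕ}
    (hA : Acyc (ZMod p) A) (hn : CohDimLE (ZMod p) X n) (hgA : ∀ g, ∀ x ∈ A, act g x ∈ A) :
    Acyc (ZMod p) (A ∩ {x | ∀ g, act g x = x}) := by
  have := Fact.mk hp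
  obtain ⟨N, hN⟩ := IsPGroup.iff_card.1 hG
  have key : ∀ i ≤ N, ∃ H : Subgroup G, Nat.card H = p ^ i ∧
      Acyc (ZMod p) (A ∩ {x | ∀ g ∈ H, act g x = x}) := by
    intro i
    induction i with
    | zero =>
      intro _
      refine ⟨⊥, by simp, ?_⟩
      convert hA using 1
      ext x
      simp
    | succ i ih =>
      intro hi
      obtain ⟨H, hH, hHA⟩ := ih (by omega)
      obtain ⟨K, hK, hHK⟩ := Sylow.exists_subgroup_card_pow_succ (hN ▸ pow_dvd_pow p hi) hH
      refine ⟨K, hK, ?_⟩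
      have hidx : (H.subgroupOf K).index = p := by
        have h1 := (H.subgroupOf K).card_mul_index
        rw [Nat.card_congr (Subgroup.subgroupOfEquivOfLe hHK).toEquiv, hH, hK, pow_succ] at h1
        exact Nat.eq_of_mul_eq_mul_left (pow_pos hp.pos i) h1
      have hnorm : (H.subgroupOf K).Normal := by
        apply Subgroup.normal_of_index_eq_minFac_card
        rw [hidx, hK, hp.pow_minFac (Nat.succ_ne_zero i)]
      have hne : ∃ g ∈ K, g ∉ H := by
        by_contra h
        push Not at h
        have h2 := Nat.le_antisymm (Nat.card_mono (Set.toFinite _) (hHK : (H : Set G) ⊆ K))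
          (Nat.card_mono (Set.toFinite _) (h : (K : Set G) ⊆ H))
        have h3 : p ^ i < p ^ (i + 1) := Nat.pow_lt_pow_right hp.one_lt (Nat.lt_succ_self i)
        have h4 : Nat.card H = Nat.card K := h2
        omega
      obtain ⟨g, hgK, hgH⟩ := hne
      have hconj : ∀ h ∈ H, ∀ k ∈ K, k⁻¹ * h * k ∈ H := by
        intro h hh k hk
        have := hnorm.conj_mem ⟨h, hHK hh⟩ (by simpa [Subgroup.mem_subgroupOf] using hh) ⟨k, hk⟩⁻¹
        simpa [Subgroup.mem_subgroupOf] using this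
      have hpow : g ^ p ∈ H := by
        have h1 : (⟨g, hgK⟩ : K) ^ p ∈ H.subgroupOf K := by
          rw [← QuotientGroup.eq_one_iff, QuotientGroup.mk_pow, ← hidx, Subgroup.index]
          exact pow_card_eq_one'
        simpa [Subgroup.mem_subgroupOf] using h1
      have hit : ∀ m : ℕ, ∀ x, (act g)^[m] x = act (g ^ m) x := by
        intro m x
        rw [map_pow, Equiv.Perm.iterate_eq_pow]
      have hfix : A ∩ {x | ∀ g ∈ K, act g x = x} =
          (A ∩ {x | ∀ g ∈ H, act g x = x}) ∩ {x | act g x = x} := by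
        ext x
        constructor
        · rintro ⟨hx, h⟩
          exact ⟨⟨hx, fun k hk => h k (hHK hk)⟩, h g hgK⟩
        · rintro ⟨⟨hx, h⟩, hxg⟩
          refine ⟨hx, ?_⟩
          let St : Subgroup G :=
            { carrier := {k | k ∈ K ∧ act k x = x}
              mul_mem' := fun {a b} ha hb => ⟨K.mul_mem ha.1 hb.1, by
                rw [map_mul, Equiv.Perm.mul_apply, hb.2, ha.2]⟩
              one_mem' := ⟨K.one_mem, by simp⟩
              inv_mem' := fun {a} ha => ⟨K.inv_mem ha.1, by
                rw [map_inv, Equiv.Perm.inv_eq_iff_eq, ha.2]⟩ }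
          have hHS : H ≤ St := fun k hk => ⟨hHK hk, h k hk⟩
          have hSK : St ≤ K := fun k hk => hk.1
          have hSeq : St = K := by
            have h1 := Subgroup.relIndex_mul_relIndex H St K hHS hSK
            have h2 : H.relIndex K = p := hidx
            rw [h2] at h1
            rcases (Nat.dvd_prime hp).1 ⟨_, h1.symm⟩ with h3 | h3
            · exact (hgH (Subgroup.relIndex_eq_one.1 h3 ⟨hgK, hxg⟩)).elim
            · rw [h3] at h1
              have h4 : St.relIndex K = 1 :=
                Nat.eq_of_mul_eq_mul_left hp.pos (by rw [h1, mul_one])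
              exact le_antisymm hSK (Subgroup.relIndex_eq_one.1 h4)
          intro k hk
          rw [← hSeq] at hk
          exact hk.2
      rw [hfix]
      refine hHA.fixed hp (hact g) hn ?_ ?_
      · rintro x ⟨hx, h⟩
        refine ⟨hgA g x hx, fun k hk => ?_⟩
        have h1 := h _ (hconj k hk g hgK)
        rw [mul_assoc, map_mul, map_mul, Equiv.Perm.mul_apply, Equiv.Perm.mul_apply, map_inv,
          Equiv.Perm.inv_eq_iff_eq] at h1
        exact h1
      · rintro x ⟨hx, h⟩
        rw [hit]
        exact h _ hpow
  obtain ⟨H, hH, h⟩ := key N le_rfl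
  have : H = ⊤ := by
    apply Subgroup.eq_top_of_card_eq
    rw [hH, hN]
  subst this
  simpa using h

/-- If the fixed points remain acyclic after exchanging a point for an isolated point at infinity,
there is exactly one fixed point. -/
lemma Acyc.eq_singleton {𝕜 : Type*} [AddCommGroup 𝕜] [Nontrivial 𝕜] {F : Set X} {y z : X}
    (hF : IsCompact F) (hz : z ∉ F) (hy : y ∈ F) (hA : Acyc 𝕜 ((F \ {y}) ∪ {z})) : F = {y} := by
  classical
  by_contra hne
  obtain ⟨x, hx, hxy⟩ : ∃ x ∈ F, x ≠ y := by
    by_contra h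
    push Not at h
    exact hne (eq_singleton_iff_unique_mem.2 ⟨hy, h⟩)
  obtain ⟨r, hr⟩ := exists_ne (0 : 𝕜)
  obtain ⟨K', hK', hK'A, hK, hk⟩ := hA {x, z} (by simp) (by
    rintro a (rfl | rfl)
    · exact Or.inl ⟨hx, hxy⟩
    · exact Or.inr rfl)
  obtain ⟨ε, hε, hd⟩ := Metric.isOpen_iff.1 hF.isClosed.isOpen_compl z hz
  obtain ⟨w, ε', hε', hw⟩ := hk 1 (fun l => if l = [z] then r else 0) ⟨ε, hε, fun l hl hC => by
    obtain ⟨a, b, rfl⟩ := List.length_eq_two.1 hl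
    have h1 : ∀ c ∈ ({a, b} : Set X), c = z ∨ c ∈ F := by
      rintro c (rfl | rfl)
      · exact (hK'A (hC.1 c (by simp))).symm.imp id fun h => h.1
      · exact (hK'A (hC.1 c (by simp))).symm.imp id fun h => h.1
    have h2 : a = z ↔ b = z := by
      constructor
      · rintro rfl
        refine (h1 b (by simp)).resolve_right fun hb => hd ?_ hb
        exact hC.2 b (by simp) a (by simp)
      · rintro rfl
        refine (h1 a (by simp)).resolve_right fun ha => hd ?_ ha
        exact hC.2 a (by simp) b (by simp)
    simp [d_cons, h2]⟩
  have hxz : x ≠ z := fun h => hz (h ▸ hx)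
  have h1 := hw [x] rfl ⟨by simp, by simpa using hε'⟩
  have h2 := hw [z] rfl ⟨by simp, by simpa using hε'⟩
  simp only [Pi.sub_apply, d_cons, d_nil, List.cons.injEq, hxz, if_false, and_true,
    if_true] at h1 h2
  apply hr
  have h3 := sub_eq_zero.1 h2
  rw [h3]
  simpa using h1

end Fixed

section Algebra

variable {X 𝕜 : Type*} [Field 𝕜]

/-- The homogeneous component on lists of length `k`. -/
def hom (k : ℕ) : (List X → 𝕜) →ₗ[𝕜] (List X → 𝕜) where
  toFun f l := if l.length = k then f l else 0
  map_add' f g := by funext l; by_cases h : l.length = k <;> simp [h]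
  map_smul' c f := by funext l; by_cases h : l.length = k <;> simp [h]

lemma hom_apply (k : ℕ) (f : List X → 𝕜) (l : List X) :
    hom k f l = if l.length = k then f l else 0 := rfl

lemma hom_eq {k : ℕ} {f : List X → 𝕜} (h : ∀ l, l.length ≠ k → f l = 0) : hom k f = f := by
  funext l
  by_cases hl : l.length = k
  · simp [hom_apply, hl]
  · simp [hom_apply, hl, h l hl]

/-- The coboundary as a linear map. -/
def dL : (List X → 𝕜) →ₗ[𝕜] (List X → 𝕜) where
  toFun := d
  map_add' := d_add'
  map_smul' := d_smul

@[simp] lemma dL_apply (f : List X → 𝕜) : dL f = d f := rfl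

lemma d_hom (k : ℕ) (f : List X → 𝕜) : d (hom k f) = hom (k + 1) (d f) := by
  funext l
  by_cases hl : l.length = k + 1
  · rw [hom_apply, if_pos hl]
    exact d_congr l fun l' _ hl' => by rw [hom_apply, if_pos (by omega)]
  · rw [hom_apply, if_neg hl]
    exact d_eq_zero fun l' _ hl' => by rw [hom_apply, if_neg (by omega)]

lemma hom_hom_ne {k m : ℕ} (h : k ≠ m) (f : List X → 𝕜) : hom k (hom m f) = 0 := by
  funext l
  simp only [hom_apply, Pi.zero_apply]
  split_ifs with h1 h2
  · omega
  · rfl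
  · rfl

lemma hom_hom (k : ℕ) (f : List X → 𝕜) : hom k (hom k f) = hom k f :=
  hom_eq fun l hl => by rw [hom_apply, if_neg hl]

/-- Extending a functional along a linear map, modulo a subspace. -/
lemma exists_functional {V : Type*} [AddCommGroup V] [Module 𝕜 V] (D : V →ₗ[𝕜] V)
    (S N : Submodule 𝕜 V) (μ : V →ₗ[𝕜] 𝕜) (h : ∀ g ∈ S, D g ∈ N → μ g = 0) :
    ∃ ν : V →ₗ[𝕜] 𝕜, (∀ g ∈ N, ν g = 0) ∧ ∀ g ∈ S, ν (D g) = μ g := by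
  set E : S →ₗ[𝕜] V ⧸ N := N.mkQ ∘ₗ D ∘ₗ S.subtype with hE
  have h1 : μ ∘ₗ S.subtype ∈ LinearMap.range E.dualMap := by
    rw [LinearMap.range_dualMap_eq_dualAnnihilator_ker, Submodule.mem_dualAnnihilator]
    intro g hg
    refine h g g.2 ?_
    rw [LinearMap.mem_ker] at hg
    simpa [hE, Submodule.Quotient.mk_eq_zero] using hg
  obtain ⟨φ, hφ⟩ := h1
  refine ⟨φ ∘ₗ N.mkQ, fun g hg => ?_, fun g hg => ?_⟩
  · have : N.mkQ g = 0 := by simpa using hg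
    simp [this]
  · exact LinearMap.congr_fun hφ ⟨g, hg⟩

/-- Gluing of functionals along the intersection of two subspaces. -/
lemma exists_functional_sup {V : Type*} [AddCommGroup V] [Module 𝕜 V] (S T : Submodule 𝕜 V)
    (μ ν : V →ₗ[𝕜] 𝕜) (h : ∀ g ∈ S, g ∈ T → μ g = ν g) :
    ∃ ρ : V →ₗ[𝕜] 𝕜, (∀ g ∈ S, ρ g = μ g) ∧ ∀ g ∈ T, ρ g = ν g := by
  obtain ⟨ρ, hρ1, hρ2⟩ := exists_functional (LinearMap.id) T S (ν - μ) fun g hg hg' => by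
    simp [h g hg' hg]
  exact ⟨μ + ρ, fun g hg => by simp [hρ1 g hg], fun g hg => by
    have := hρ2 g hg
    simp only [LinearMap.id_coe, id_eq] at this
    simp [this]⟩

/-- A functional separating a vector from a subspace. -/
lemma exists_separating {V : Type*} [AddCommGroup V] [Module 𝕜 V] (S : Submodule 𝕜 V) {v : V}
    (hv : v ∉ S) : ∃ μ : V →ₗ[𝕜] 𝕜, (∀ g ∈ S, μ g = 0) ∧ μ v = 1 := by
  obtain ⟨f, hfv, hf⟩ := Submodule.exists_le_ker_of_notMem hv
  exact ⟨(f v)⁻¹ • f, fun g hg => by simp [LinearMap.mem_ker.1 (hf hg)],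
    by simp [inv_mul_cancel₀ hfv]⟩

end Algebra

section Support

variable {X 𝕜 : Type*} [Field 𝕜] [MetricSpace X]

/-- Homogeneous cochains with compact support in `U`. -/
def CS (𝕜 : Type*) [Field 𝕜] {X : Type*} [MetricSpace X] (U : Set X) (k : ℕ) :
    Submodule 𝕜 (List X → 𝕜) where
  carrier := {g | (∀ l, l.length ≠ k → g l = 0) ∧
    ∃ K, IsCompact K ∧ K ⊆ U ∧ Null (Germ.on Kᶜ) k g}
  zero_mem' := ⟨fun _ _ => rfl, ∅, isCompact_empty, empty_subset _, Null.zero⟩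
  add_mem' := by
    rintro f g ⟨hf, K, hK, hKU, hfK⟩ ⟨hg, L, hL, hLU, hgL⟩
    exact ⟨fun l hl => by simp [hf l hl, hg l hl], K ∪ L, hK.union hL, union_subset hKU hLU,
      (hfK.on_mono (compl_subset_compl.2 subset_union_left)).add
        (hgL.on_mono (compl_subset_compl.2 subset_union_right))⟩
  smul_mem' := by
    rintro c f ⟨hf, K, hK, hKU, hfK⟩
    exact ⟨fun l hl => by simp [hf l hl], K, hK, hKU, hfK.smul c⟩

variable {U V : Set X} {k : ℕ} {f g : List X → 𝕜}

lemma mem_CS : g ∈ CS 𝕜 U k ↔ (∀ l, l.length ≠ k → g l = 0) ∧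
    ∃ K, IsCompact K ∧ K ⊆ U ∧ Null (Germ.on Kᶜ) k g := Iff.rfl

lemma mem_CS_empty : g ∈ CS 𝕜 ∅ k ↔ (∀ l, l.length ≠ k → g l = 0) ∧ Null (Germ.on univ) k g := by
  rw [mem_CS]
  refine and_congr_right fun _ => ⟨?_, fun h => ⟨∅, isCompact_empty, le_rfl, by rwa [compl_empty]⟩⟩
  rintro ⟨K, _, hK, h⟩
  rw [subset_empty_iff.1 hK, compl_empty] at h
  exact h

lemma CS_mono (h : U ⊆ V) : CS 𝕜 U k ≤ CS 𝕜 V k := fun _ hg =>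
  ⟨hg.1, hg.2.imp fun _ hK => ⟨hK.1, hK.2.1.trans h, hK.2.2⟩⟩

lemma CS_empty_le : CS 𝕜 ∅ k ≤ CS 𝕜 U k := CS_mono (empty_subset _)

lemma hom_of_mem_CS (hg : g ∈ CS 𝕜 U k) : hom k g = g := hom_eq hg.1

lemma hom_ne_of_mem_CS (hg : g ∈ CS 𝕜 U k) {m : ℕ} (h : m ≠ k) : hom m g = 0 := by
  rw [← hom_of_mem_CS hg, hom_hom_ne h]

lemma d_mem_CS (hg : g ∈ CS 𝕜 U k) : d g ∈ CS 𝕜 U (k + 1) := by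
  obtain ⟨h, K, hK, hKU, hn⟩ := hg
  refine ⟨fun l hl => d_eq_zero fun l' _ hl' => h l' (by omega), K, hK, hKU, hn.d⟩

lemma nil_of_mem_CS (hg : g ∈ CS 𝕜 U k) : g [] = 0 := by
  by_cases hk : k = 0
  · subst hk
    obtain ⟨_, K, _, _, h⟩ := hg
    exact null_on_zero.1 h
  · exact hg.1 [] (by simpa using Ne.symm hk)

lemma exists_mem_CS_of_mem (hg : g ∈ CS 𝕜 U k) : ∃ K, IsCompact K ∧ K ⊆ U ∧
    ∀ V, K ⊆ V → g ∈ CS 𝕜 V k := by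
  obtain ⟨h, K, hK, hKU, hn⟩ := hg
  exact ⟨K, hK, hKU, fun V hV => ⟨h, K, hK, hV, hn⟩⟩

variable [CompactSpace X]

lemma exists_support (hU : IsOpen U) (hg : g ∈ CS 𝕜 U k) : ∃ K, IsCompact K ∧ K ⊆ U ∧ ∃ ε > 0,
    ∀ l : List X, (∀ a ∈ l, ∀ b ∈ l, dist a b < ε) → (∃ a ∈ l, a ∉ K) → g l = 0 := by
  obtain ⟨h, K, hK, hKU, ε, hε, hn⟩ := hg
  obtain ⟨δ, hδ, hδU⟩ := hK.exists_cthickening_subset_open hU hKU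
  refine ⟨Metric.cthickening δ K, Metric.isClosed_cthickening.isCompact, hδU, min ε δ,
    lt_min hε hδ, fun l hd ⟨a, ha, haK⟩ => ?_⟩
  by_cases hl : l.length = k
  · refine hn l hl ⟨fun b hb hbK => haK ?_, fun a ha b hb => (hd a ha b hb).trans_le (min_le_left _ _)⟩
    exact Metric.mem_cthickening_of_dist_le a b δ K hbK ((hd a ha b hb).le.trans (min_le_right _ _))
  · exact h l hl

lemma CS_inter (hU : IsOpen U) (hV : IsOpen V) (hf : g ∈ CS 𝕜 U k) (hf' : g ∈ CS 𝕜 V k) :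
    g ∈ CS 𝕜 (U ∩ V) k := by
  obtain ⟨K, hK, hKU, ε, hε, h⟩ := exists_support hU hf
  obtain ⟨L, hL, hLV, ε', hε', h'⟩ := exists_support hV hf'
  refine ⟨hf.1, K ∩ L, hK.inter hL, inter_subset_inter hKU hLV, min ε ε', lt_min hε hε',
    fun l hl hC => ?_⟩
  cases l with
  | nil => exact nil_of_mem_CS hf
  | cons a l =>
    have h1 := hC.1 a (by simp)
    rw [mem_compl_iff, mem_inter_iff, not_and_or] at h1
    rcases h1 with h1 | h1
    · exact h _ (fun a ha b hb => (hC.2 a ha b hb).trans_le (min_le_left _ _)) ⟨a, by simp, h1⟩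
    · exact h' _ (fun a ha b hb => (hC.2 a ha b hb).trans_le (min_le_right _ _)) ⟨a, by simp, h1⟩

open Classical in
lemma CS_union (hU : IsOpen U) (hV : IsOpen V) (hg : g ∈ CS 𝕜 (U ∪ V) k) :
    ∃ g₁ ∈ CS 𝕜 U k, ∃ g₂ ∈ CS 𝕜 V k, g = g₁ + g₂ := by
  obtain ⟨K, hK, hKU, ε, hε, h⟩ := exists_support (hU.union hV) hg
  obtain ⟨K₁, K₂, hK₁, hK₂, h1, h2, rfl⟩ := hK.binary_compact_cover hU hV hKU
  set g₁ : List X → 𝕜 := fun l => if ∃ a ∈ l.head?, a ∈ K₁ then g l else 0 with hg₁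
  refine ⟨g₁, ⟨fun l hl => ?_, K₁, hK₁, h1, 1, one_pos, fun l hl hC => ?_⟩, g - g₁,
    ⟨fun l hl => ?_, K₂, hK₂, h2, ε, hε, fun l hl hC => ?_⟩, by simp⟩
  · simp [hg₁, hg.1 l hl]
  · rw [hg₁]
    simp only
    rw [if_neg]
    rintro ⟨a, ha, haK⟩
    exact hC.1 a (List.mem_of_mem_head? ha) haK
  · simp [hg₁, hg.1 l hl]
  · rw [Pi.sub_apply, hg₁]
    simp only
    split_ifs with h3
    · simp
    · rw [sub_zero]
      cases l with
      | nil => exact nil_of_mem_CS hg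
      | cons a l =>
        refine h _ hC.2 ⟨a, by simp, ?_⟩
        rintro (h4 | h4)
        · exact h3 ⟨a, by simp, h4⟩
        · exact hC.1 a (by simp) h4

end Support

section Locally

variable {X 𝕜 : Type*} [Field 𝕜] [MetricSpace X]

/-- Cochains which vanish locally on `U`. -/
def LZ (U : Set X) (f : List X → 𝕜) : Prop :=
  ∀ K, IsCompact K → K ⊆ U → ∀ k, Null (Germ.on K) k f

variable {U V : Set X} {k : ℕ} {f g : List X → 𝕜}

lemma LZ.zero : LZ U (0 : List X → 𝕜) := fun _ _ _ _ => Null.zero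
lemma LZ.add (hf : LZ U f) (hg : LZ U g) : LZ U (f + g) := fun K hK hKU k =>
  (hf K hK hKU k).add (hg K hK hKU k)
lemma LZ.sub (hf : LZ U f) (hg : LZ U g) : LZ U (f - g) := fun K hK hKU k =>
  (hf K hK hKU k).sub (hg K hK hKU k)
lemma LZ.neg (hf : LZ U f) : LZ U (-f) := fun K hK hKU k => (hf K hK hKU k).neg
lemma LZ.mono (hf : LZ V f) (h : U ⊆ V) : LZ U f := fun K hK hKU k => hf K hK (hKU.trans h) k
lemma LZ.d (hf : LZ U f) : LZ U (d f) := by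
  intro K hK hKU k
  cases k with
  | zero => exact null_on_zero.2 (d_nil f)
  | succ k => exact (hf K hK hKU k).d
lemma LZ.sgn (hf : LZ U f) : LZ U (sgn f) := by
  intro K hK hKU k
  obtain ⟨ε, hε, h⟩ := hf K hK hKU k
  exact ⟨ε, hε, fun l hl hC => by rw [sgn_apply, h l hl hC, mul_zero]⟩

lemma LZ.hom (hf : LZ U f) (m : ℕ) : LZ U (hom m f) := by
  intro K hK hKU k
  obtain ⟨ε, hε, h⟩ := hf K hK hKU k
  exact ⟨ε, hε, fun l hl hC => by rw [hom_apply, h l hl hC, ite_self]⟩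

variable [CompactSpace X]

lemma LZ.union (hU : IsOpen U) (hV : IsOpen V) (hf : LZ U f) (hg : LZ V f) : LZ (U ∪ V) f := by
  intro K hK hKU k
  obtain ⟨K₁, K₂, hK₁, hK₂, h1, h2, rfl⟩ := hK.binary_compact_cover hU hV hKU
  obtain ⟨δ, hδ, hδU⟩ := hK₁.exists_cthickening_subset_open hU h1
  obtain ⟨δ', hδ', hδV⟩ := hK₂.exists_cthickening_subset_open hV h2
  obtain ⟨ε, hε, h⟩ := hf _ (Metric.isClosed_cthickening.isCompact) hδU k
  obtain ⟨ε', hε', h'⟩ := hg _ (Metric.isClosed_cthickening.isCompact) hδV k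
  refine ⟨min (min ε ε') (min δ δ'), by positivity, fun l hl hC => ?_⟩
  have e1 : min (min ε ε') (min δ δ') ≤ ε := (min_le_left _ _).trans (min_le_left _ _)
  have e2 : min (min ε ε') (min δ δ') ≤ ε' := (min_le_left _ _).trans (min_le_right _ _)
  have e3 : min (min ε ε') (min δ δ') ≤ δ := (min_le_right _ _).trans (min_le_left _ _)
  have e4 : min (min ε ε') (min δ δ') ≤ δ' := (min_le_right _ _).trans (min_le_right _ _)
  by_cases hne : ∃ a ∈ l, a ∈ K₁
  · obtain ⟨a, ha, haK⟩ := hne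
    exact h l hl ⟨fun b hb => Metric.mem_cthickening_of_dist_le b a δ K₁ haK
      ((hC.2 b hb a ha).le.trans e3), fun a ha b hb => (hC.2 a ha b hb).trans_le e1⟩
  · push Not at hne
    exact h' l hl ⟨fun b hb => Metric.self_subset_cthickening _ ((hC.1 b hb).resolve_left (hne b hb)),
      fun a ha b hb => (hC.2 a ha b hb).trans_le e2⟩

omit [CompactSpace X] in
lemma cup_mem_CS (w : List X → 𝕜) (hg : g ∈ CS 𝕜 U k) (m : ℕ) : hom m (cup w g) ∈ CS 𝕜 U m := by
  obtain ⟨h, K, hK, hKU, ε, hε, hn⟩ := hg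
  refine ⟨fun l hl => by rw [hom_apply, if_neg hl], K, hK, hKU, ε, hε, fun l hl hC => ?_⟩
  rw [hom_apply, if_pos hl]
  refine cup_eq_zero fun l₁ l₂ a hl' => ?_
  have h0 : a :: l₂ ⊆ l := by
    intro x hx
    rw [hl']
    exact List.mem_append_right _ hx
  by_cases hlen : (a :: l₂).length = k
  · rw [hn _ hlen ((Germ.on Kᶜ).sub h0 hC), mul_zero]
  · rw [h _ hlen, mul_zero]

lemma cup_mem_CS_empty (hU : IsOpen U) (hf : LZ U f) (hg : g ∈ CS 𝕜 U k) (m : ℕ) :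
    hom m (cup f g) ∈ CS 𝕜 ∅ m := by
  refine mem_CS_empty.2 ⟨fun l hl => by rw [hom_apply, if_neg hl], ?_⟩
  obtain ⟨K, hK, hKU, ε, hε, h⟩ := exists_support hU hg
  by_cases hmk : m + 1 < k
  · refine ⟨1, one_pos, fun l hl _ => ?_⟩
    rw [hom_apply, if_pos hl]
    refine cup_eq_zero fun l₁ l₂ a hl' => ?_
    rw [hg.1 (a :: l₂), mul_zero]
    subst hl'
    simp at hl ⊢
    omega
  obtain ⟨δ, hδ, hδU⟩ := hK.exists_cthickening_subset_open hU hKU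
  obtain ⟨ε', hε', h'⟩ := hf _ Metric.isClosed_cthickening.isCompact hδU (m + 1 - k)
  refine ⟨min ε (min ε' δ), by positivity, fun l hl hC => ?_⟩
  rw [hom_apply, if_pos hl]
  refine cup_eq_zero fun l₁ l₂ a hl' => ?_
  have h0 : a :: l₂ ⊆ l := by
    intro x hx
    rw [hl']
    exact List.mem_append_right _ hx
  have h1 : l₁ ++ [a] ⊆ l := by
    intro x hx
    rw [hl']
    simp only [List.mem_append, List.mem_cons, List.not_mem_nil, or_false] at hx ⊢
    tauto
  by_cases hlen : (a :: l₂).length = k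
  swap
  · rw [hg.1 _ hlen, mul_zero]
  by_cases haK : a ∈ K
  swap
  · rw [h (a :: l₂) (fun x hx y hy => (hC.2 x (h0 hx) y (h0 hy)).trans_le (min_le_left _ _))
      ⟨a, by simp, haK⟩, mul_zero]
  rw [h', zero_mul]
  · subst hl'
    simp at hl hlen ⊢
    omega
  · exact ⟨fun x hx => Metric.mem_cthickening_of_dist_le x a δ K haK
      ((hC.2 x (h1 hx) a (h0 (by simp))).le.trans ((min_le_right _ _).trans (min_le_right _ _))),
      fun x hx y hy => (hC.2 x (h1 hx) y (h1 hy)).trans_le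
        ((min_le_right _ _).trans (min_le_left _ _))⟩

end Locally

section OpenInduction

variable {X : Type*} [MetricSpace X] [CompactSpace X]

/-- Unions of `m` members of a family of sets. -/
def UnionOf (𝓞 : Set (Set X)) : ℕ → Set X → Prop
  | 0, U => U = ∅
  | m + 1, U => ∃ U' V, UnionOf 𝓞 m U' ∧ V ∈ 𝓞 ∧ U = U' ∪ V

variable {𝓞 : Set (Set X)}

omit [MetricSpace X] [CompactSpace X] in
lemma UnionOf.union {m n : ℕ} {U V : Set X} (hU : UnionOf 𝓞 m U) (hV : UnionOf 𝓞 n V) :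
    UnionOf 𝓞 (m + n) (U ∪ V) := by
  induction n generalizing V with
  | zero =>
    rw [show V = ∅ from hV, union_empty]
    exact hU
  | succ n ih =>
    obtain ⟨V', O, hV', hO, rfl⟩ := hV
    exact ⟨U ∪ V', O, ih hV', hO, (union_assoc _ _ _).symm⟩

omit [MetricSpace X] [CompactSpace X] in
lemma UnionOf.inter (h𝓞 : ∀ U ∈ 𝓞, ∀ V ∈ 𝓞, U ∩ V ∈ 𝓞) {m : ℕ} {U V : Set X}
    (hU : UnionOf 𝓞 m U) (hV : V ∈ 𝓞) : UnionOf 𝓞 m (U ∩ V) := by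
  induction m generalizing U with
  | zero =>
    rw [show U = ∅ from hU, empty_inter]
    rfl
  | succ m ih =>
    obtain ⟨U', O, hU', hO, rfl⟩ := hU
    exact ⟨U' ∩ V, O ∩ V, ih hU', h𝓞 _ hO _ hV, union_inter_distrib_right _ _ _⟩

omit [CompactSpace X] in
lemma UnionOf.isOpen (ho : ∀ U ∈ 𝓞, IsOpen U) {m : ℕ} {U : Set X}
    (hU : UnionOf 𝓞 m U) : IsOpen U := by
  induction m generalizing U with
  | zero =>
    rw [show U = ∅ from hU]
    exact isOpen_empty
  | succ m ih =>
    obtain ⟨U', O, hU', hO, rfl⟩ := hU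
    exact (ih hU').union (ho _ hO)

omit [CompactSpace X] in
lemma UnionOf.interpolate (ho : ∀ U ∈ 𝓞, IsOpen U)
    (hi : ∀ U ∈ 𝓞, ∀ K, IsCompact K → K ⊆ U → ∃ V ∈ 𝓞, K ⊆ V ∧ closure V ⊆ U) {m : ℕ} {U : Set X}
    (hU : UnionOf 𝓞 m U) {K : Set X} (hK : IsCompact K) (hKU : K ⊆ U) :
    ∃ V, UnionOf 𝓞 m V ∧ K ⊆ V ∧ closure V ⊆ U := by
  induction m generalizing U K with
  | zero => exact ⟨∅, rfl, by rwa [show U = ∅ from hU] at hKU, by simp⟩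
  | succ m ih =>
    obtain ⟨U', O, hU', hO, rfl⟩ := hU
    obtain ⟨K₁, K₂, hK₁, hK₂, h1, h2, rfl⟩ :=
      hK.binary_compact_cover (hU'.isOpen ho) (ho _ hO) hKU
    obtain ⟨V, hV, h3, h4⟩ := ih hU' hK₁ h1
    obtain ⟨V', hV', h5, h6⟩ := hi O hO K₂ hK₂ h2
    exact ⟨V ∪ V', ⟨V, V', hV, hV', rfl⟩, union_subset_union h3 h5,
      closure_union.trans_subset (union_subset_union h4 h6)⟩

omit [CompactSpace X] in
/-- Induction over open sets by a Mayer–Vietoris argument. -/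
lemma open_induction {P : Set X → Prop} (ho : ∀ U ∈ 𝓞, IsOpen U)
    (h𝓞 : ∀ U ∈ 𝓞, ∀ V ∈ 𝓞, U ∩ V ∈ 𝓞)
    (hi : ∀ U ∈ 𝓞, ∀ K, IsCompact K → K ⊆ U → ∃ V ∈ 𝓞, K ⊆ V ∧ closure V ⊆ U)
    (h0 : P ∅) (hP : ∀ U ∈ 𝓞, P U)
    (hmv : ∀ U V, IsOpen U → IsOpen V → P U → P V → (∀ K, IsCompact K → K ⊆ U ∪ V →
      ∃ U₁ V₁, IsOpen U₁ ∧ IsOpen V₁ ∧ closure U₁ ⊆ U ∧ closure V₁ ⊆ V ∧ K ⊆ U₁ ∪ V₁ ∧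
        P (U₁ ∩ V₁)) → P (U ∪ V))
    (hdir : ∀ U, IsOpen U → (∀ K, IsCompact K → K ⊆ U → ∃ V, IsOpen V ∧ V ⊆ U ∧ K ⊆ V ∧ P V) →
      P U)
    {U : Set X} (hU : ∀ x ∈ U, ∃ V ∈ 𝓞, x ∈ V ∧ V ⊆ U) : P U := by
  have key : ∀ m U, UnionOf 𝓞 m U → P U := by
    intro m
    induction m with
    | zero =>
      rintro U hU
      rwa [show U = ∅ from hU]
    | succ m ih =>
      rintro _ ⟨U, V, hU, hV, rfl⟩
      refine hmv U V (hU.isOpen ho) (ho V hV) (ih U hU) (hP V hV) fun K hK hKUV => ?_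
      obtain ⟨K₁, K₂, hK₁, hK₂, h1, h2, rfl⟩ :=
        hK.binary_compact_cover (hU.isOpen ho) (ho _ hV) hKUV
      obtain ⟨U₁, hU₁, h3, h4⟩ := hU.interpolate ho hi hK₁ h1
      obtain ⟨V₁, hV₁, h5, h6⟩ := hi V hV K₂ hK₂ h2
      exact ⟨U₁, V₁, hU₁.isOpen ho, ho _ hV₁, h4, h6, union_subset_union h3 h5,
        ih _ (hU₁.inter h𝓞 hV₁)⟩
  have hUo : IsOpen U := isOpen_iff_forall_mem_open.2 fun x hx => by
    obtain ⟨V, hV, hx, h⟩ := hU x hx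
    exact ⟨V, h, ho V hV, hx⟩
  refine hdir U hUo fun K hK hKU => ?_
  have : ∃ m V, UnionOf 𝓞 m V ∧ V ⊆ U ∧ K ⊆ V := by
    refine hK.induction_on (p := fun K => ∃ m V, UnionOf 𝓞 m V ∧ V ⊆ U ∧ K ⊆ V) ?_ ?_ ?_ ?_
    · exact ⟨0, ∅, rfl, by simp⟩
    · rintro s t hst ⟨m, V, hV, h1, h2⟩
      exact ⟨m, V, hV, h1, hst.trans h2⟩
    · rintro s t ⟨m, V, hV, h1, h2⟩ ⟨n, W, hW, h3, h4⟩
      exact ⟨m + n, V ∪ W, hV.union hW, union_subset h1 h3, union_subset_union h2 h4⟩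
    · intro x hx
      obtain ⟨V, hV, hxV, h⟩ := hU x (hKU hx)
      exact ⟨V, mem_nhdsWithin_of_mem_nhds ((ho V hV).mem_nhds hxV), 1, V,
        ⟨∅, V, rfl, hV, by simp⟩, h, subset_rfl⟩
  obtain ⟨m, V, hV, h1, h2⟩ := this
  exact ⟨V, hV.isOpen ho, h1, h2, key m V hV⟩

end OpenInduction

section Cohomology

variable {X 𝕜 : Type*} [Field 𝕜] [MetricSpace X]

/-- Compactly supported cocycles of degree `k`. -/
def coc (𝕜 : Type*) [Field 𝕜] {X : Type*} [MetricSpace X] (U : Set X) (k : ℕ) :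
    Submodule 𝕜 (List X → 𝕜) :=
  CS 𝕜 U (k + 1) ⊓ (CS 𝕜 ∅ (k + 2)).comap dL

/-- Compactly supported coboundaries of degree `k`. -/
def cob (𝕜 : Type*) [Field 𝕜] {X : Type*} [MetricSpace X] (U : Set X) (k : ℕ) :
    Submodule 𝕜 (List X → 𝕜) :=
  (CS 𝕜 U k).map dL ⊔ CS 𝕜 ∅ (k + 1)

variable {U V : Set X} {k : ℕ} {f g : List X → 𝕜}

lemma mem_coc : g ∈ coc 𝕜 U k ↔ g ∈ CS 𝕜 U (k + 1) ∧ d g ∈ CS 𝕜 ∅ (k + 2) := Iff.rfl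

lemma mem_cob : g ∈ cob 𝕜 U k ↔ ∃ w ∈ CS 𝕜 U k, g - d w ∈ CS 𝕜 ∅ (k + 1) := by
  rw [cob, Submodule.mem_sup]
  constructor
  · rintro ⟨_, ⟨w, hw, rfl⟩, z, hz, rfl⟩
    exact ⟨w, hw, by simpa using hz⟩
  · rintro ⟨w, hw, h⟩
    exact ⟨d w, ⟨w, hw, rfl⟩, _, h, by simp⟩

lemma coc_mono (h : U ⊆ V) : coc 𝕜 U k ≤ coc 𝕜 V k := inf_le_inf_right _ (CS_mono h)

lemma cob_mono (h : U ⊆ V) : cob 𝕜 U k ≤ cob 𝕜 V k :=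
  sup_le_sup_right (Submodule.map_mono (CS_mono h)) _

lemma CS_empty_le_cob : CS 𝕜 ∅ (k + 1) ≤ cob 𝕜 U k := le_sup_right

lemma d_mem_cob (hg : g ∈ CS 𝕜 U k) : d g ∈ cob 𝕜 U k := Submodule.mem_sup_left ⟨g, hg, rfl⟩

lemma d_mem_coc (hg : g ∈ CS 𝕜 U k) : d g ∈ coc 𝕜 U k :=
  mem_coc.2 ⟨d_mem_CS hg, by rw [d_d]; exact Submodule.zero_mem _⟩

lemma cob_le_coc : cob 𝕜 U k ≤ coc 𝕜 U k := by
  refine sup_le ?_ fun g hg => ⟨CS_empty_le hg, d_mem_CS hg⟩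
  rintro _ ⟨w, hw, rfl⟩
  exact d_mem_coc hw

lemma coc_empty_le_cob : coc 𝕜 ∅ k ≤ cob 𝕜 U k := fun _ hg => CS_empty_le_cob hg.1

lemma exists_open_mem_coc (hg : g ∈ coc 𝕜 U k) : ∃ K, IsCompact K ∧ K ⊆ U ∧
    ∀ V, K ⊆ V → g ∈ coc 𝕜 V k := by
  obtain ⟨K, hK, hKU, h1⟩ := exists_mem_CS_of_mem hg.1
  exact ⟨K, hK, hKU, fun V hV => ⟨h1 V hV, hg.2⟩⟩

/-- Compactly supported cohomology vanishes above degree `n`. -/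
def DimLE (𝕜 : Type*) [Field 𝕜] {X : Type*} [MetricSpace X] (n : ℕ) (U : Set X) : Prop :=
  ∀ k > n, coc 𝕜 U k ≤ cob 𝕜 U k

lemma DimLE.empty {n : ℕ} : DimLE 𝕜 n (∅ : Set X) := fun _ _ => coc_empty_le_cob

variable [CompactSpace X]

/-- Splitting a cocycle along a cover when the obstruction vanishes. -/
lemma coc_union_le
    (h : ∀ K, IsCompact K → K ⊆ U ∪ V → ∃ U₁ V₁, IsOpen U₁ ∧ IsOpen V₁ ∧ closure U₁ ⊆ U ∧
      closure V₁ ⊆ V ∧ K ⊆ U₁ ∪ V₁ ∧ coc 𝕜 (U₁ ∩ V₁) (k + 1) ≤ cob 𝕜 (U₁ ∩ V₁) (k + 1)) :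
    coc 𝕜 (U ∪ V) k ≤ coc 𝕜 U k ⊔ coc 𝕜 V k := by
  intro g hg
  obtain ⟨K, hK, hKU, hgK⟩ := exists_mem_CS_of_mem hg.1
  obtain ⟨U₁, V₁, hU₁, hV₁, h1, h2, h3, h4⟩ := h K hK hKU
  obtain ⟨g₁, hg₁, g₂, hg₂, e⟩ := CS_union hU₁ hV₁ (hgK _ h3)
  have hd : d g₁ = d g - d g₂ := by rw [e, d_add']; simp
  have h5 : d g₁ ∈ CS 𝕜 (U₁ ∩ V₁) (k + 2) := by
    refine CS_inter hU₁ hV₁ (d_mem_CS hg₁) ?_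
    rw [hd]
    exact Submodule.sub_mem _ (CS_empty_le hg.2) (d_mem_CS hg₂)
  obtain ⟨w, hw, h6⟩ := mem_cob.1 (h4 (mem_coc.2 ⟨h5, by rw [d_d]; exact Submodule.zero_mem _⟩))
  have s1 := subset_closure.trans h1
  have s2 := subset_closure.trans h2
  refine Submodule.mem_sup.2 ⟨g₁ - w, mem_coc.2 ⟨?_, by rwa [d_sub]⟩, g₂ + w, mem_coc.2 ⟨?_, ?_⟩,
    by rw [e]; abel⟩
  · exact Submodule.sub_mem _ (CS_mono s1 hg₁) (CS_mono (inter_subset_left.trans s1) hw)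
  · exact Submodule.add_mem _ (CS_mono s2 hg₂) (CS_mono (inter_subset_right.trans s2) hw)
  · have : d (g₂ + w) = d g - (d g₁ - d w) := by rw [d_add', hd]; abel
    rw [this]
    exact Submodule.sub_mem _ hg.2 h6

lemma DimLE.union {n : ℕ} (h : DimLE 𝕜 n U) (h' : DimLE 𝕜 n V)
    (hUV : ∀ K, IsCompact K → K ⊆ U ∪ V → ∃ U₁ V₁, IsOpen U₁ ∧ IsOpen V₁ ∧ closure U₁ ⊆ U ∧
      closure V₁ ⊆ V ∧ K ⊆ U₁ ∪ V₁ ∧ DimLE 𝕜 n (U₁ ∩ V₁)) : DimLE 𝕜 n (U ∪ V) := by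
  intro k hk
  refine (coc_union_le fun K hK hKU => ?_).trans (sup_le
    ((h k hk).trans (cob_mono subset_union_left)) ((h' k hk).trans (cob_mono subset_union_right)))
  obtain ⟨U₁, V₁, hU₁, hV₁, h1, h2, h3, h4⟩ := hUV K hK hKU
  exact ⟨U₁, V₁, hU₁, hV₁, h1, h2, h3, h4 (k + 1) (by omega)⟩

omit [CompactSpace X] in
lemma DimLE.directed {n : ℕ}
    (h : ∀ K, IsCompact K → K ⊆ U → ∃ V, IsOpen V ∧ V ⊆ U ∧ K ⊆ V ∧ DimLE 𝕜 n V) :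
    DimLE 𝕜 n U := by
  intro k hk g hg
  obtain ⟨K, hK, hKU, hgK⟩ := exists_open_mem_coc hg
  obtain ⟨V, _, hVU, hKV, hV⟩ := h K hK hKU
  exact cob_mono hVU (hV k hk (hgK V hKV))

end Cohomology

section Pair

variable {X 𝕜 : Type*} [Field 𝕜] [MetricSpace X] [CompactSpace X]
  {Q B : Set X} {k : ℕ} {f g w v : List X → 𝕜}

omit [CompactSpace X] in
open Classical in
/-- A cochain on `Q` vanishing near `Q \ B` extends by zero. -/
lemma exists_extension (hQ : IsCompact Q)
    (hf : Null (Germ.near Q (Q \ B)) k f) :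
    ∃ f' ∈ CS 𝕜 B k, ∀ l : List X, l.length = k → (∀ a ∈ l, a ∈ Q) → f' l = f l := by
  obtain ⟨ε, hε, h⟩ := hf
  refine ⟨fun l => if l.length = k ∧ ∀ a ∈ l, a ∈ Q then f l else 0,
    ⟨fun l hl => if_neg fun h => hl h.1, Q \ Metric.thickening ε (Q \ B),
      hQ.diff Metric.isOpen_thickening, fun x hx => ?_, ε, hε, fun l hl hC => ?_⟩, fun l hl hlQ =>
      if_pos ⟨hl, hlQ⟩⟩
  · by_contra hxB
    exact hx.2 (Metric.self_subset_thickening hε _ ⟨hx.1, hxB⟩)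
  · simp only
    split_ifs with hlQ
    swap
    · rfl
    refine h l hl ⟨hlQ.2, fun a ha => ?_, hC.2⟩
    have h1 := hC.1 a ha
    rw [mem_compl_iff, Set.mem_sdiff, not_and, not_not] at h1
    exact Metric.mem_thickening_iff.1 (h1 (hlQ.2 a ha))

/-- A compactly supported cochain in `B` is determined by its restriction to `Q`. -/
lemma mem_CS_empty_of_null (hB : IsOpen B) (hBQ : B ⊆ Q) (hg : g ∈ CS 𝕜 B k)
    (h : Null (Germ.on Q) k g) : g ∈ CS 𝕜 ∅ k := by
  obtain ⟨K, _, hKB, ε, hε, hK⟩ := exists_support hB hg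
  obtain ⟨ε', hε', h'⟩ := h
  refine mem_CS_empty.2 ⟨hg.1, min ε ε', by positivity, fun l hl hC => ?_⟩
  by_cases hlK : ∃ a ∈ l, a ∉ K
  · exact hK l (fun a ha b hb => (hC.2 a ha b hb).trans_le (min_le_left _ _)) hlK
  · push Not at hlK
    exact h' l hl ⟨fun a ha => hBQ (hKB (hlK a ha)),
      fun a ha b hb => (hC.2 a ha b hb).trans_le (min_le_right _ _)⟩

omit [CompactSpace X] in
lemma null_near_of_mem_CS (hB : IsOpen B) (hg : g ∈ CS 𝕜 B k) :
    Null (Germ.near Q (Q \ B)) k g := by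
  obtain ⟨_, K, hK, hKB, ε, hε, h⟩ := hg
  obtain ⟨δ, hδ, h'⟩ := hK.exists_cthickening_subset_open hB hKB
  refine ⟨min ε δ, by positivity, fun l hl hC => h l hl ⟨fun a ha haK => ?_,
    fun a ha b hb => (hC.2.2 a ha b hb).trans_le (min_le_left _ _)⟩⟩
  obtain ⟨b, hb, hab⟩ := hC.2.1 a ha
  refine hb.2 (h' (Metric.mem_cthickening_of_dist_le b a δ K haK ?_))
  rw [dist_comm]
  exact hab.le.trans (min_le_right _ _)

/-- A cocycle supported in `B` with a primitive on `Q` that is exact on `Q \ B` is a compactly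
supported coboundary. -/
lemma mem_cob_of_pair (hQ : IsCompact Q) (hB : IsOpen B) (hBQ : B ⊆ Q) (hg : g ∈ CS 𝕜 B (k + 1))
    (hw : Null (Germ.on Q) (k + 1) (g - d w)) (hv : Null (Germ.on (Q \ B)) k (w - d v)) :
    g ∈ cob 𝕜 B k := by
  obtain ⟨v', hv'⟩ := Null.exists_near (T := Q) (hQ.diff hB) Set.sdiff_subset
    (((null_near_of_mem_CS hB hg).sub hw.near_of_on).congr fun l _ => by simp) hv
  obtain ⟨w', hw', h⟩ := exists_extension hQ hv'
  refine mem_cob.2 ⟨w', hw', mem_CS_empty_of_null hB hBQ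
    (Submodule.sub_mem _ hg (d_mem_CS hw')) (hw.of_eq_on fun l hl hlQ => ?_)⟩
  have h1 : d w' l = d (w - d v') l := d_congr l fun l' hs hl' =>
    h l' (by omega) fun a ha => hlQ.1 a (hs.subset ha)
  rw [Pi.sub_apply, Pi.sub_apply, h1, d_sub, d_d, sub_zero]

end Pair

section Chart

variable {E X : Type*} [MetricSpace E] [MetricSpace X]

/-- Transport of a homotopy along an embedding. -/
lemma exists_chart_homotopy {φ : E → X} (hφ : IsOpenEmbedding φ) {A : Set E} {h : ℝ → E → E}
    (hc : ContinuousOn (Function.uncurry h) (Icc 0 1 ×ˢ A)) :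
    ∃ H : ℝ → X → X, ContinuousOn (Function.uncurry H) (Icc 0 1 ×ˢ (φ '' A)) ∧
      ∀ t e, H t (φ e) = φ (h t e) := by
  rcases isEmpty_or_nonempty E with hE | hE
  · exact ⟨fun _ x => x, by fun_prop, fun _ e => (IsEmpty.false e).elim⟩
  have hl : ∀ e, Function.invFun φ (φ e) = e := Function.leftInverse_invFun hφ.injective
  refine ⟨fun t x => φ (h t (Function.invFun φ x)), ?_, fun t e => by simp only [hl]⟩
  have h1 : ContinuousOn (Function.invFun φ) (φ '' A) := by
    rintro _ ⟨e, _, rfl⟩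
    refine ContinuousAt.continuousWithinAt ?_
    rw [hφ.continuousAt_iff.symm]
    have : Function.invFun φ ∘ φ = id := funext hl
    rw [this]
    exact continuousAt_id
  refine hφ.continuous.comp_continuousOn (hc.comp (f := fun p : ℝ × X => (p.1, Function.invFun φ p.2))
    (continuousOn_fst.prodMk (h1.comp continuousOn_snd fun p hp => hp.2)) ?_)
  rintro ⟨t, _⟩ ⟨ht, e, he, rfl⟩
  exact ⟨ht, by simpa [hl] using he⟩

/-- Deformation retractions inside a chart. -/
lemma Kills.of_chart_homotopy {R : Type*} [AddCommGroup R] {φ : E → X} (hφ : IsOpenEmbedding φ)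
    {A D : Set E} (hA : IsCompact A) (hDA : D ⊆ A) (hD : Kills R (φ '' D) (φ '' D)) {h : ℝ → E → E}
    (hc : ContinuousOn (Function.uncurry h) (Icc 0 1 ×ˢ A))
    (hm : ∀ t ∈ Icc (0 : ℝ) 1, ∀ x ∈ A, h t x ∈ A) (h0 : ∀ x ∈ A, h 0 x = x)
    (h1 : ∀ x ∈ A, h 1 x ∈ D) : Kills R (φ '' A) (φ '' A) := by
  obtain ⟨H, hH, hHφ⟩ := exists_chart_homotopy hφ hc
  refine fun k => KillsAt.of_homotopy (hA.image hφ.continuous) (hD k) (image_mono hDA) H hH ?_ ?_ ?_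
  · rintro t ht _ ⟨e, he, rfl⟩
    rw [hHφ]
    exact mem_image_of_mem _ (hm t ht e he)
  · rintro _ ⟨e, he, rfl⟩
    rw [hHφ, h0 e he]
  · rintro _ ⟨e, he, rfl⟩
    rw [hHφ]
    exact mem_image_of_mem _ (h1 e he)

end Chart

section Convex

variable {E X R : Type*} [NormedAddCommGroup E] [NormedSpace ℝ E] [MetricSpace X] [AddCommGroup R]
  {φ : E → X}

lemma kills_convex (hφ : IsOpenEmbedding φ) {A : Set E} (hA : IsCompact A) (hc : Convex ℝ A)
    {z : E} (hz : z ∈ A) : Kills R (φ '' A) (φ '' A) := by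
  refine Kills.of_chart_homotopy hφ hA (singleton_subset_iff.2 hz) (D := {z})
    (h := fun t x => (1 - t) • x + t • z) ?_ ?_ ?_ ?_ ?_
  · rw [image_singleton]
    exact kills_singleton _
  · exact Continuous.continuousOn (by unfold Function.uncurry; fun_prop)
  · intro t ht x hx
    exact hc hx hz (by linarith [ht.2]) ht.1 (by ring)
  · simp
  · simp

/-- The radial homotopy pushing the complement of `B'` in the closure of `B` to the frontier. -/
lemma exists_radial {B B' : Set E} (hB : IsOpen B) (hc : Convex ℝ B) (hc' : Convex ℝ B')
    (hb : Bornology.IsBounded B) (hBB : B' ⊆ B) (hz : (0 : E) ∈ B') :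
    ∃ h : ℝ → E → E, ContinuousOn (Function.uncurry h) (Icc 0 1 ×ˢ (closure B \ B')) ∧
      (∀ t ∈ Icc (0 : ℝ) 1, ∀ x ∈ closure B \ B', h t x ∈ closure B \ B') ∧
      (∀ x, h 0 x = x) ∧ ∀ x ∈ closure B \ B', h 1 x ∈ closure B \ B := by
  have hn : B ∈ 𝓝 (0 : E) := hB.mem_nhds (hBB hz)
  have hpos : ∀ x ∉ B', 0 < gauge B x := fun x hx =>
    (gauge_pos (absorbent_nhds_zero hn) ((NormedSpace.isVonNBounded_iff ℝ).2 hb)).2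
      fun h => hx (h ▸ hz)
  have hle : ∀ x ∈ closure B, gauge B x ≤ 1 := fun x hx => (gauge_le_one_iff_mem_closure hc hn).2 hx
  refine ⟨fun t x => ((1 - t) + t * (gauge B x)⁻¹) • x, ?_, ?_, ?_, ?_⟩
  · refine ContinuousOn.smul (f := fun p : ℝ × E => (1 - p.1) + p.1 * (gauge B p.2)⁻¹) ?_
      continuousOn_snd
    refine (by fun_prop : ContinuousOn (fun p : ℝ × E => 1 - p.1) _).add (continuousOn_fst.mul ?_)
    exact ((continuous_gauge hc hn).comp_continuousOn continuousOn_snd).inv₀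
      fun p hp => (hpos p.2 hp.2.2).ne'
  · intro t ht x hx
    have h1 := hpos x hx.2
    have h2 := hle x hx.1
    have h3 : 1 ≤ (gauge B x)⁻¹ := (one_le_inv₀ h1).2 h2
    have h4 : 1 ≤ (1 - t) + t * (gauge B x)⁻¹ := by nlinarith [ht.1]
    refine ⟨(gauge_le_one_iff_mem_closure hc hn).1 ?_, fun h => hx.2 ?_⟩
    · rw [gauge_smul_of_nonneg (by linarith), smul_eq_mul, add_mul, mul_assoc,
        inv_mul_cancel₀ h1.ne']
      nlinarith [ht.2]
    · have h5 := hc'.smul_mem_of_zero_mem hz h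
        (t := ((1 - t) + t * (gauge B x)⁻¹)⁻¹) ⟨by positivity, inv_le_one_of_one_le₀ h4⟩
      rwa [smul_smul, inv_mul_cancel₀ (by positivity), one_smul] at h5
  · simp
  · intro x hx
    have h1 := hpos x hx.2
    have h2 : gauge B ((1 - 1 + 1 * (gauge B x)⁻¹) • x) = 1 := by
      rw [gauge_smul_of_nonneg (by simpa using h1.le), smul_eq_mul]
      field_simp
      ring
    have h3 := (gauge_eq_one_iff_mem_frontier hc hn).1 h2
    rwa [hB.frontier_eq] at h3

lemma mem_cob_of_mem_cob_convex_aux {𝕜 : Type*} [Field 𝕜] [CompactSpace X]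
    (hφ : IsOpenEmbedding φ) {B B' : Set E} (hB : IsOpen B) (hB' : IsOpen B') (hc : Convex ℝ B)
    (hc' : Convex ℝ B') (hQ : IsCompact (closure B)) (hBB : B' ⊆ B)
    (hz : (0 : E) ∈ B') {k : ℕ} {g : List X → 𝕜} (hg : g ∈ coc 𝕜 (φ '' B') k)
    (h : g ∈ cob 𝕜 (φ '' B) k) : g ∈ cob 𝕜 (φ '' B') k := by
  obtain ⟨r, hr, hr1, hr2, hr3⟩ := exists_radial hB hc hc' (hQ.isBounded.subset subset_closure) hBB hz
  obtain ⟨H, hH, hHφ⟩ := exists_chart_homotopy hφ hr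
  have hQ' : IsCompact (closure B') := hQ.of_isClosed_subset isClosed_closure (closure_mono hBB)
  have hA : IsCompact (closure B \ B') := hQ.diff hB'
  obtain ⟨w, hw, hgw⟩ := mem_cob.1 h
  have hgw := (mem_CS_empty.1 hgw).2
  have hgA : Null (Germ.on (φ '' (closure B \ B'))) (k + 1) g := by
    obtain ⟨_, K, _, hK, hn⟩ := hg.1
    refine hn.on_mono ?_
    rintro _ ⟨e, he, rfl⟩ heK
    obtain ⟨e', he', h⟩ := hK heK
    exact he.2 (hφ.injective h ▸ he')
  have hwS : Null (Germ.on (φ '' (closure B \ B))) k w := by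
    obtain ⟨_, K, _, hK, hn⟩ := hw
    refine hn.on_mono ?_
    rintro _ ⟨e, he, rfl⟩ heK
    obtain ⟨e', he', h⟩ := hK heK
    exact he.2 (hφ.injective h ▸ he')
  have hdw : Null (Germ.on (φ '' (closure B \ B'))) (k + 1) (d w) :=
    (hgA.sub (hgw.on_mono (subset_univ _))).congr fun l _ => by simp
  obtain ⟨y, hy⟩ := exists_null_homotopy (hA.image hφ.continuous) H hH
    (T := φ '' (closure B \ B')) (by
      rintro t ht _ ⟨e, he, rfl⟩
      rw [hHφ]
      exact mem_image_of_mem _ (hr1 t ht e he)) hdw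
  have hH1 : ContinuousOn (H 1) (φ '' (closure B \ B')) :=
    hH.comp (f := fun x => ((1 : ℝ), x)) (by fun_prop) fun x hx => ⟨by simp, hx⟩
  have hw1 := hwS.map (map_on_of_continuousOn (hA.image hφ.continuous) hH1 (by
    rintro _ ⟨e, he, rfl⟩
    rw [hHφ]
    exact mem_image_of_mem _ (hr3 e he)))
  have hwy : Null (Germ.on (φ '' (closure B \ B'))) k (w + d y) := by
    refine (hw1.sub hy).of_eq_on fun l _ hC => ?_
    have h4 : l.map (H 0) = l := by
      conv_rhs => rw [← List.map_id l]
      refine List.map_congr_left fun a ha => ?_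
      obtain ⟨e, he, rfl⟩ := hC.1 a ha
      rw [hHφ, hr2, id]
    simp only [Pi.sub_apply, Pi.add_apply, h4]
    abel
  have hKill : Kills 𝕜 (φ '' closure B') (φ '' closure B') :=
    kills_convex hφ hQ' hc'.closure (subset_closure hz)
  obtain ⟨v, hv⟩ := hKill (k + 1) g ((mem_CS_empty.1 hg.2).2.on_mono (subset_univ _))
  obtain ⟨y', hy'⟩ := hKill k (v - w) (((hgw.on_mono (subset_univ _)).sub hv).congr fun l _ => by
    simp [d_sub])
  refine mem_cob_of_pair (hQ'.image hφ.continuous) (hφ.isOpenMap _ hB') (image_mono subset_closure)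
    hg.1 hv (v := y' - y) ?_
  rw [← image_sdiff hφ.injective]
  refine ((hy'.on_mono (image_mono Set.sdiff_subset)).add (hwy.on_mono (image_mono
    (sdiff_subset_sdiff_left (closure_mono hBB))))).congr fun l _ => ?_
  simp [d_sub]
  ring

/-- Injectivity of the extension maps between nested convex cells. -/
lemma mem_cob_of_mem_cob_convex {𝕜 : Type*} [Field 𝕜] [CompactSpace X] (hφ : IsOpenEmbedding φ)
    {B B' : Set E} (hB : IsOpen B) (hB' : IsOpen B') (hc : Convex ℝ B) (hc' : Convex ℝ B')
    (hQ : IsCompact (closure B)) (hBB : B' ⊆ B)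
    (hne : B'.Nonempty) {k : ℕ} {g : List X → 𝕜} (hg : g ∈ coc 𝕜 (φ '' B') k)
    (h : g ∈ cob 𝕜 (φ '' B) k) : g ∈ cob 𝕜 (φ '' B') k := by
  obtain ⟨z, hz⟩ := hne
  have hs : ∀ A : Set E, φ '' A = (fun e => φ (z + e)) '' ((fun e => z + e) ⁻¹' A) := by
    intro A
    rw [← image_image φ (fun e => z + e), image_preimage_eq _ (add_left_surjective z)]
  rw [hs] at hg h ⊢
  have hcl : closure ((fun e => z + e) ⁻¹' B) = (fun e => z + e) ⁻¹' closure B :=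
    ((Homeomorph.addLeft z).preimage_closure B).symm
  refine mem_cob_of_mem_cob_convex_aux (hφ.comp (Homeomorph.addLeft z).isOpenEmbedding)
    (hB.preimage (by fun_prop)) (hB'.preimage (by fun_prop)) (hc.translate_preimage_right z)
    (hc'.translate_preimage_right z) ?_ (preimage_mono hBB) (by simpa using hz) hg h
  rw [hcl]
  exact (Homeomorph.addLeft z).isCompact_preimage.2 hQ

end Convex

section Cell

variable {X 𝕜 : Type*} [Field 𝕜] [MetricSpace X] [CompactSpace X]
  {Q B : Set X} {k n : ℕ} {f g w v : List X → 𝕜}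

/-- Cohomology of a cell away from the top degree. -/
lemma coc_le_cob_of_sph (hQ : IsCompact Q) (hB : IsOpen B) (hBQ : B ⊆ Q) (hK : Kills 𝕜 Q Q)
    (hS : Sph 𝕜 n (Q \ B)) (hk : k ≠ n) : coc 𝕜 B k ≤ cob 𝕜 B k := by
  intro g hg
  obtain ⟨w, hw⟩ := hK (k + 1) g ((mem_CS_empty.1 hg.2).2.on_mono (subset_univ _))
  have hgS : Null (Germ.on (Q \ B)) (k + 1) g :=
    (null_near_of_mem_CS hB hg.1).on_of_near subset_rfl Set.sdiff_subset
  obtain ⟨v, hv⟩ := hS.1 k hk w ((hgS.sub (hw.on_mono Set.sdiff_subset)).congr fun l _ => by simp)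
  exact mem_cob_of_pair hQ hB hBQ hg.1 hw hv

/-- Cohomology of a cell in the top degree. -/
lemma exists_generator_of_sph (hQ : IsCompact Q) (hB : IsOpen B) (hBQ : B ⊆ Q) (hK : Kills 𝕜 Q Q)
    (hS : Sph 𝕜 n (Q \ B)) : ∃ u ∈ coc 𝕜 B n, u ∉ cob 𝕜 B n ∧
      coc 𝕜 B n ≤ Submodule.span 𝕜 {u} ⊔ cob 𝕜 B n := by
  obtain ⟨_, v, hv, hvne, hgen⟩ := hS
  have hSc : IsCompact (Q \ B) := hQ.diff hB
  obtain ⟨r, hr1, hr⟩ := exists_nearest hSc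
  set v' : List X → 𝕜 := fun l => v (l.map r) with hv'
  have hdv' : Null (Germ.near Q (Q \ B)) (n + 1) (d v') := by
    refine (hv.map (G := Germ.near Q (Q \ B)) (φ := r) fun ε hε => ⟨ε / 3, by positivity,
      fun l hl => ⟨?_, ?_⟩⟩).congr fun l _ => by rw [hv', d_map]
    · simp only [List.mem_map]
      rintro _ ⟨a, ha, rfl⟩
      exact (hr a _ (hl.2.1 a ha)).1
    · simp only [List.mem_map]
      rintro _ ⟨a, ha, rfl⟩ _ ⟨b, hb, rfl⟩
      have h1 := (hr a _ (hl.2.1 a ha)).2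
      have h2 := (hr b _ (hl.2.1 b hb)).2
      have h3 := hl.2.2 a ha b hb
      have h4 := dist_triangle4 (r a) a b (r b)
      rw [dist_comm] at h1
      linarith
  have hv'S : Null (Germ.on (Q \ B)) n (v' - v) := by
    refine Null.zero.of_eq_on fun l _ hl => ?_
    have : l.map r = l := by
      conv_rhs => rw [← List.map_id l]
      exact List.map_congr_left fun a ha => hr1 a (hl.1 a ha)
    simp [hv', this]
  obtain ⟨u, hu, huv⟩ := exists_extension hQ hdv'
  have huQ : Null (Germ.on Q) (n + 1) (u - d v') :=
    Null.zero.of_eq_on fun l hl hlQ => by simp [huv l hl hlQ.1]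
  have huc : u ∈ coc 𝕜 B n := mem_coc.2 ⟨hu, mem_CS_empty_of_null hB hBQ (d_mem_CS hu)
    (huQ.d.congr fun l _ => by simp [d_sub, d_d])⟩
  refine ⟨u, huc, fun h => ?_, fun g hg => ?_⟩
  · obtain ⟨w, hw, hww⟩ := mem_cob.1 h
    obtain ⟨z, hz⟩ := hK n (v' - w) ((((mem_CS_empty.1 hww).2.on_mono (subset_univ _)).sub huQ).congr
      fun l _ => by simp [d_sub])
    have hwS : Null (Germ.on (Q \ B)) n w :=
      (null_near_of_mem_CS hB hw).on_of_near subset_rfl Set.sdiff_subset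
    exact hvne ⟨z, (((hz.on_mono Set.sdiff_subset).add hwS).sub hv'S).congr fun l _ => by
      simp
      ring⟩
  · obtain ⟨w, hw⟩ := hK (n + 1) g ((mem_CS_empty.1 hg.2).2.on_mono (subset_univ _))
    have hgS : Null (Germ.on (Q \ B)) (n + 1) g :=
      (null_near_of_mem_CS hB hg.1).on_of_near subset_rfl Set.sdiff_subset
    obtain ⟨c, z, hz⟩ := hgen w ((hgS.sub (hw.on_mono Set.sdiff_subset)).congr fun l _ => by simp)
    have h1 : g - c • u ∈ cob 𝕜 B n := by
      refine mem_cob_of_pair hQ hB hBQ (Submodule.sub_mem _ hg.1 (Submodule.smul_mem _ _ hu))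
        (w := w - c • v') (v := z) ((hw.sub (huQ.smul c)).congr fun l _ => ?_)
        ((hz.sub (hv'S.smul c)).congr fun l _ => ?_)
      · simp [d_sub, d_smul]
        ring
      · simp
        ring
    exact Submodule.mem_sup.2 ⟨c • u, Submodule.smul_mem _ _ (Submodule.mem_span_singleton_self u),
      _, h1, by simp⟩

end Cell

section Box

variable {X : Type*} [MetricSpace X] {n : ℕ} {φ : (Fin n → ℝ) → X} {a b : Fin n → ℝ}

/-- The part of the boundary of a box cut out by the first `j` coordinates. -/
def faces (a b : Fin n → ℝ) (j : ℕ) : Set (Fin n → ℝ) :=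
  {x | x ∈ Icc a b ∧ ∃ i : Fin n, (i : ℕ) < j ∧ (x i = a i ∨ x i = b i)}

lemma isCompact_faces (j : ℕ) : IsCompact (faces a b j) := by
  have : faces a b j = Icc a b ∩ ⋃ i : Fin n, ⋃ _ : (i : ℕ) < j, {x | x i = a i ∨ x i = b i} := by
    ext x
    simp [faces]
  rw [this]
  refine isCompact_Icc.inter_right (isClosed_iUnion_of_finite fun i =>
    isClosed_iUnion_of_finite fun _ => ?_)
  exact (isClosed_eq (by fun_prop) (by fun_prop)).union (isClosed_eq (by fun_prop) (by fun_prop))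

lemma kills_faces_union {R : Type*} [AddCommGroup R] (hφ : IsOpenEmbedding φ)
    (hab : ∀ i, a i < b i) (j : Fin n) {c : ℝ} (hc : c ∈ Icc (a j) (b j)) :
    Kills R (φ '' (faces a b j ∪ {x | x ∈ Icc a b ∧ x j = c}))
      (φ '' (faces a b j ∪ {x | x ∈ Icc a b ∧ x j = c})) := by
  have hD : IsCompact {x : Fin n → ℝ | x ∈ Icc a b ∧ x j = c} :=
    isCompact_Icc.inter_right (t := {x : Fin n → ℝ | x j = c})
      (isClosed_eq (by fun_prop) (by fun_prop))
  have hDc : Convex ℝ {x : Fin n → ℝ | x ∈ Icc a b ∧ x j = c} := by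
    intro x hx y hy s t hs ht hst
    refine ⟨convex_Icc a b hx.1 hy.1 hs ht hst, ?_⟩
    simp only [Pi.add_apply, Pi.smul_apply, hx.2, hy.2, smul_eq_mul]
    rw [← add_mul, hst, one_mul]
  have hup : ∀ x ∈ Icc a b, ∀ s ∈ Icc (a j) (b j), Function.update x j s ∈ Icc a b := by
    intro x hx s hs
    refine ⟨fun i => ?_, fun i => ?_⟩
    · by_cases h : i = j
      · subst h
        simpa using hs.1
      · simpa [h] using hx.1 i
    · by_cases h : i = j
      · subst h
        simpa using hs.2
      · simpa [h] using hx.2 i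
  have hz : Function.update a j c ∈ {x : Fin n → ℝ | x ∈ Icc a b ∧ x j = c} :=
    ⟨hup a ⟨le_rfl, fun i => (hab i).le⟩ c hc, by simp⟩
  refine Kills.of_chart_homotopy hφ ((isCompact_faces _).union hD) subset_union_right
    (kills_convex hφ hD hDc hz) (h := fun t x => Function.update x j ((1 - t) * x j + t * c))
    ?_ ?_ ?_ ?_
  · refine Continuous.continuousOn ?_
    unfold Function.uncurry
    exact continuous_snd.update j (by fun_prop)
  · rintro t ht x (⟨hx, i, hi, hxi⟩ | ⟨hx, hxj⟩)
    · refine Or.inl ⟨hup x hx _ ?_, i, hi, ?_⟩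
      · exact convex_Icc (a j) (b j) ⟨hx.1 j, hx.2 j⟩ hc (by linarith [ht.2]) ht.1 (by ring)
      · have : i ≠ j := fun h => by subst h; exact lt_irrefl _ hi
        simpa [this] using hxi
    · refine Or.inr ⟨hup x hx _ ?_, ?_⟩
      · exact convex_Icc (a j) (b j) ⟨hx.1 j, hx.2 j⟩ hc (by linarith [ht.2]) ht.1 (by ring)
      · simp only [Function.update_self, hxj]
        ring
  · intro x _
    simp
  · rintro x hx
    have hx' : x ∈ Icc a b := hx.elim (fun h => h.1) fun h => h.1
    exact ⟨hup x hx' _ (by simpa using hc), by simp⟩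

lemma sph_faces (𝕜 : Type*) [Field 𝕜] (hφ : IsOpenEmbedding φ) (hab : ∀ i, a i < b i) :
    ∀ j ≤ n, Sph 𝕜 j (φ '' faces a b j) := by
  intro j
  induction j with
  | zero =>
    intro _
    have : faces a b 0 = ∅ := by
      ext x
      simp [faces]
    rw [this, image_empty]
    exact sph_empty 𝕜
  | succ j ih =>
    intro hj
    set i : Fin n := ⟨j, hj⟩ with hi
    have e1 : faces a b (j + 1) = (faces a b j ∪ {x | x ∈ Icc a b ∧ x i = a i}) ∪
        (faces a b j ∪ {x | x ∈ Icc a b ∧ x i = b i}) := by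
      ext x
      constructor
      · rintro ⟨hx, i', hi', h⟩
        rcases Nat.lt_succ_iff_lt_or_eq.1 hi' with h1 | h1
        · exact Or.inl (Or.inl ⟨hx, i', h1, h⟩)
        · have : i' = i := Fin.ext h1
          subst this
          exact h.elim (fun h => Or.inl (Or.inr ⟨hx, h⟩)) fun h => Or.inr (Or.inr ⟨hx, h⟩)
      · rintro ((⟨hx, i', h1, h⟩ | ⟨hx, h⟩) | (⟨hx, i', h1, h⟩ | ⟨hx, h⟩))
        · exact ⟨hx, i', by omega, h⟩
        · exact ⟨hx, i, by simp [hi], Or.inl h⟩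
        · exact ⟨hx, i', by omega, h⟩
        · exact ⟨hx, i, by simp [hi], Or.inr h⟩
    have e2 : (faces a b j ∪ {x | x ∈ Icc a b ∧ x i = a i}) ∩
        (faces a b j ∪ {x | x ∈ Icc a b ∧ x i = b i}) = faces a b j := by
      ext x
      constructor
      · rintro ⟨h | h, h' | h'⟩
        · exact h
        · exact h
        · exact h'
        · exact absurd (h.2.symm.trans h'.2) (hab i).ne
      · exact fun h => ⟨Or.inl h, Or.inl h⟩
    have hcl : ∀ c, IsCompact (faces a b j ∪ {x : Fin n → ℝ | x ∈ Icc a b ∧ x i = c}) := fun c =>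
      (isCompact_faces j).union (isCompact_Icc.inter_right (t := {x : Fin n → ℝ | x i = c})
        (isClosed_eq (by fun_prop) (by fun_prop)))
    rw [e1, image_union]
    refine Sph.union 𝕜 ((hcl _).image hφ.continuous) ((hcl _).image hφ.continuous)
      (kills_faces_union hφ hab i ⟨le_rfl, (hab i).le⟩)
      (kills_faces_union hφ hab i ⟨(hab i).le, le_rfl⟩) ?_
    rw [← image_inter hφ.injective, e2]
    exact ih (by omega)

/-- The open box with given corners. -/
def obox (a b : Fin n → ℝ) : Set (Fin n → ℝ) := univ.pi fun i => Ioo (a i) (b i)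

lemma mem_obox {x : Fin n → ℝ} : x ∈ obox a b ↔ ∀ i, a i < x i ∧ x i < b i := by simp [obox]

lemma isOpen_obox : IsOpen (obox a b) := isOpen_set_pi finite_univ fun _ _ => isOpen_Ioo

lemma convex_obox : Convex ℝ (obox a b) := convex_pi fun _ _ => convex_Ioo _ _

lemma obox_subset_Icc : obox a b ⊆ Icc a b := fun _ hx =>
  ⟨fun i => (mem_obox.1 hx i).1.le, fun i => (mem_obox.1 hx i).2.le⟩

lemma isCompact_closure_obox : IsCompact (closure (obox a b)) :=
  isCompact_Icc.of_isClosed_subset isClosed_closure (closure_minimal obox_subset_Icc isClosed_Icc)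

lemma obox_inter (a b a' b' : Fin n → ℝ) : obox a b ∩ obox a' b' = obox (a ⊔ a') (b ⊓ b') := by
  ext x
  simp only [mem_inter_iff, mem_obox, Pi.sup_apply, Pi.inf_apply, sup_lt_iff, lt_inf_iff]
  exact ⟨fun h i => ⟨⟨(h.1 i).1, (h.2 i).1⟩, (h.1 i).2, (h.2 i).2⟩,
    fun h => ⟨fun i => ⟨(h i).1.1, (h i).2.1⟩, fun i => ⟨(h i).1.2, (h i).2.2⟩⟩⟩

lemma lt_of_obox_nonempty (h : (obox a b).Nonempty) (i : Fin n) : a i < b i := by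
  obtain ⟨x, hx⟩ := h
  exact (mem_obox.1 hx i).1.trans (mem_obox.1 hx i).2

lemma Icc_sdiff_obox : Icc a b \ obox a b = faces a b n := by
  ext x
  constructor
  · rintro ⟨hx, h⟩
    rw [mem_obox] at h
    push Not at h
    obtain ⟨i, hi⟩ := h
    refine ⟨hx, i, i.2, ?_⟩
    by_cases h1 : a i < x i
    · exact Or.inr (le_antisymm (hx.2 i) (hi h1))
    · exact Or.inl (le_antisymm (not_lt.1 h1) (hx.1 i))
  · rintro ⟨hx, i, _, h⟩
    refine ⟨hx, fun h' => ?_⟩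
    have := mem_obox.1 h' i
    rcases h with h | h
    · exact this.1.ne' h
    · exact this.2.ne h

variable (𝕜 : Type*) [Field 𝕜]

lemma kills_Icc (hφ : IsOpenEmbedding φ) (h : (obox a b).Nonempty) :
    Kills 𝕜 (φ '' Icc a b) (φ '' Icc a b) :=
  kills_convex hφ isCompact_Icc (convex_Icc a b) (obox_subset_Icc h.some_mem)

lemma sph_box (hφ : IsOpenEmbedding φ) (h : (obox a b).Nonempty) :
    Sph 𝕜 n (φ '' Icc a b \ φ '' obox a b) := by
  rw [← image_sdiff hφ.injective, Icc_sdiff_obox]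
  exact sph_faces 𝕜 hφ (lt_of_obox_nonempty h) n le_rfl

variable [CompactSpace X]

lemma coc_box_le_cob (hφ : IsOpenEmbedding φ) (h : (obox a b).Nonempty) {k : ℕ} (hk : k ≠ n) :
    coc 𝕜 (φ '' obox a b) k ≤ cob 𝕜 (φ '' obox a b) k :=
  coc_le_cob_of_sph (isCompact_Icc.image hφ.continuous) (hφ.isOpenMap _ isOpen_obox)
    (image_mono obox_subset_Icc) (kills_Icc 𝕜 hφ h) (sph_box 𝕜 hφ h) hk

lemma exists_generator_box (hφ : IsOpenEmbedding φ) (h : (obox a b).Nonempty) :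
    ∃ u ∈ coc 𝕜 (φ '' obox a b) n, u ∉ cob 𝕜 (φ '' obox a b) n ∧
      coc 𝕜 (φ '' obox a b) n ≤ Submodule.span 𝕜 {u} ⊔ cob 𝕜 (φ '' obox a b) n :=
  exists_generator_of_sph (isCompact_Icc.image hφ.continuous) (hφ.isOpenMap _ isOpen_obox)
    (image_mono obox_subset_Icc) (kills_Icc 𝕜 hφ h) (sph_box 𝕜 hφ h)

lemma mem_cob_box {a' b' : Fin n → ℝ} (hφ : IsOpenEmbedding φ) (h : (obox a b).Nonempty)
    (hs : obox a b ⊆ obox a' b') {k : ℕ} {g : List X → 𝕜}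
    (hg : g ∈ coc 𝕜 (φ '' obox a b) k) (hg' : g ∈ cob 𝕜 (φ '' obox a' b') k) :
    g ∈ cob 𝕜 (φ '' obox a b) k :=
  mem_cob_of_mem_cob_convex hφ isOpen_obox isOpen_obox convex_obox convex_obox
    isCompact_closure_obox hs h hg hg'

lemma dimLE_box (hφ : IsOpenEmbedding φ) : DimLE 𝕜 n (φ '' obox a b) := by
  rcases (obox a b).eq_empty_or_nonempty with h | h
  · rw [h, image_empty]
    exact DimLE.empty
  · exact fun k hk => coc_box_le_cob 𝕜 hφ h hk.ne'

end Box

section Manifold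

variable {X : Type*} [MetricSpace X] {n : ℕ} {M : Set X}

/-- An open set covered by `n`-dimensional charts. -/
def Mfd (n : ℕ) (M : Set X) : Prop :=
  ∀ x ∈ M, ∃ φ : (Fin n → ℝ) → X, IsOpenEmbedding φ ∧ x ∈ range φ ∧ range φ ⊆ M

lemma Mfd.isOpen (hM : Mfd n M) : IsOpen M := isOpen_iff_forall_mem_open.2 fun x hx => by
  obtain ⟨φ, hφ, hx, h⟩ := hM x hx
  exact ⟨_, h, hφ.isOpen_range, hx⟩

/-- Charts can be taken arbitrarily small. -/
lemma exists_small_chart {Y : Type*} [TopologicalSpace Y] {φ : (Fin n → ℝ) → Y} {V : Set (Fin n → ℝ)}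
    (hφ : ∀ W ⊆ V, IsOpen W → IsOpen (φ '' W)) (hc : ContinuousOn φ V) (hi : InjOn φ V)
    (hV : IsOpen V) {e : Fin n → ℝ} (he : e ∈ V) :
    ∃ ψ : (Fin n → ℝ) → Y, IsOpenEmbedding ψ ∧ φ e ∈ range ψ ∧ range ψ ⊆ φ '' V := by
  obtain ⟨r, hr, hrV⟩ := Metric.isOpen_iff.1 hV e he
  have h1 : IsOpenEmbedding (OpenPartialHomeomorph.univBall e r) :=
    OpenPartialHomeomorph.isOpenEmbedding _ (OpenPartialHomeomorph.univBall_source e r)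
  have h2 : range (OpenPartialHomeomorph.univBall e r) = Metric.ball e r := by
    rw [← image_univ, ← OpenPartialHomeomorph.univBall_source e r,
      OpenPartialHomeomorph.image_source_eq_target, OpenPartialHomeomorph.univBall_target e hr]
  have h3 : ∀ x, OpenPartialHomeomorph.univBall e r x ∈ V := fun x =>
    hrV (h2 ▸ mem_range_self x)
  refine ⟨φ ∘ OpenPartialHomeomorph.univBall e r, IsOpenEmbedding.of_continuous_injective_isOpenMap
    (hc.comp_continuous h1.continuous h3) (fun x y h => h1.injective (hi (h3 x) (h3 y) h))
    fun W hW => ?_, ⟨0, by simp⟩, ?_⟩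
  · rw [image_comp]
    exact hφ _ (by rintro _ ⟨x, _, rfl⟩; exact h3 x) (h1.isOpenMap _ hW)
  · rintro _ ⟨x, rfl⟩
    exact mem_image_of_mem _ (h3 x)

lemma Mfd.mono (hM : Mfd n M) {U : Set X} (hU : IsOpen U) (hUM : U ⊆ M) : Mfd n U := by
  intro x hx
  obtain ⟨φ, hφ, ⟨e, rfl⟩, h⟩ := hM x (hUM hx)
  obtain ⟨ψ, hψ, h1, h2⟩ := exists_small_chart (φ := φ) (V := φ ⁻¹' U)
    (fun W _ hW => hφ.isOpenMap _ hW) hφ.continuous.continuousOn hφ.injective.injOn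
    (hU.preimage hφ.continuous) (e := e) hx
  exact ⟨ψ, hψ, h1, h2.trans (image_preimage_subset _ _)⟩

lemma exists_box {φ : (Fin n → ℝ) → X} (hφ : IsOpenEmbedding φ) {U : Set X} (hU : IsOpen U)
    {e : Fin n → ℝ} (he : φ e ∈ U) : ∃ a b, e ∈ obox a b ∧ φ '' Icc a b ⊆ U := by
  obtain ⟨r, hr, h⟩ := Metric.nhds_basis_closedBall.mem_iff.1
    ((hU.preimage hφ.continuous).mem_nhds he)
  refine ⟨fun i => e i - r, fun i => e i + r, mem_obox.2 fun i => ⟨by linarith, by linarith⟩, ?_⟩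
  rintro _ ⟨x, hx, rfl⟩
  refine h (Metric.mem_closedBall.2 ((dist_pi_le_iff hr.le).2 fun i => ?_))
  rw [Real.dist_eq, abs_le]
  exact ⟨by linarith [hx.1 i], by linarith [hx.2 i]⟩

lemma exists_box_between {φ : (Fin n → ℝ) → X} (hφ : IsOpenEmbedding φ) {a b : Fin n → ℝ}
    {K : Set X} (hK : IsCompact K) (hKB : K ⊆ φ '' obox a b) :
    ∃ a' b', K ⊆ φ '' obox a' b' ∧ closure (φ '' obox a' b') ⊆ φ '' obox a b := by
  set U : ℕ → Set (Fin n → ℝ) := fun j =>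
    obox (fun i => a i + 1 / ((j : ℝ) + 1)) (fun i => b i - 1 / ((j : ℝ) + 1)) with hU
  have hmono : Monotone U := by
    intro j j' hj x hx
    refine mem_obox.2 fun i => ?_
    have h1 := mem_obox.1 hx i
    have h2 : 1 / ((j' : ℝ) + 1) ≤ 1 / ((j : ℝ) + 1) := by gcongr
    exact ⟨by linarith [h1.1], by linarith [h1.2]⟩
  obtain ⟨j, hj⟩ := hK.elim_directed_cover (fun j => φ '' U j)
    (fun j => hφ.isOpenMap _ isOpen_obox) (by
      intro x hx
      obtain ⟨e, he, rfl⟩ := hKB hx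
      rw [mem_obox] at he
      have h1 : ∀ᶠ j : ℕ in atTop, ∀ i, 1 / ((j : ℝ) + 1) < min (e i - a i) (b i - e i) :=
        eventually_all.2 fun i => tendsto_one_div_add_atTop_nhds_zero_nat.eventually_lt_const
          (lt_min (by linarith [(he i).1]) (by linarith [(he i).2]))
      obtain ⟨j, hj⟩ := h1.exists
      exact mem_iUnion.2 ⟨j, e, mem_obox.2 fun i => ⟨by linarith [(lt_min_iff.1 (hj i)).1],
        by linarith [(lt_min_iff.1 (hj i)).2]⟩, rfl⟩)
    (directed_of_isDirected_le fun j j' h => image_mono (hmono h))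
  refine ⟨_, _, hj, (closure_minimal (image_mono obox_subset_Icc)
    (isCompact_Icc.image hφ.continuous).isClosed).trans (image_mono fun x hx => ?_)⟩
  have h0 : 0 < 1 / ((j : ℝ) + 1) := by positivity
  exact mem_obox.2 fun i => ⟨by linarith [hx.1 i], by linarith [hx.2 i]⟩

variable [CompactSpace X]

/-- Mayer–Vietoris induction over the open subsets of a manifold. -/
lemma Mfd.induction (hM : Mfd n M) {P : Set X → Prop} (h0 : P ∅)
    (hP : ∀ φ : (Fin n → ℝ) → X, IsOpenEmbedding φ → range φ ⊆ M → ∀ a b, P (φ '' obox a b))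
    (hmv : ∀ U V, IsOpen U → IsOpen V → P U → P V → (∀ K, IsCompact K → K ⊆ U ∪ V →
      ∃ U₁ V₁, IsOpen U₁ ∧ IsOpen V₁ ∧ closure U₁ ⊆ U ∧ closure V₁ ⊆ V ∧ K ⊆ U₁ ∪ V₁ ∧
        P (U₁ ∩ V₁)) → P (U ∪ V))
    (hdir : ∀ U, IsOpen U → (∀ K, IsCompact K → K ⊆ U → ∃ V, IsOpen V ∧ V ⊆ U ∧ K ⊆ V ∧ P V) →
      P U) : P M := by
  have h1 : ∀ φ : (Fin n → ℝ) → X, IsOpenEmbedding φ → range φ ⊆ M → ∀ U, IsOpen U →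
      U ⊆ range φ → P U := by
    intro φ hφ hφM U hU hUφ
    refine open_induction (𝓞 := {B | ∃ a b, B = φ '' obox a b}) ?_ ?_ ?_ h0 ?_ hmv hdir ?_
    · rintro _ ⟨a, b, rfl⟩
      exact hφ.isOpenMap _ isOpen_obox
    · rintro _ ⟨a, b, rfl⟩ _ ⟨a', b', rfl⟩
      exact ⟨_, _, by rw [← image_inter hφ.injective, obox_inter]⟩
    · rintro _ ⟨a, b, rfl⟩ K hK hKB
      obtain ⟨a', b', h1, h2⟩ := exists_box_between hφ hK hKB
      exact ⟨_, ⟨a', b', rfl⟩, h1, h2⟩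
    · rintro _ ⟨a, b, rfl⟩
      exact hP φ hφ hφM a b
    · intro x hx
      obtain ⟨e, rfl⟩ := hUφ hx
      obtain ⟨a, b, h1, h2⟩ := exists_box hφ hU hx
      exact ⟨_, ⟨a, b, rfl⟩, mem_image_of_mem _ h1, (image_mono obox_subset_Icc).trans h2⟩
  refine open_induction (𝓞 := {U | IsOpen U ∧ ∃ φ : (Fin n → ℝ) → X, IsOpenEmbedding φ ∧
    range φ ⊆ M ∧ U ⊆ range φ}) (fun U hU => hU.1) ?_ ?_ h0 ?_ hmv hdir ?_
  · rintro U ⟨hU, φ, hφ, h, h'⟩ V ⟨hV, _⟩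
    exact ⟨hU.inter hV, φ, hφ, h, inter_subset_left.trans h'⟩
  · rintro U ⟨hU, φ, hφ, h, h'⟩ K hK hKU
    obtain ⟨V, hV, hKV, hVU, _⟩ := exists_open_between_and_isCompact_closure hK hU hKU
    exact ⟨V, ⟨hV, φ, hφ, h, (subset_closure.trans hVU).trans h'⟩, hKV, hVU⟩
  · rintro U ⟨hU, φ, hφ, h, h'⟩
    exact h1 φ hφ h U hU h'
  · intro x hx
    obtain ⟨φ, hφ, hxφ, h⟩ := hM x hx
    exact ⟨range φ, ⟨hφ.isOpen_range, φ, hφ, h, subset_rfl⟩, hxφ, h⟩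

variable (𝕜 : Type*) [Field 𝕜]

lemma Mfd.dimLE (hM : Mfd n M) : DimLE 𝕜 n M :=
  hM.induction DimLE.empty (fun _ hφ _ _ _ => dimLE_box 𝕜 hφ)
    (fun _ _ _ _ hU hV h => hU.union hV h) fun _ _ h => DimLE.directed h

/-- The top cohomology of a box is supported near any of its points. -/
lemma coc_box_le_sup {φ : (Fin n → ℝ) → X} (hφ : IsOpenEmbedding φ) {a b : Fin n → ℝ} {W : Set X}
    (hW : IsOpen W) (hWB : (W ∩ φ '' obox a b).Nonempty) :
    coc 𝕜 (φ '' obox a b) n ≤ coc 𝕜 (W ∩ φ '' obox a b) n ⊔ cob 𝕜 (φ '' obox a b) n := by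
  have hB : IsOpen (φ '' obox a b) := hφ.isOpenMap _ isOpen_obox
  obtain ⟨_, hxW, e, he, rfl⟩ := hWB
  obtain ⟨a', b', h1, h2⟩ := exists_box hφ (hW.inter hB) ⟨hxW, mem_image_of_mem _ he⟩
  have h2' := (image_mono (f := φ) obox_subset_Icc).trans h2
  obtain ⟨u, hu, hu', hgen⟩ := exists_generator_box 𝕜 hφ ⟨e, he⟩
  obtain ⟨v, hv, hv', _⟩ := exists_generator_box 𝕜 hφ ⟨e, h1⟩
  have hvB : v ∉ cob 𝕜 (φ '' obox a b) n := fun h => hv' (mem_cob_box 𝕜 hφ ⟨e, h1⟩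
    ((image_subset_image_iff hφ.injective).1 (h2'.trans inter_subset_right)) hv h)
  obtain ⟨x, hx, z, hz, hxz⟩ := Submodule.mem_sup.1 (hgen (coc_mono (h2'.trans inter_subset_right) hv))
  obtain ⟨c, rfl⟩ := Submodule.mem_span_singleton.1 hx
  have hc : c ≠ 0 := by
    rintro rfl
    exact hvB (by rw [← hxz]; simpa using hz)
  have hu2 : u ∈ coc 𝕜 (W ∩ φ '' obox a b) n ⊔ cob 𝕜 (φ '' obox a b) n := by
    have : u = c⁻¹ • v - c⁻¹ • z := by
      rw [← smul_sub, ← hxz, add_sub_cancel_right, smul_smul, inv_mul_cancel₀ hc, one_smul]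
    rw [this]
    exact Submodule.sub_mem _ (Submodule.mem_sup_left (Submodule.smul_mem _ _ (coc_mono h2' hv)))
      (Submodule.mem_sup_right (Submodule.smul_mem _ _ hz))
  exact hgen.trans (sup_le (Submodule.span_le.2 (singleton_subset_iff.2 hu2)) le_sup_right)

omit 𝕜 in
/-- Invariance of dimension. -/
lemma dim_eq {m : ℕ} {φ : (Fin n → ℝ) → X} (hφ : IsOpenEmbedding φ) {ψ : (Fin m → ℝ) → X}
    (hψ : IsOpenEmbedding ψ) {x : X} (hx : x ∈ range φ) (hx' : x ∈ range ψ) : n = m := by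
  by_contra hnm
  obtain ⟨e, rfl⟩ := hx
  obtain ⟨e', he'⟩ := hx'
  obtain ⟨a₁, b₁, h1, h1'⟩ := exists_box hφ isOpen_univ (mem_univ (φ e))
  obtain ⟨a₂, b₂, h2, h2'⟩ := exists_box hψ (hφ.isOpenMap _ (isOpen_obox (a := a₁) (b := b₁)))
    (e := e') (by rw [he']; exact mem_image_of_mem _ h1)
  obtain ⟨a₃, b₃, h3, h3'⟩ := exists_box hφ (hψ.isOpenMap _ (isOpen_obox (a := a₂) (b := b₂)))
    (e := e) (by rw [← he']; exact mem_image_of_mem _ h2)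
  have h32 := (image_mono (f := φ) obox_subset_Icc).trans h3'
  have h21 := (image_mono (f := ψ) obox_subset_Icc).trans h2'
  obtain ⟨u, hu, hu', _⟩ := exists_generator_box ℚ hφ ⟨e, h3⟩
  exact hu' (mem_cob_box ℚ hφ ⟨e, h3⟩
    ((image_subset_image_iff hφ.injective).1 (h32.trans h21)) hu
    (cob_mono h21 (coc_box_le_cob ℚ hψ ⟨e', h2⟩ hnm (coc_mono h32 hu))))

end Manifold

section Orientation

variable {X : Type*} [MetricSpace X] [CompactSpace X] {n : ℕ} {M : Set X}

lemma exists_shrink {K U V : Set X} (hK : IsCompact K) (hU : IsOpen U) (hV : IsOpen V)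
    (h : K ⊆ U ∪ V) : ∃ U₁ V₁, IsOpen U₁ ∧ IsOpen V₁ ∧ closure U₁ ⊆ U ∧ closure V₁ ⊆ V ∧
      K ⊆ U₁ ∪ V₁ := by
  obtain ⟨K₁, K₂, h1, h2, h1', h2', rfl⟩ := hK.binary_compact_cover hU hV h
  obtain ⟨U₁, hU₁, ha, hb, _⟩ := exists_open_between_and_isCompact_closure h1 hU h1'
  obtain ⟨V₁, hV₁, hc, hd, _⟩ := exists_open_between_and_isCompact_closure h2 hV h2'
  exact ⟨U₁, V₁, hU₁, hV₁, hb, hd, union_subset_union ha hc⟩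

variable {𝕜 : Type*} [Field 𝕜]

lemma Mfd.coc_union_le (hM : Mfd n M) {U V : Set X} (hU : IsOpen U) (hV : IsOpen V)
    (hUM : U ⊆ M) : coc 𝕜 (U ∪ V) n ≤ coc 𝕜 U n ⊔ coc 𝕜 V n :=
  AlexanderSpanier.coc_union_le fun K hK hKU => by
    obtain ⟨U₁, V₁, hU₁, hV₁, h1, h2, h3⟩ := exists_shrink hK hU hV hKU
    exact ⟨U₁, V₁, hU₁, hV₁, h1, h2, h3, (hM.mono (hU₁.inter hV₁)
      ((inter_subset_left.trans subset_closure).trans (h1.trans hUM))).dimLE 𝕜 _ (Nat.lt_succ_self n)⟩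

lemma interpolate_small {ε : ℝ} {M U K : Set X} (hU : IsOpen U ∧ U ⊆ M ∧ ∀ x ∈ U, ∀ y ∈ U, dist x y < ε)
    (hK : IsCompact K) (hKU : K ⊆ U) : ∃ V, (IsOpen V ∧ V ⊆ M ∧ ∀ x ∈ V, ∀ y ∈ V, dist x y < ε) ∧
      K ⊆ V ∧ closure V ⊆ U := by
  obtain ⟨V, hV, ha, hb, _⟩ := exists_open_between_and_isCompact_closure hK hU.1 hKU
  have hVU := subset_closure.trans hb
  exact ⟨V, ⟨hV, hVU.trans hU.2.1, fun x hx y hy => hU.2.2 x (hVU hx) y (hVU hy)⟩, ha, hb⟩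

/-- Induction over the open subsets of a manifold starting from small sets. -/
lemma small_induction {ε : ℝ} (hε : 0 < ε) {P : Set X → Prop}
    (hP : ∀ W, IsOpen W → W ⊆ M → (∀ x ∈ W, ∀ y ∈ W, dist x y < ε) → P W)
    (hmv : ∀ U V, IsOpen U → IsOpen V → U ⊆ M → V ⊆ M → P U → P V → P (U ∪ V))
    (hdir : ∀ U, IsOpen U → U ⊆ M →
      (∀ K, IsCompact K → K ⊆ U → ∃ V, IsOpen V ∧ V ⊆ U ∧ K ⊆ V ∧ P V) → P U)
    {U : Set X} (hU : IsOpen U) (hUM : U ⊆ M) : P U := by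
  let 𝓞 : Set (Set X) := {W | IsOpen W ∧ W ⊆ M ∧ ∀ x ∈ W, ∀ y ∈ W, dist x y < ε}
  refine (open_induction (𝓞 := 𝓞) (P := fun U => U ⊆ M → P U) (fun _ h => h.1)
    (fun A hA B hB => ⟨hA.1.inter hB.1, inter_subset_left.trans hA.2.1,
      fun x hx y hy => hA.2.2 x hx.1 y hy.1⟩)
    (fun A hA K hK hKA => interpolate_small hA hK hKA)
    (fun _ => hP ∅ isOpen_empty (empty_subset _) (by simp)) (fun W hW _ => hP W hW.1 hW.2.1 hW.2.2)
    (fun A B hA hB pA pB _ hAB => hmv A B hA hB (subset_union_left.trans hAB)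
      (subset_union_right.trans hAB) (pA (subset_union_left.trans hAB))
      (pB (subset_union_right.trans hAB)))
    (fun A hA h hAM => hdir A hA hAM fun K hK hKA => ?_) fun x hx => ?_) hUM
  · obtain ⟨V, h1, h2, h3, h4⟩ := h K hK hKA
    exact ⟨V, h1, h2, h3, h4 (h2.trans hAM)⟩
  · refine ⟨U ∩ Metric.ball x (ε / 2), ⟨hU.inter Metric.isOpen_ball, inter_subset_left.trans hUM,
      fun y hy z hz => ?_⟩, ⟨hx, Metric.mem_ball_self (by positivity)⟩, inter_subset_left⟩
    have h1 := Metric.mem_ball.1 hy.2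
    have h2 := Metric.mem_ball.1 hz.2
    have h3 := dist_triangle_right y z x
    linarith

/-- Top degree cocycles decompose into small ones. -/
lemma Mfd.coc_le_of_small (hM : Mfd n M) {ε : ℝ} (hε : 0 < ε) {S : Submodule 𝕜 (List X → 𝕜)}
    {U : Set X} (hU : IsOpen U) (hUM : U ⊆ M)
    (h : ∀ W ⊆ U, IsOpen W → (∀ x ∈ W, ∀ y ∈ W, dist x y < ε) → coc 𝕜 W n ≤ S) :
    coc 𝕜 U n ≤ S := by
  refine small_induction (M := U) (P := fun V => coc 𝕜 V n ≤ S) hε (fun W hW hWU h' => h W hWU hW h')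
    (fun A B hA hB hAU _ pA pB => (hM.coc_union_le hA hB (hAU.trans hUM)).trans (sup_le pA pB))
    (fun A hA _ h g hg => ?_) hU subset_rfl
  obtain ⟨K, hK, hKA, hg'⟩ := exists_open_mem_coc hg
  obtain ⟨V, _, _, hKV, hV⟩ := h K hK hKA
  exact hV (hg' V hKV)

/-- A functional which is an orientation of the open set `W`. -/
def Orients (n : ℕ) (W : Set X) (o : (List X → 𝕜) →ₗ[𝕜] 𝕜) : Prop :=
  (∀ g ∈ cob 𝕜 W n, o g = 0) ∧ ∀ V ⊆ W, IsOpen V → V.Nonempty → ∃ g ∈ coc 𝕜 V n, o g ≠ 0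

variable {W W' : Set X} {o o' : (List X → 𝕜) →ₗ[𝕜] 𝕜}

omit [CompactSpace X] in
lemma Orients.mono (h : Orients n W o) (hW : W' ⊆ W) : Orients n W' o :=
  ⟨fun g hg => h.1 g (cob_mono hW hg), fun V hV => h.2 V (hV.trans hW)⟩

omit [CompactSpace X] in
lemma Orients.smul (h : Orients n W o) {c : 𝕜} (hc : c ≠ 0) : Orients n W (c • o) :=
  ⟨fun g hg => by simp [h.1 g hg], fun V hV ho hne => (h.2 V hV ho hne).imp fun g hg =>
    ⟨hg.1, by simpa [hc] using hg.2⟩⟩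

lemma exists_orients_box {φ : (Fin n → ℝ) → X} (hφ : IsOpenEmbedding φ) (a b : Fin n → ℝ) :
    ∃ o : (List X → 𝕜) →ₗ[𝕜] 𝕜, Orients n (φ '' obox a b) o := by
  rcases (obox a b).eq_empty_or_nonempty with he | he
  · refine ⟨0, fun _ _ => rfl, fun V hV _ hne => ?_⟩
    rw [he, image_empty] at hV
    exact absurd (subset_empty_iff.1 hV) hne.ne_empty
  obtain ⟨u, hu, hu', _⟩ := exists_generator_box 𝕜 hφ he
  obtain ⟨o, ho, hou⟩ := exists_separating (cob 𝕜 (φ '' obox a b) n) hu'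
  refine ⟨o, ho, fun V hV hVo hne => ?_⟩
  have h := coc_box_le_sup 𝕜 hφ hVo (by rwa [inter_eq_left.2 hV]) hu
  rw [inter_eq_left.2 hV] at h
  obtain ⟨g, hg, z, hz, rfl⟩ := Submodule.mem_sup.1 h
  refine ⟨g, hg, fun h0 => ?_⟩
  rw [map_add, h0, ho z hz, zero_add] at hou
  exact zero_ne_one hou

lemma Mfd.exists_orients (hM : Mfd n M) {x : X} (hx : x ∈ M) :
    ∃ W, IsOpen W ∧ x ∈ W ∧ W ⊆ M ∧ ∃ o : (List X → 𝕜) →ₗ[𝕜] 𝕜, Orients n W o := by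
  obtain ⟨φ, hφ, ⟨e, rfl⟩, hr⟩ := hM x hx
  obtain ⟨a, b, h1, _⟩ := exists_box hφ isOpen_univ (mem_univ (φ e))
  exact ⟨_, hφ.isOpenMap _ isOpen_obox, mem_image_of_mem _ h1, (image_subset_range _ _).trans hr,
    exists_orients_box hφ a b⟩

/-- Orientations are locally proportional. -/
lemma Orients.exists_unit (hM : Mfd n M) (h : Orients n W o) (h' : Orients n W' o')
    (hW : IsOpen W) (hW' : IsOpen W') {x : X} (hx : x ∈ W) (hx' : x ∈ W') (hxM : x ∈ M) :
    ∃ c : 𝕜ˣ, ∃ V, IsOpen V ∧ x ∈ V ∧ V ⊆ W ∩ W' ∧ ∀ g ∈ coc 𝕜 V n, o' g = c * o g := by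
  obtain ⟨φ, hφ, ⟨e, rfl⟩, _⟩ := hM x hxM
  obtain ⟨a, b, h1, h2⟩ := exists_box hφ (hW.inter hW') ⟨hx, hx'⟩
  have h2 := (image_mono (f := φ) obox_subset_Icc).trans h2
  have hB : IsOpen (φ '' obox a b) := hφ.isOpenMap _ isOpen_obox
  obtain ⟨u, hu, hu', hgen⟩ := exists_generator_box 𝕜 hφ ⟨e, h1⟩
  have key : ∀ {o : (List X → 𝕜) →ₗ[𝕜] 𝕜}, Orients n (φ '' obox a b) o → o u ≠ 0 := by
    intro o ho h0
    obtain ⟨g, hg, hg'⟩ := ho.2 _ subset_rfl hB ⟨φ e, mem_image_of_mem _ h1⟩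
    obtain ⟨y, hy, z, hz, rfl⟩ := Submodule.mem_sup.1 (hgen hg)
    obtain ⟨c, rfl⟩ := Submodule.mem_span_singleton.1 hy
    exact hg' (by rw [map_add, map_smul, h0, ho.1 z hz, smul_zero, add_zero])
  have hu1 := key (h.mono (h2.trans inter_subset_left))
  have hu2 := key (h'.mono (h2.trans inter_subset_right))
  refine ⟨Units.mk0 (o' u / o u) (div_ne_zero hu2 hu1), _, hB, mem_image_of_mem _ h1, h2,
    fun g hg => ?_⟩
  obtain ⟨y, hy, z, hz, rfl⟩ := Submodule.mem_sup.1 (hgen hg)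
  obtain ⟨c, rfl⟩ := Submodule.mem_span_singleton.1 hy
  rw [map_add, map_add, (h.mono (h2.trans inter_subset_left)).1 z hz,
    (h'.mono (h2.trans inter_subset_right)).1 z hz, map_smul, map_smul]
  simp only [smul_eq_mul, Units.val_mk0, add_zero]
  field_simp

omit [CompactSpace X] in
lemma Orients.unit_unique (h : Orients n W o) {c c' : 𝕜} {V V' : Set X} (hV : IsOpen V)
    (hV' : IsOpen V') (hW : IsOpen W) {x : X} (hx : x ∈ V) (hx' : x ∈ V') (hxW : x ∈ W)
    (h1 : ∀ g ∈ coc 𝕜 V n, o' g = c * o g) (h2 : ∀ g ∈ coc 𝕜 V' n, o' g = c' * o g) : c = c' := by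
  obtain ⟨g, hg, hg'⟩ := h.2 (V ∩ V' ∩ W) inter_subset_right ((hV.inter hV').inter hW)
    ⟨x, ⟨hx, hx'⟩, hxW⟩
  refine mul_right_cancel₀ hg' ?_
  rw [← h1 g (coc_mono (inter_subset_left.trans inter_subset_left) hg),
    ← h2 g (coc_mono (inter_subset_left.trans inter_subset_right) hg)]

end Orientation

section Orientation

variable {X : Type*} [MetricSpace X] [CompactSpace X] {n : ℕ} {M : Set X} {𝕜 : Type*} [Field 𝕜]

/-- A uniform family of local orientations, pairwise proportional. -/
lemma Mfd.exists_proportional (hM : Mfd n M) {K : Set X} (hK : IsCompact K) (hKM : K ⊆ M) :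
    ∃ δ > 0, ∃ p : X → (List X → 𝕜) →ₗ[𝕜] 𝕜, ∀ x ∈ K, ∀ y ∈ K, dist y x < δ →
      Orients n (Metric.ball x δ) (p y) ∧ ∀ w ∈ K, dist w x < δ → ∃ c : 𝕜ˣ,
        ∀ g ∈ coc 𝕜 (Metric.ball x δ) n, p w g = c * p y g := by
  choose! W hW hxW hWM o ho using fun x hx => hM.exists_orients (𝕜 := 𝕜) (x := x) hx
  obtain ⟨t, ht, htK⟩ := hK.elim_nhds_subcover W fun x hx => (hW x (hKM hx)).mem_nhds (hxW x (hKM hx))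
  obtain ⟨ε, hε, hj⟩ := lebesgue_number_lemma_of_metric (c := fun i : t => W i) hK
    (fun i => hW i (hKM (ht i i.2))) (by simpa [iUnion_subtype] using htK)
  rcases K.eq_empty_or_nonempty with rfl | ⟨x₀, hx₀⟩
  · exact ⟨1, one_pos, 0, by simp⟩
  have : Nonempty t := ⟨(hj x₀ hx₀).choose⟩
  choose! j hj using hj
  have hN : ∀ z ∈ K, ∃ N, IsOpen N ∧ z ∈ N ∧ N ⊆ Metric.ball z ε ∧ ∀ i k : t, z ∈ W i → z ∈ W k →
      N ⊆ W i ∧ ∃ c : 𝕜ˣ, ∀ g ∈ coc 𝕜 N n, o k g = c * o i g := by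
    intro z hz
    have h1 : ∀ᶠ N in (𝓝 z).smallSets, ∀ i k : t, z ∈ W i → z ∈ W k →
        N ⊆ W i ∧ ∃ c : 𝕜ˣ, ∀ g ∈ coc 𝕜 N n, o k g = c * o i g := by
      refine eventually_all.2 fun i => eventually_all.2 fun k => ?_
      by_cases h : z ∈ W i ∧ z ∈ W k
      · have hi := hKM (ht i i.2)
        have hk := hKM (ht k k.2)
        obtain ⟨c, V, hV, hzV, hVW, hc⟩ := (ho i hi).exists_unit hM (ho k hk) (hW i hi) (hW k hk)
          h.1 h.2 (hKM hz)
        exact eventually_smallSets.2 ⟨V, hV.mem_nhds hzV, fun N hN _ _ =>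
          ⟨hN.trans (hVW.trans inter_subset_left), c, fun g hg => hc g (coc_mono hN hg)⟩⟩
      · exact Eventually.of_forall fun N hi hk => (h ⟨hi, hk⟩).elim
    obtain ⟨s, hs, hs'⟩ := eventually_smallSets.1 h1
    obtain ⟨N, hNs, hNo, hzN⟩ := mem_nhds_iff.1 (inter_mem hs (Metric.ball_mem_nhds z hε))
    exact ⟨N, hNo, hzN, hNs.trans inter_subset_right, hs' N (hNs.trans inter_subset_left)⟩
  choose! N hNo hzN hNε hN using hN
  obtain ⟨δ, hδ, hδN⟩ := lebesgue_number_lemma_of_metric (c := fun i : K => N i) hK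
    (fun i => hNo i i.2) fun x hx => mem_iUnion.2 ⟨⟨x, hx⟩, hzN x hx⟩
  refine ⟨δ, hδ, fun x => o (j x), fun x hx => ?_⟩
  obtain ⟨⟨z, hz⟩, hxz⟩ := hδN x hx
  have key : ∀ y ∈ K, dist y x < δ → z ∈ W (j y) := by
    intro y hy hyx
    have h1 := hNε z hz (hxz (Metric.mem_ball.2 hyx))
    exact hj y hy (Metric.mem_ball'.2 (Metric.mem_ball.1 h1))
  intro y hy hyx
  refine ⟨(ho _ (hKM (ht _ (j y).2))).mono (hxz.trans ?_), fun w hw hwx => ?_⟩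
  · exact (hN z hz (j y) (j y) (key y hy hyx) (key y hy hyx)).1
  · obtain ⟨c, hc⟩ := (hN z hz (j y) (j w) (key y hy hyx) (key w hw hwx)).2
    exact ⟨c, fun g hg => hc g (coc_mono hxz hg)⟩

/-- A locally constant family of local orientations. -/
lemma Mfd.exists_coherent (hM : Mfd n M) (hA : Acyc (Additive 𝕜ˣ) M) {K : Set X}
    (hK : IsCompact K) (hKM : K ⊆ M) :
    ∃ δ > 0, ∃ p : X → (List X → 𝕜) →ₗ[𝕜] 𝕜, ∀ x ∈ K, Orients n (Metric.ball x δ) (p x) ∧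
      ∀ y ∈ K, dist y x < δ → ∀ g ∈ coc 𝕜 (Metric.ball x δ) n, p y g = p x g := by
  obtain ⟨K', hK', hKM', hKK, hkill⟩ := hA K hK hKM
  obtain ⟨δ, hδ, p, hp⟩ := hM.exists_proportional (𝕜 := 𝕜) hK' hKM'
  have hex : ∀ y w, ∃ c : 𝕜ˣ, (∃ c : 𝕜ˣ, ∃ V, IsOpen V ∧ y ∈ V ∧ ∀ g ∈ coc 𝕜 V n,
      p w g = c * p y g) → ∃ V, IsOpen V ∧ y ∈ V ∧ ∀ g ∈ coc 𝕜 V n, p w g = c * p y g := by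
    intro y w
    by_cases h : ∃ c : 𝕜ˣ, ∃ V, IsOpen V ∧ y ∈ V ∧ ∀ g ∈ coc 𝕜 V n, p w g = c * p y g
    · exact h.imp fun c hc _ => hc
    · exact ⟨1, fun h' => (h h').elim⟩
  choose T hT using hex
  have hT' : ∀ x ∈ K', ∀ y ∈ K', dist y x < δ → ∀ w ∈ K', dist w x < δ →
      ∀ g ∈ coc 𝕜 (Metric.ball x δ) n, p w g = T y w * p y g := by
    intro x hx y hy hyx w hw hwx g hg
    obtain ⟨ho, h1⟩ := hp x hx y hy hyx
    obtain ⟨c, hc⟩ := h1 w hw hwx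
    obtain ⟨V, hV, hyV, h2⟩ := hT y w ⟨c, _, Metric.isOpen_ball, Metric.mem_ball.2 hyx, hc⟩
    rw [hc g hg, ho.unit_unique Metric.isOpen_ball hV Metric.isOpen_ball (Metric.mem_ball.2 hyx) hyV
      (Metric.mem_ball.2 hyx) hc h2]
  have hcoc : ∀ x ∈ K', ∀ y ∈ K', dist y x < δ → ∀ w ∈ K', dist w x < δ →
      T x w = T y w * T x y := by
    intro x hx y hy hyx w hw hwx
    have hxx : dist x x < δ := by rwa [dist_self]
    have hb := Metric.mem_ball_self (x := x) hδ
    refine Units.ext ((hp x hx x hx hxx).1.unit_unique (o' := p w) Metric.isOpen_ball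
      Metric.isOpen_ball Metric.isOpen_ball hb hb hb (hT' x hx x hx hxx w hw hwx) fun g hg => ?_)
    rw [hT' x hx y hy hyx w hw hwx g hg, hT' x hx x hx hxx y hy hyx g hg, Units.val_mul, mul_assoc]
  let f : List X → Additive 𝕜ˣ
    | [y, w] => Additive.ofMul (T y w)
    | _ => 0
  obtain ⟨s, ε, hε, hs⟩ := hkill 2 f ⟨δ, hδ, fun l hl hC => by
    obtain ⟨x, y, w, rfl⟩ := List.length_eq_three.1 hl
    have hx := hC.1 x (by simp)
    have hy := hC.1 y (by simp)
    have hw := hC.1 w (by simp)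
    have h := hcoc x hx y hy (hC.2 y (by simp) x (by simp)) w hw (hC.2 w (by simp) x (by simp))
    simp only [d_cons, d_nil, f, h, ofMul_mul]
    abel⟩
  have hs' : ∀ x ∈ K, ∀ y ∈ K, dist y x < ε → (T x y) =
      Additive.toMul (s [y]) * (Additive.toMul (s [x]))⁻¹ := by
    intro x hx y hy hxy
    have h := hs [x, y] rfl ⟨by simp [hx, hy], by simp [hxy, hε, dist_comm x y]⟩
    simp only [Pi.sub_apply, d_cons, d_nil, f, sub_eq_zero, sub_zero] at h
    rw [← div_eq_mul_inv, ← toMul_sub, ← h, toMul_ofMul]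
  refine ⟨min δ ε, lt_min hδ hε, fun x => ((Additive.toMul (s [x]))⁻¹ : 𝕜ˣ).val • p x,
    fun x hx => ⟨(((hp x (hKK hx) x (hKK hx) (by rwa [dist_self])).1).mono
      (Metric.ball_subset_ball (min_le_left _ _))).smul (Units.ne_zero _), fun y hy hyx g hg => ?_⟩⟩
  have hg' := coc_mono (Metric.ball_subset_ball (min_le_left δ ε)) hg
  rw [LinearMap.smul_apply, LinearMap.smul_apply, hT' x (hKK hx) x (hKK hx) (by rwa [dist_self]) y (hKK hy)
    (hyx.trans_le (min_le_left _ _)) g hg', hs' x hx y hy (hyx.trans_le (min_le_right _ _)),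
    Units.val_mul, smul_eq_mul, smul_eq_mul, mul_comm (Units.val (s [y]).toMul), mul_assoc,
    ← mul_assoc, ← mul_assoc, mul_comm (Units.val (s [y]).toMul⁻¹), mul_assoc (Units.val _), mul_assoc]
  simp

/-- Gluing of local orientations. -/
theorem Mfd.exists_orientation (hM : Mfd n M) (hA : Acyc (Additive 𝕜ˣ) M) {K : Set X}
    (hK : IsCompact K) (hKM : K ⊆ M) :
    ∃ U, IsOpen U ∧ K ⊆ U ∧ U ⊆ M ∧ ∃ o : (List X → 𝕜) →ₗ[𝕜] 𝕜, Orients n U o := by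
  obtain ⟨U, hU, hKU, hUM, hUc⟩ := exists_open_between_and_isCompact_closure hK hM.isOpen hKM
  obtain ⟨U', hU', hUU, hUM', hUc'⟩ := exists_open_between_and_isCompact_closure hUc hM.isOpen hUM
  obtain ⟨δ, hδ, p, hp⟩ := hM.exists_coherent hA hUc' hUM'
  have hM' : Mfd n U' := hM.mono hU' (subset_closure.trans hUM')
  let P : Set X → Prop := fun A => ∀ B, IsOpen B → closure B ⊆ A → ∃ o : (List X → 𝕜) →ₗ[𝕜] 𝕜,
    (∀ g ∈ cob 𝕜 B n, o g = 0) ∧ ∀ x ∈ closure U', ∀ V, IsOpen V → V ⊆ B →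
      V ⊆ Metric.ball x (δ / 2) → ∀ g ∈ coc 𝕜 V n, o g = p x g
  have hP : P U' := by
    refine small_induction (M := U') (half_pos hδ) (fun W hW hWU hWδ B hB hBW => ?_)
      (fun A B hA hB hAU hBU pA pB C hCo hCAB => ?_) (fun A hA hAU h B hB hBA => ?_) hU' subset_rfl
    · have hBW' := subset_closure.trans hBW
      rcases W.eq_empty_or_nonempty with rfl | ⟨x, hx⟩
      · refine ⟨0, fun _ _ => rfl, fun x hx V _ hVB _ g hg => ?_⟩
        rw [(hp x hx).1.1 g (coc_empty_le_cob (coc_mono (hVB.trans hBW') hg)), LinearMap.zero_apply]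
      have hWb : W ⊆ Metric.ball x δ := fun y hy => Metric.mem_ball.2 ((hWδ y hy x hx).trans (by linarith))
      have hxU := subset_closure (hWU hx)
      refine ⟨p x, fun g hg => (hp x hxU).1.1 g (cob_mono (hBW'.trans hWb) hg), fun y hy V _ hVB hVy g hg => ?_⟩
      rcases V.eq_empty_or_nonempty with rfl | ⟨z, hz⟩
      · rw [(hp x hxU).1.1 g (coc_empty_le_cob hg), (hp y hy).1.1 g (coc_empty_le_cob hg)]
      have h1 := hWδ z (hBW' (hVB hz)) x hx
      have h2 := Metric.mem_ball.1 (hVy hz)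
      have h3 := dist_triangle_left y x z
      exact ((hp x hxU).2 y hy (by linarith) g (coc_mono ((hVB.trans hBW').trans hWb) hg)).symm
    · obtain ⟨A₁, B₁, hA₁, hB₁, hAA, hBB, hCU⟩ := exists_shrink (isClosed_closure (s := C)).isCompact
        hA hB hCAB
      have hCU := subset_closure.trans hCU
      have hA₁U : A₁ ⊆ U' := (subset_closure.trans hAA).trans hAU
      obtain ⟨oA, hoA, hoA'⟩ := pA A₁ hA₁ hAA
      obtain ⟨oB, hoB, hoB'⟩ := pB B₁ hB₁ hBB
      have hagree : ∀ g ∈ coc 𝕜 A₁ n, g ∈ coc 𝕜 B₁ n → oA g = oB g := by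
        intro g hgA hgB
        have hg : g ∈ coc 𝕜 (A₁ ∩ B₁) n := ⟨CS_inter hA₁ hB₁ hgA.1 hgB.1, hgA.2⟩
        refine hM'.coc_le_of_small (S := LinearMap.eqLocus oA oB) (half_pos hδ) (hA₁.inter hB₁)
          (inter_subset_left.trans hA₁U) (fun W hW hWo hWδ g hg => ?_) hg
        change oA g = oB g
        rcases W.eq_empty_or_nonempty with rfl | ⟨x, hx⟩
        · rw [hoA g (coc_empty_le_cob hg), hoB g (coc_empty_le_cob hg)]
        · have hxU := subset_closure (hA₁U (hW hx).1)
          have hWx : W ⊆ Metric.ball x (δ / 2) := fun y hy => Metric.mem_ball.2 (hWδ y hy x hx)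
          rw [hoA' x hxU W hWo (hW.trans inter_subset_left) hWx g hg,
            hoB' x hxU W hWo (hW.trans inter_subset_right) hWx g hg]
      obtain ⟨ρ, hρA, hρB⟩ := exists_functional_sup _ _ oA oB hagree
      refine ⟨ρ, fun g hg => ?_, fun x hx V hV hVC hVx g hg => ?_⟩
      · obtain ⟨w, hw, hgw⟩ := mem_cob.1 hg
        obtain ⟨w₁, hw₁, w₂, hw₂, rfl⟩ := CS_union hA₁ hB₁ (CS_mono hCU hw)
        have h1 : g = (g - d (w₁ + w₂)) + dL w₁ + dL w₂ := by
          change g = (g - dL (w₁ + w₂)) + dL w₁ + dL w₂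
          rw [map_add]; abel
        have h2 : ρ (g - d (w₁ + w₂)) = 0 := by
          rw [hρA _ (cob_le_coc (CS_empty_le_cob hgw)), hoA _ (CS_empty_le_cob hgw)]
        rw [h1, map_add, map_add, h2]
        change 0 + ρ (d w₁) + ρ (d w₂) = 0
        rw [hρA _ (d_mem_coc hw₁), hρB _ (d_mem_coc hw₂), hoA _ (d_mem_cob hw₁), hoB _ (d_mem_cob hw₂)]
        simp
      · have hVU : V = V ∩ A₁ ∪ V ∩ B₁ := by
          rw [← inter_union_distrib_left, inter_eq_left.2 (hVC.trans hCU)]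
        rw [hVU] at hg
        have hg' := hM'.coc_union_le (hV.inter hA₁) (hV.inter hB₁) (inter_subset_right.trans hA₁U) hg
        obtain ⟨g₁, hg₁, g₂, hg₂, rfl⟩ := Submodule.mem_sup.1 hg'
        rw [map_add, map_add, hρA _ (coc_mono inter_subset_right hg₁),
          hρB _ (coc_mono inter_subset_right hg₂),
          hoA' x hx _ (hV.inter hA₁) inter_subset_right (inter_subset_left.trans hVx) g₁ hg₁,
          hoB' x hx _ (hV.inter hB₁) inter_subset_right (inter_subset_left.trans hVx) g₂ hg₂]
    · obtain ⟨V, hV, hVA, hBV, pV⟩ := h _ isClosed_closure.isCompact hBA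
      exact pV B hB hBV
  obtain ⟨o, ho, ho'⟩ := hP U hU hUU
  refine ⟨U, hU, hKU, subset_closure.trans hUM, o, ho, fun V hVU hV ⟨x, hx⟩ => ?_⟩
  have hxU : x ∈ closure U' := subset_closure (hUU (subset_closure (hVU hx)))
  obtain ⟨g, hg, hg'⟩ := (hp x hxU).1.2 (V ∩ Metric.ball x (δ / 2))
    (inter_subset_right.trans (Metric.ball_subset_ball (by linarith))) (hV.inter Metric.isOpen_ball)
    ⟨x, hx, Metric.mem_ball_self (half_pos hδ)⟩
  refine ⟨g, coc_mono inter_subset_left hg, ?_⟩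
  rwa [ho' x hxU _ (hV.inter Metric.isOpen_ball) (inter_subset_left.trans hVU) inter_subset_right g hg]

end Orientation

section Duality

variable {X : Type*} [MetricSpace X] {n : ℕ} {𝕜 : Type*} [Field 𝕜]

/-- A cocycle of the cone of the cap product with `Λ`. -/
structure ConeCocycle (n : ℕ) (Λ : (List X → 𝕜) →ₗ[𝕜] 𝕜) (U : Set X) (k : ℕ) (f : List X → 𝕜)
    (μ : (List X → 𝕜) →ₗ[𝕜] 𝕜) : Prop where
  len : ∀ l, l.length + k ≠ n + 2 → f l = 0
  nil : f [] = 0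
  lz : LZ U (d f)
  null : ∀ g ∈ CS 𝕜 ∅ (k + 1), μ g = 0
  rel : ∀ g ∈ CS 𝕜 U k, Λ (cup f g) + μ (d g) = 0

/-- A coboundary of the cone of the cap product with `Λ`. -/
structure ConePrimitive (n : ℕ) (Λ : (List X → 𝕜) →ₗ[𝕜] 𝕜) (U : Set X) (k : ℕ) (f : List X → 𝕜)
    (μ : (List X → 𝕜) →ₗ[𝕜] 𝕜) (w : List X → 𝕜) (ν : (List X → 𝕜) →ₗ[𝕜] 𝕜) : Prop where
  len : ∀ l, l.length + (k + 1) ≠ n + 2 → w l = 0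
  nil : w [] = 0
  lz : LZ U (f - d w)
  null : ∀ g ∈ CS 𝕜 ∅ (k + 2), ν g = 0
  rel : ∀ g ∈ CS 𝕜 U (k + 1), μ g = Λ (cup (sgn w) g) + ν (d g)

/-- The cone of the cap product has no cohomology. -/
def ConeExact (n : ℕ) (Λ : (List X → 𝕜) →ₗ[𝕜] 𝕜) (U : Set X) : Prop :=
  ∀ k f μ, ConeCocycle n Λ U k f μ → ∀ T, IsOpen T → closure T ⊆ U →
    ∃ w ν, ConePrimitive n Λ T k f μ w ν

variable {Λ : (List X → 𝕜) →ₗ[𝕜] 𝕜} {U V T : Set X} {k : ℕ} {f w g : List X → 𝕜}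
  {μ ν : (List X → 𝕜) →ₗ[𝕜] 𝕜}

lemma ConeCocycle.mono (h : ConeCocycle n Λ U k f μ) (hV : V ⊆ U) : ConeCocycle n Λ V k f μ :=
  ⟨h.len, h.nil, h.lz.mono hV, h.null, fun g hg => h.rel g (CS_mono hV hg)⟩

lemma ConePrimitive.mono (h : ConePrimitive n Λ U k f μ w ν) (hV : V ⊆ U) :
    ConePrimitive n Λ V k f μ w ν :=
  ⟨h.len, h.nil, h.lz.mono hV, h.null, fun g hg => h.rel g (CS_mono hV hg)⟩

lemma apply_cup_of_null (hΛ : ∀ g ∈ cob 𝕜 U n, Λ g = 0) (hh : ∀ g, Λ (hom (n + 1) g) = Λ g)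
    (f : List X → 𝕜) (hg : g ∈ CS 𝕜 ∅ k) : Λ (cup f g) = 0 := by
  rw [← hh]
  exact hΛ _ (CS_empty_le_cob (cup_mem_CS f hg _))

/-- Adjointness of the coboundary under the pairing. -/
lemma apply_cup_d (hΛ : ∀ g ∈ cob 𝕜 U n, Λ g = 0) (hh : ∀ g, Λ (hom (n + 1) g) = Λ g)
    (w : List X → 𝕜) (hg : g ∈ CS 𝕜 U k) :
    Λ (cup (d w) g) + Λ (cup (sgn w) (d g)) = w [] * Λ g := by
  have h1 : d (cup w g) = cup (d w) g + cup (sgn w) (d g) - w [] • g := by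
    funext l
    rw [d_cup w g (nil_of_mem_CS hg)]
    rfl
  have h2 : Λ (d (cup w g)) = 0 := by
    rw [← hh, ← d_hom]
    exact hΛ _ (d_mem_cob (cup_mem_CS w hg n))
  rw [h1, map_sub, map_add, map_smul, sub_eq_zero, smul_eq_mul] at h2
  exact h2

variable [CompactSpace X]

lemma apply_cup_of_lz (hΛ : ∀ g ∈ cob 𝕜 U n, Λ g = 0) (hh : ∀ g, Λ (hom (n + 1) g) = Λ g)
    (hV : IsOpen V) (hf : LZ V f) (hg : g ∈ CS 𝕜 V k) : Λ (cup f g) = 0 := by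
  rw [← hh]
  exact hΛ _ (CS_empty_le_cob (cup_mem_CS_empty hV hf hg _))

lemma LZ.glue {U' : Set X} (hU : IsOpen U) (hV : IsOpen V) (hU' : closure U' ⊆ U)
    {w w' : List X → 𝕜} (h : LZ (U ∩ V) (w - w')) :
    ∃ w'', LZ U' (w'' - w) ∧ LZ V (w'' - w') ∧ ∀ l, w l = 0 → w' l = 0 → w'' l = 0 := by
  classical
  let w'' : List X → 𝕜
    | [] => w []
    | a :: l => if a ∈ U' then w (a :: l) else w' (a :: l)
  refine ⟨w'', fun K hK hKU k => ⟨1, one_pos, fun l _ hC => ?_⟩, fun K hK hKV k => ?_, ?_⟩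
  · cases l with
    | nil => simp [w'']
    | cons a l => simp [w'', hKU (hC.1 a (by simp))]
  · have hc : IsCompact (K ∩ closure U') := hK.inter_right isClosed_closure
    obtain ⟨δ, hδ, hδU⟩ := hc.exists_cthickening_subset_open (hU.inter hV)
      fun x hx => ⟨hU' hx.2, hKV hx.1⟩
    obtain ⟨ε, hε, hn⟩ := h _ Metric.isClosed_cthickening.isCompact hδU k
    refine ⟨min ε δ, lt_min hε hδ, fun l hl hC => ?_⟩
    cases l with
    | nil => simpa [w''] using hn [] hl ⟨by simp, by simp⟩
    | cons a l =>
      by_cases ha : a ∈ U'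
      · have h1 : (w'' - w') (a :: l) = (w - w') (a :: l) := by simp [w'', ha]
        rw [h1]
        refine hn _ hl ⟨fun b hb => ?_, fun b hb c hc => (hC.2 b hb c hc).trans_le (min_le_left _ _)⟩
        exact Metric.mem_cthickening_of_dist_le b a _ _ ⟨hC.1 a (by simp), subset_closure ha⟩
          ((hC.2 b hb a (by simp)).le.trans (min_le_right _ _))
      · simp [w'', ha]
  · rintro (_ | ⟨a, l⟩) h1 h2
    · exact h1
    · simp [w'', h1, h2]

/-- Mayer–Vietoris for duality. -/
lemma ConeExact.union {U₀ : Set X} (hΛ : ∀ g ∈ cob 𝕜 U₀ n, Λ g = 0)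
    (hh : ∀ g, Λ (hom (n + 1) g) = Λ g) (hV₀ : V ⊆ U₀)
    (eU : ConeExact n Λ U) (eV : ConeExact n Λ V) (h : ∀ K, IsCompact K → K ⊆ U ∪ V →
      ∃ U₁ V₁, IsOpen U₁ ∧ IsOpen V₁ ∧ closure U₁ ⊆ U ∧ closure V₁ ⊆ V ∧ K ⊆ U₁ ∪ V₁ ∧
        ConeExact n Λ (U₁ ∩ V₁)) : ConeExact n Λ (U ∪ V) := by
  intro k f μ hf T hT hTU
  obtain ⟨U₁, V₁, hU₁, hV₁, hUU₁, hVV₁, hT₁, e⟩ := h _ isClosed_closure.isCompact hTU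
  obtain ⟨U₂, V₂, hU₂, hV₂, hUU₂, hVV₂, hT₂⟩ :=
    exists_shrink (isClosed_closure (s := T)).isCompact hU₁ hV₁ hT₁
  obtain ⟨U₃, V₃, hU₃, hV₃, hUU₃, hVV₃, hT₃⟩ :=
    exists_shrink (isClosed_closure (s := T)).isCompact hU₂ hV₂ hT₂
  obtain ⟨w₁, ν₁, h1⟩ := eU k f μ (hf.mono subset_union_left) U₁ hU₁ hUU₁
  obtain ⟨w₂, ν₂, h2⟩ := eV k f μ (hf.mono subset_union_right) V₁ hV₁ hVV₁
  have hW : IsOpen (U₁ ∩ V₁) := hU₁.inter hV₁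
  have hdδ : LZ (U₁ ∩ V₁) (d (w₁ - w₂)) := by
    have := (h2.lz.mono inter_subset_right).sub (h1.lz.mono inter_subset_left)
    rwa [sub_sub_sub_cancel_left, ← d_sub] at this
  have hδ : ConeCocycle n Λ (U₁ ∩ V₁) (k + 1) (sgn (w₁ - w₂)) (ν₁ - ν₂) := by
    refine ⟨fun l hl => ?_, ?_, ?_, fun g hg => ?_, fun g hg => ?_⟩
    · simp [sgn_apply, h1.len l hl, h2.len l hl]
    · simp [sgn_apply, h1.nil, h2.nil]
    · rw [d_sgn]
      exact hdδ.sgn.neg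
    · simp [h1.null g hg, h2.null g hg]
    · have h3 := h1.rel g (CS_mono inter_subset_left hg)
      have h4 := h2.rel g (CS_mono inter_subset_right hg)
      have h5 : Λ (cup (sgn (w₁ - w₂)) g) = Λ (cup (sgn w₁) g) - Λ (cup (sgn w₂) g) := by
        rw [← cupₗ_apply, map_sub, map_sub, LinearMap.sub_apply, map_sub]; rfl
      rw [h5, LinearMap.sub_apply]
      rw [h3] at h4
      linear_combination h4
  obtain ⟨w₃, ν₃, h3⟩ := e (k + 1) _ _ hδ (U₂ ∩ V₂) (hU₂.inter hV₂) fun x hx =>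
    ⟨hUU₂ (closure_mono inter_subset_left hx), hVV₂ (closure_mono inter_subset_right hx)⟩
  set w₂' := w₂ - d (sgn w₃) with hw₂'
  have hV₂V := subset_closure.trans hVV₂
  have hU₂U := subset_closure.trans hUU₂
  have hU₃U := subset_closure.trans hUU₃
  have hlz : LZ (U₂ ∩ V₂) (w₁ - w₂') := by
    have := h3.lz.sgn
    rw [map_sub, sgn_sgn] at this
    have h4 : w₁ - w₂' = w₁ - w₂ - sgn (d w₃) := by
      rw [hw₂', d_sgn]; abel
    rwa [h4]
  obtain ⟨w, hw1, hw2, hw0⟩ := hlz.glue hU₂ hV₂ hUU₃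
  set ν₂' : (List X → 𝕜) →ₗ[𝕜] 𝕜 := ν₂ + Λ ∘ₗ cupₗ (sgn w₃) + ν₃ ∘ₗ dL with hν₂'
  have hν₂a : ∀ g, ν₂' g = ν₂ g + Λ (cup (sgn w₃) g) + ν₃ (d g) := fun g => rfl
  have h2' : ∀ g ∈ CS 𝕜 V₂ (k + 1), μ g = Λ (cup (sgn w₂') g) + ν₂' (d g) := by
    intro g hg
    have h4 := apply_cup_d hΛ hh w₃ (CS_mono (hV₂V.trans ((subset_closure.trans hVV₁).trans hV₀)) hg)
    rw [h3.nil, zero_mul] at h4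
    have h5 : sgn w₂' = sgn w₂ + d w₃ := by
      have h6 : d w₃ = - sgn (d (sgn w₃)) := by rw [d_sgn, map_neg, sgn_sgn, neg_neg]
      rw [h6, hw₂', map_sub]; abel
    rw [h2.rel g (CS_mono hV₂V hg), hν₂a, h5, d_d, map_zero]
    have h6 : Λ (cup (sgn w₂ + d w₃) g) = Λ (cup (sgn w₂) g) + Λ (cup (d w₃) g) := by
      rw [← cupₗ_apply, map_add, LinearMap.add_apply, map_add]; rfl
    rw [h6]
    linear_combination -h4
  have hagree : ∀ g ∈ CS 𝕜 U₃ (k + 2), g ∈ CS 𝕜 V₂ (k + 2) → ν₁ g = ν₂' g := by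
    intro g hgU hgV
    have h4 := h3.rel g (CS_inter hU₂ hV₂ (CS_mono hU₃U hgU) hgV)
    rw [LinearMap.sub_apply] at h4
    rw [hν₂a]
    linear_combination h4
  obtain ⟨ρ, hρ1, hρ2⟩ := exists_functional_sup _ _ ν₁ ν₂' hagree
  have hw_cup : ∀ {S : Set X} {v : List X → 𝕜}, IsOpen S → LZ S (w - v) → ∀ g ∈ CS 𝕜 S (k + 1),
      Λ (cup (sgn w) g) = Λ (cup (sgn v) g) := by
    intro S v hS hv g hg
    have := apply_cup_of_lz hΛ hh hS hv.sgn hg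
    rw [map_sub, ← cupₗ_apply, map_sub, LinearMap.sub_apply, map_sub, sub_eq_zero] at this
    exact this
  refine ⟨w, ρ, ConePrimitive.mono (U := U₃ ∪ V₂) ⟨fun l hl => hw0 l (h1.len l hl) ?_,
    hw0 _ h1.nil ?_, ?_, fun g hg => ?_, fun g hg => ?_⟩
    ((subset_closure.trans hT₃).trans (union_subset_union_right _ (subset_closure.trans hVV₃)))⟩
  · rw [hw₂', Pi.sub_apply, h2.len l hl, zero_sub, neg_eq_zero]
    refine d_eq_zero fun l' _ hl' => ?_
    rw [sgn_apply, h3.len l' (by omega), mul_zero]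
  · simp [hw₂', h2.nil]
  · have hs : ∀ {S : Set X} {v : List X → 𝕜}, LZ S (f - d v) → LZ S (w - v) → LZ S (f - d w) := by
      intro S v h h'
      have := h.sub h'.d
      rwa [d_sub, sub_sub_sub_cancel_right] at this
    have hfw₂' : LZ V₂ (f - d w₂') := by
      rw [hw₂', d_sub, d_d, sub_zero]
      exact h2.lz.mono hV₂V
    exact (hs (h1.lz.mono (hU₃U.trans hU₂U)) hw1).union hU₃ hV₂ (hs hfw₂' hw2)
  · rw [hρ1 g (CS_empty_le hg), h1.null g hg]
  · obtain ⟨g₁, hg₁, g₂, hg₂, rfl⟩ := CS_union hU₃ hV₂ hg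
    have h4 : d (g₁ + g₂) = d g₁ + d g₂ := map_add dL g₁ g₂
    have h5 : cup (sgn w) (g₁ + g₂) = cup (sgn w) g₁ + cup (sgn w) g₂ := map_add (cupₗ (sgn w)) g₁ g₂
    rw [h4, h5, map_add, map_add, map_add, h1.rel g₁ (CS_mono (hU₃U.trans hU₂U) hg₁), h2' g₂ hg₂,
      hw_cup hU₃ hw1 g₁ hg₁, hw_cup hV₂ hw2 g₂ hg₂, hρ1 _ (d_mem_CS hg₁), hρ2 _ (d_mem_CS hg₂)]
    ring

end Duality

section Duality

variable {X : Type*} [MetricSpace X] [CompactSpace X] {n : ℕ} {𝕜 : Type*} [Field 𝕜]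
  {Λ : (List X → 𝕜) →ₗ[𝕜] 𝕜} {U T K : Set X} {k : ℕ} {f g : List X → 𝕜}
  {μ : (List X → 𝕜) →ₗ[𝕜] 𝕜}

omit [CompactSpace X] in
lemma coneExact_empty : ConeExact n Λ (∅ : Set X) := by
  intro k f μ hf T _ hT
  refine ⟨0, 0, ConePrimitive.mono (U := ∅) ⟨fun _ _ => rfl, rfl, fun K _ hK m => ⟨1, one_pos,
    fun l _ hC => ?_⟩, fun _ _ => rfl, fun g hg => ?_⟩ (subset_closure.trans hT)⟩
  · cases l with
    | nil => simpa using hf.nil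
    | cons a l => exact (hK (hC.1 a (by simp))).elim
  · rw [hf.null g hg, map_zero, ← cupₗ_apply, map_zero]
    simp

/-- The first component of a primitive in the cone over a box, before normalisation. -/
lemma ConeCocycle.exists_primitive (hΛ : Orients n U Λ) (hh : ∀ g, Λ (hom (n + 1) g) = Λ g)
    {B Q : Set X} (hQU : Q ⊆ U) (hB : IsOpen B) (hne : B.Nonempty) (hBQ : B ⊆ Q)
    (hQ : Kills 𝕜 Q Q) (hQc : IsCompact Q) (hf : ConeCocycle n Λ U k f μ) :
    ∃ w, (∀ l, l.length + (k + 1) ≠ n + 2 → w l = 0) ∧ w [] = 0 ∧ LZ B (f - d w) := by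
  rcases lt_or_ge k (n + 2) with hk | hk
  swap
  · have hf0 : f = 0 := by
      funext l
      by_cases hl : l.length + k = n + 2
      · have : l = [] := List.length_eq_zero_iff.1 (by omega)
        rw [this, hf.nil]; rfl
      · exact hf.len l hl
    exact ⟨0, fun _ _ => rfl, rfl, by rw [hf0, d_zero, sub_zero]; exact LZ.zero⟩
  obtain ⟨a, ha⟩ : ∃ a, n + 1 = k + a := Nat.exists_eq_add_of_le (by omega)
  obtain ⟨w, hw⟩ := hQ (a + 1) f (hf.lz Q hQc hQU _)
  have hlz : LZ B (f - d (hom a w)) := by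
    intro L hL hLB m
    rw [d_hom]
    by_cases hm : m = a + 1
    · subst hm
      refine (hw.on_mono (hLB.trans hBQ)).congr fun l hl => ?_
      rw [Pi.sub_apply, hom_apply, if_pos hl]; rfl
    · refine Null.zero.congr fun l hl => ?_
      rw [Pi.sub_apply, hom_apply, if_neg (by omega), hf.len l (by omega), sub_zero]; rfl
  refine ⟨hom a w, fun l hl => by rw [hom_apply, if_neg (by omega)], ?_, hlz⟩
  rcases Nat.eq_zero_or_pos a with rfl | ha0
  swap
  · rw [hom_apply, if_neg (by simp; omega)]
  obtain rfl : k = n + 1 := by omega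
  obtain ⟨g, hg, hg0⟩ := hΛ.2 B (hBQ.trans hQU) hB hne
  have hgU := CS_mono (hBQ.trans hQU) hg.1
  have h1 := apply_cup_of_lz hΛ.1 hh hB hlz hg.1
  have h2 := apply_cup_d hΛ.1 hh (hom 0 w) hgU
  have h3 := hf.rel g hgU
  rw [apply_cup_of_null hΛ.1 hh _ (mem_coc.1 hg).2, add_zero] at h2
  rw [hf.null _ (mem_coc.1 hg).2, add_zero] at h3
  rw [← cupₗ_apply, map_sub, LinearMap.sub_apply, map_sub, cupₗ_apply, cupₗ_apply, h3, h2, zero_sub,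
    neg_eq_zero] at h1
  exact (mul_eq_zero.1 h1).resolve_right hg0

/-- Duality for boxes. -/
lemma coneExact_box {φ : (Fin n → ℝ) → X} (hφ : IsOpenEmbedding φ) {a b : Fin n → ℝ}
    (hΛ : Orients n (φ '' obox a b) Λ) (hh : ∀ g, Λ (hom (n + 1) g) = Λ g) :
    ConeExact n Λ (φ '' obox a b) := by
  intro k f μ hf T hT hTB
  obtain ⟨a', b', hTB', hB'⟩ := exists_box_between hφ isClosed_closure.isCompact hTB
  have hTB'' := subset_closure.trans hTB'
  rcases (obox a' b').eq_empty_or_nonempty with he | hne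
  · rw [he, image_empty] at hTB'
    exact coneExact_empty k f μ (hf.mono (empty_subset _)) T hT hTB'
  have hBo : IsOpen (φ '' obox a' b') := hφ.isOpenMap _ isOpen_obox
  have hBB := subset_closure.trans hB'
  have hQB : φ '' closure (obox a' b') ⊆ φ '' obox a b :=
    (image_closure_subset_closure_image hφ.continuous).trans hB'
  have hQ : Kills 𝕜 (φ '' closure (obox a' b')) (φ '' closure (obox a' b')) :=
    kills_convex hφ isCompact_closure_obox convex_obox.closure (subset_closure hne.some_mem)
  obtain ⟨w₀, hlen₀, hnil₀, hlz₀⟩ := hf.exists_primitive hΛ hh hQB hBo (hne.image φ)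
    (image_mono subset_closure) hQ (isCompact_closure_obox.image hφ.continuous)
  obtain ⟨w, hlen, hnil, hlz, hμ⟩ : ∃ w, (∀ l, l.length + (k + 1) ≠ n + 2 → w l = 0) ∧ w [] = 0 ∧
      LZ (φ '' obox a' b') (f - d w) ∧
      ∀ g ∈ coc 𝕜 (φ '' obox a' b') k, (μ - Λ ∘ₗ cupₗ (sgn w)) g = 0 := by
    have hcob : ∀ w : List X → 𝕜, w [] = 0 → LZ (φ '' obox a' b') (f - d w) →
        ∀ g ∈ cob 𝕜 (φ '' obox a' b') k, (μ - Λ ∘ₗ cupₗ (sgn w)) g = 0 := by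
      intro w hw hlz g hg
      obtain ⟨v, hv, hgv⟩ := mem_cob.1 hg
      have hvB := CS_mono hBB hv
      have h1 : (μ - Λ ∘ₗ cupₗ (sgn w)) (g - d v) = 0 := by
        change μ (g - d v) - Λ (cup (sgn w) (g - d v)) = 0
        rw [hf.null _ hgv, apply_cup_of_null hΛ.1 hh _ hgv, sub_zero]
      have h2 : (μ - Λ ∘ₗ cupₗ (sgn w)) (d v) = 0 := by
        change μ (d v) - Λ (cup (sgn w) (d v)) = 0
        have h3 := hf.rel v hvB
        have h4 := apply_cup_d hΛ.1 hh w hvB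
        have h5 := apply_cup_of_lz hΛ.1 hh hBo hlz hv
        rw [← cupₗ_apply, map_sub, LinearMap.sub_apply, map_sub, cupₗ_apply, cupₗ_apply] at h5
        rw [hw, zero_mul] at h4
        linear_combination h3 - h4 - h5
      rw [← sub_add_cancel g (d v), map_add, h1, h2, add_zero]
    by_cases hkn : k = n
    swap
    · exact ⟨w₀, hlen₀, hnil₀, hlz₀, fun g hg =>
        hcob w₀ hnil₀ hlz₀ g (coc_box_le_cob 𝕜 hφ hne hkn hg)⟩
    subst hkn
    obtain ⟨u, hu, _, hgen⟩ := exists_generator_box 𝕜 hφ hne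
    have hΛu : Λ u ≠ 0 := by
      intro h0
      obtain ⟨g, hg, hg'⟩ := hΛ.2 _ hBB hBo (hne.image φ)
      obtain ⟨y, hy, z, hz, rfl⟩ := Submodule.mem_sup.1 (hgen hg)
      obtain ⟨c, rfl⟩ := Submodule.mem_span_singleton.1 hy
      exact hg' (by rw [map_add, map_smul, h0, hΛ.1 z (cob_mono hBB hz), smul_zero, add_zero])
    set c := (μ - Λ ∘ₗ cupₗ (sgn w₀)) u / Λ u with hc
    let s : List X → 𝕜 := fun l => if l = [] then 1 else 0
    have hds : ∀ l : List X, l.length ≠ 1 → d s l = 0 := fun l hl => d_eq_zero fun l' _ hl' => by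
      have : l' ≠ [] := by rintro rfl; exact hl (by simpa using hl'.symm)
      simp [s, this]
    have hsu : Λ (cup (d s) u) = Λ u := by
      have h1 := apply_cup_d hΛ.1 hh s (CS_mono hBB hu.1)
      rw [apply_cup_of_null hΛ.1 hh _ (mem_coc.1 hu).2, add_zero] at h1
      simpa [s] using h1
    have hdw : d (w₀ + c • sgn (d s)) = d w₀ := by
      change dL (w₀ + c • sgn (d s)) = d w₀
      rw [map_add, map_smul]
      change d w₀ + c • d (sgn (d s)) = d w₀
      rw [d_sgn, d_d, map_zero, neg_zero, smul_zero, add_zero]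
    have hnil : (w₀ + c • sgn (d s)) [] = 0 := by simp [hnil₀, sgn_apply]
    have hlz : LZ (φ '' obox a' b') (f - d (w₀ + c • sgn (d s))) := by rwa [hdw]
    refine ⟨w₀ + c • sgn (d s), fun l hl => ?_, hnil, hlz, fun g hg => ?_⟩
    · simp [hlen₀ l hl, sgn_apply, hds l (by omega)]
    · obtain ⟨y, hy, z, hz, rfl⟩ := Submodule.mem_sup.1 (hgen hg)
      obtain ⟨r, rfl⟩ := Submodule.mem_span_singleton.1 hy
      rw [map_add, hcob _ hnil hlz z hz, map_smul, add_zero]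
      have h1 : (μ - Λ ∘ₗ cupₗ (sgn (w₀ + c • sgn (d s)))) u =
          (μ - Λ ∘ₗ cupₗ (sgn w₀)) u - c * Λ (cup (d s) u) := by
        rw [map_add, map_smul, sgn_sgn, map_add, map_smul]
        simp only [LinearMap.sub_apply, LinearMap.comp_apply, LinearMap.add_apply,
          LinearMap.smul_apply, map_add, map_smul, cupₗ_apply, smul_eq_mul]
        ring
      rw [h1, hsu, hc, div_mul_cancel₀ _ hΛu, sub_self, smul_zero]
  obtain ⟨ν, hν0, hν⟩ := exists_functional dL (CS 𝕜 (φ '' obox a' b') (k + 1)) (CS 𝕜 ∅ (k + 2))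
    (μ - Λ ∘ₗ cupₗ (sgn w)) fun g hg hg' => hμ g ⟨hg, hg'⟩
  refine ⟨w, ν, ConePrimitive.mono (U := φ '' obox a' b') ⟨hlen, hnil, hlz, hν0, fun g hg => ?_⟩ hTB''⟩
  have h1 : ν (d g) = μ g - Λ (cup (sgn w) g) := hν g hg
  rw [h1]; ring

/-- Duality on a manifold with orientation `Λ`. -/
lemma Mfd.coneExact (hU : Mfd n U) (hΛ : Orients n U Λ) (hh : ∀ g, Λ (hom (n + 1) g) = Λ g) :
    ConeExact n Λ U := by
  have h : U ⊆ U → ConeExact n Λ U := by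
    refine hU.induction (P := fun A => A ⊆ U → ConeExact n Λ A) (fun _ => coneExact_empty) (fun φ hφ hr a b hU' =>
      coneExact_box hφ (hΛ.mono hU') hh) (fun A B hA hB pA pB h hAB => ?_) fun A hA h hAU => ?_
    · refine (pA (subset_union_left.trans hAB)).union hΛ.1 hh (subset_union_right.trans hAB)
        (pB (subset_union_right.trans hAB)) fun K hK hKU => ?_
      obtain ⟨A₁, B₁, h1, h2, h3, h4, h5, h6⟩ := h K hK hKU
      exact ⟨A₁, B₁, h1, h2, h3, h4, h5, h6 ((inter_subset_left.trans subset_closure).trans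
        (h3.trans (subset_union_left.trans hAB)))⟩
    · intro k f μ hf T hT hTA
      obtain ⟨V, hV, hVA, hTV, pV⟩ := h _ isClosed_closure.isCompact hTA
      exact pV (hVA.trans hAU) k f μ (hf.mono hVA) T hT hTV
  exact h subset_rfl

end Duality

section Core

variable {X : Type*} [MetricSpace X] [CompactSpace X] {n : ℕ} {𝕜 : Type*} [Field 𝕜]
  {Λ : (List X → 𝕜) →ₗ[𝕜] 𝕜} {U M K : Set X} {k : ℕ}

omit [CompactSpace X] in
lemma Orients.comp_hom (h : Orients n U Λ) : Orients n U (Λ ∘ₗ hom (n + 1)) := by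
  refine ⟨fun g hg => ?_, fun V hV hVo hne => ?_⟩
  · rw [LinearMap.comp_apply, hom_of_mem_CS (mem_coc.1 (cob_le_coc hg)).1]
    exact h.1 g hg
  · obtain ⟨g, hg, h0⟩ := h.2 V hV hVo hne
    exact ⟨g, hg, by rwa [LinearMap.comp_apply, hom_of_mem_CS (mem_coc.1 hg).1]⟩

/-- The compactly supported cohomology of an acyclic manifold is that of a ball. -/
lemma Mfd.exists_duality (hM : Mfd n M) (hA : Acyc 𝕜 M) (hA' : Acyc (Additive 𝕜ˣ) M)
    (hK : IsCompact K) (hKM : K ⊆ M) :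
    ∃ U, K ⊆ U ∧ U ⊆ M ∧ ∃ Λ : (List X → 𝕜) →ₗ[𝕜] 𝕜, Orients n U Λ ∧ (∀ g, Λ (hom (n + 1) g) = Λ g) ∧
      ∀ V ⊆ K, IsOpen V → ∀ k, ∀ g ∈ coc 𝕜 V k, Λ g = 0 → g ∈ cob 𝕜 U k := by
  obtain ⟨K', hK', hK'M, hKK', hkill⟩ := hA K hK hKM
  obtain ⟨U, hU, hK'U, hUM, o, ho⟩ := hM.exists_orientation hA' hK' hK'M
  have hΛ := ho.comp_hom
  have hh : ∀ g, (o ∘ₗ hom (n + 1)) (hom (n + 1) g) = (o ∘ₗ hom (n + 1)) g := fun g => by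
    rw [LinearMap.comp_apply, LinearMap.comp_apply, hom_hom]
  generalize o ∘ₗ hom (n + 1) = Λ at hΛ hh
  refine ⟨U, hKK'.trans hK'U, hUM, Λ, hΛ, hh, fun V hVK hV k g hg hg0 => ?_⟩
  by_contra hgc
  obtain ⟨μ, hμ, hμg⟩ := exists_separating _ hgc
  obtain ⟨δ, hδ, hδU⟩ := hK'.exists_cthickening_subset_open hU hK'U
  have hK'T : K' ⊆ Metric.thickening δ K' := Metric.self_subset_thickening hδ _
  obtain ⟨w, ν, hw⟩ := (hM.mono hU hUM).coneExact hΛ hh k 0 μ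
    ⟨fun _ _ => rfl, rfl, by rw [d_zero]; exact LZ.zero, fun g hg => hμ g (CS_empty_le_cob hg),
      fun g hg => by
        rw [hμ _ (d_mem_cob hg), ← cupₗ_apply, map_zero]
        simp⟩ (Metric.thickening δ K') Metric.isOpen_thickening
    ((Metric.closure_thickening_subset_cthickening _ _).trans hδU)
  obtain ⟨hgV, hdg⟩ := mem_coc.1 hg
  have hrel := hw.rel g (CS_mono (hVK.trans (hKK'.trans hK'T)) hgV)
  rw [hμg, hw.null _ hdg, add_zero] at hrel
  have hlz : LZ V (d (sgn w)) := by
    rw [d_sgn]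
    have h1 := (hw.lz.mono (hVK.trans (hKK'.trans hK'T))).sgn
    rw [zero_sub, map_neg] at h1
    exact h1
  obtain ⟨y, hy, hyz⟩ : ∃ y : List X → 𝕜, y [] * Λ g = 0 ∧ LZ V (sgn w - d y) := by
    by_cases hk : k ≤ n
    swap
    · refine ⟨0, by simp, ?_⟩
      have hw0 : w = 0 := by
        funext l
        by_cases hl : l = []
        · rw [hl, hw.nil]; rfl
        · have := List.length_pos_iff.2 hl
          exact hw.len l (by omega)
      rw [hw0, map_zero, d_zero, sub_zero]
      exact LZ.zero
    obtain ⟨b, hb⟩ := Nat.exists_eq_add_of_le hk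
    obtain ⟨y, hy⟩ := hkill (b + 1) (sgn w) (by
      have h1 := (hw.lz K' hK' hK'T (b + 2)).neg
      obtain ⟨ε, hε, h⟩ := h1
      refine ⟨ε, hε, fun l hl hC => ?_⟩
      have h2 := h l hl hC
      simp only [zero_sub, neg_neg] at h2
      rw [d_sgn, Pi.neg_apply, sgn_apply, h2, mul_zero, neg_zero])
    refine ⟨hom b y, by rw [hg0, mul_zero], fun L hL hLV m => ?_⟩
    rw [d_hom]
    by_cases hm : m = b + 1
    · subst hm
      refine (hy.on_mono (hLV.trans hVK)).congr fun l hl => ?_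
      rw [Pi.sub_apply, hom_apply, if_pos hl]; rfl
    · refine Null.zero.congr fun l hl => ?_
      rw [Pi.sub_apply, hom_apply, if_neg (by omega), sgn_apply, hw.len l (by omega), mul_zero,
        sub_zero]; rfl
  have h1 := apply_cup_of_lz hΛ.1 hh hV hyz hgV
  have h2 := apply_cup_d hΛ.1 hh y (CS_mono (hVK.trans (hKK'.trans hK'U)) hgV)
  rw [apply_cup_of_null hΛ.1 hh _ hdg, add_zero, hy] at h2
  rw [← cupₗ_apply, map_sub, LinearMap.sub_apply, map_sub, cupₗ_apply, cupₗ_apply, h2, sub_zero,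
    ← hrel] at h1
  exact one_ne_zero h1

end Core

section Punctured

variable {X : Type*} [MetricSpace X] [CompactSpace X] {n : ℕ} {𝕜 : Type*} [Field 𝕜]
  {K : Set X} {z : X} {k m : ℕ} {f g : List X → 𝕜}

omit [CompactSpace X] in
lemma null_on_of_mem_CS_compl (hg : g ∈ CS 𝕜 Kᶜ k) : Null (Germ.on K) k g := by
  obtain ⟨_, L, _, hL, h⟩ := hg
  exact h.on_mono (subset_compl_comm.1 hL)

/-- Up to a coboundary, a cocycle on `K` extends to a cochain supported away from `z`. -/
lemma exists_extension_compl (hK : IsCompact K) (z : X) (hf : Null (Germ.on K) (m + 2) (d f)) :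
    ∃ F ∈ CS 𝕜 {z}ᶜ (m + 1), ∃ w, d F ∈ CS 𝕜 Kᶜ (m + 2) ∧
      ∀ l, l.length = m + 1 → (∀ a ∈ l, a ∈ K) → F l = f l - d w l := by
  classical
  obtain ⟨w₀, hw₀⟩ : ∃ w, Null (Germ.on (K ∩ {z})) (m + 1) (f - d w) := by
    by_cases hz : z ∈ K
    · have h1 : K ∩ {z} = {z} := inter_eq_right.2 (singleton_subset_iff.2 hz)
      rw [h1]
      exact kills_singleton z _ f (hf.on_mono (singleton_subset_iff.2 hz))
    · refine ⟨0, 1, one_pos, fun l hl hC => ?_⟩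
      obtain ⟨a, l', rfl⟩ := List.exists_cons_of_length_eq_add_one hl
      obtain ⟨h1, h2⟩ := hC.1 a (by simp)
      exact (hz (h2 ▸ h1)).elim
  obtain ⟨w, hw⟩ := Null.exists_near (hK.inter_right isClosed_singleton) inter_subset_left
    hf.near_of_on hw₀
  have hg := hf.d_succ_sub w
  generalize hgdef : f - d w = g at hw hg
  obtain ⟨r, hr, hr'⟩ := exists_nearest hK
  obtain ⟨ε, hε, h⟩ := hw
  obtain ⟨ε', hε', h'⟩ := hg
  obtain ⟨δ, hδ, hδK⟩ := exists_near_inter hK (isCompact_singleton (x := z)) (half_pos hε)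
  have hrr : ∀ (η : ℝ) (x y : X), (∃ b ∈ K, dist x b < η / 3) → (∃ b ∈ K, dist y b < η / 3) →
      dist x y < η / 3 → dist (r x) (r y) < η := by
    intro η x y hx hy hxy
    have h1 := (hr' x _ hx).2
    have h2 := (hr' y _ hy).2
    have h3 := dist_triangle4 (r x) x y (r y)
    rw [dist_comm (r x) x] at h3
    linarith
  set F : List X → 𝕜 := fun l => if l.length = m + 1 ∧ ∀ a ∈ l, ∃ b ∈ K, dist a b < δ then
    g (l.map r) else 0 with hF
  have hFd : d F ∈ CS 𝕜 Kᶜ (m + 2) := by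
    set η := min δ (ε' / 3) with hη
    have hη0 : 0 < η := by positivity
    refine ⟨fun l hl => d_eq_zero fun l' _ hl' => if_neg fun h => hl (by omega),
      (Metric.thickening η K)ᶜ, Metric.isOpen_thickening.isClosed_compl.isCompact,
      compl_subset_compl.2 (Metric.self_subset_thickening hη0 _), η, hη0, fun l hl hC => ?_⟩
    have hl1 : ∀ a ∈ l, ∃ b ∈ K, dist a b < η := fun a ha => by
      have := hC.1 a ha
      rw [compl_compl] at this
      exact Metric.mem_thickening_iff.1 this
    have h1 : d F l = d (fun l => g (l.map r)) l := d_congr l fun l' hs hl' => if_pos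
      ⟨by omega, fun a ha => (hl1 a (hs.subset ha)).imp fun b hb =>
        ⟨hb.1, hb.2.trans_le (min_le_left _ _)⟩⟩
    have hl2 : ∀ a ∈ l, ∃ b ∈ K, dist a b < ε' / 3 := fun a ha => (hl1 a ha).imp fun b hb =>
        ⟨hb.1, hb.2.trans_le (min_le_right _ _)⟩
    rw [h1, d_map]
    refine h' _ (by simpa using hl) ⟨?_, ?_⟩
    · simp only [List.mem_map, forall_exists_index, and_imp, forall_apply_eq_imp_iff₂]
      exact fun a ha => (hr' a _ (hl1 a ha)).1
    · simp only [List.mem_map, forall_exists_index, and_imp, forall_apply_eq_imp_iff₂]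
      exact fun a ha b hb => hrr _ _ _ (hl2 a ha) (hl2 b hb)
        ((hC.2 a ha b hb).trans_le (min_le_right _ _))
  refine ⟨F, ⟨fun l hl => if_neg fun h => hl h.1, (Metric.ball z (min δ (ε / 3)))ᶜ,
    Metric.isOpen_ball.isClosed_compl.isCompact,
    compl_subset_compl.2 (singleton_subset_iff.2 (Metric.mem_ball_self (by positivity))),
    ε / 3, by positivity, fun l hl hC => ?_⟩, w, hFd, fun l hl hlK => ?_⟩
  · by_cases hlK : ∀ a ∈ l, ∃ b ∈ K, dist a b < δ
    swap
    · exact if_neg fun h => hlK h.2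
    rw [hF]
    dsimp only
    rw [if_pos ⟨hl, hlK⟩]
    have hball : ∀ a ∈ l, dist a z < min δ (ε / 3) := fun a ha => by
      have := hC.1 a ha
      rwa [compl_compl] at this
    have hz : ∀ a ∈ l, z ∈ K := fun a ha => by
      obtain ⟨c, ⟨hc, rfl⟩, _⟩ := hδK a (hlK a ha)
        ⟨z, rfl, (hball a ha).trans_le (min_le_left _ _)⟩
      exact hc
    have hl3 : ∀ a ∈ l, ∃ b ∈ K, dist a b < ε / 3 := fun a ha =>
      ⟨z, hz a ha, (hball a ha).trans_le (min_le_right _ _)⟩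
    refine h _ (by simpa using hl) ⟨?_, ?_, ?_⟩
    · simp only [List.mem_map, forall_exists_index, and_imp, forall_apply_eq_imp_iff₂]
      exact fun a ha => (hr' a _ (hlK a ha)).1
    · simp only [List.mem_map, forall_exists_index, and_imp, forall_apply_eq_imp_iff₂]
      intro a ha
      refine ⟨z, ⟨hz a ha, rfl⟩, ?_⟩
      have h1 := (hr' a _ (hl3 a ha)).2
      have h2 := (hball a ha).trans_le (min_le_right _ _)
      have h3 := dist_triangle (r a) a z
      rw [dist_comm (r a) a] at h3
      linarith
    · simp only [List.mem_map, forall_exists_index, and_imp, forall_apply_eq_imp_iff₂]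
      exact fun a ha b hb => hrr _ _ _ (hl3 a ha) (hl3 b hb) (hC.2 a ha b hb)
  · rw [hF]
    dsimp only
    rw [if_pos ⟨hl, fun a ha => ⟨a, hlK a ha, by simpa using hδ⟩⟩, ← hgdef,
      List.map_congr_left fun a ha => hr a (hlK a ha), List.map_id']
    rfl

/-- The one-point compactification of an `n`-manifold has cohomological dimension at most `n`. -/
lemma Mfd.cohDimLE (hM : Mfd n ({z}ᶜ : Set X)) : CohDimLE 𝕜 X n := by
  intro K hK m hm f hf
  obtain ⟨m, rfl⟩ : ∃ m', m = m' + 1 := Nat.exists_eq_succ_of_ne_zero (by omega)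
  obtain ⟨F, hF, w, hFd, hFf⟩ := exists_extension_compl hK z hf
  have hKo := hK.isClosed.isOpen_compl
  have h1 := CS_inter hM.isOpen hKo (d_mem_CS hF) hFd
  obtain ⟨v, hv, hdv⟩ := mem_cob.1 ((hM.mono (hM.isOpen.inter hKo) inter_subset_left).dimLE 𝕜
    (m + 1) (by omega) (mem_coc.2 ⟨h1, by rw [d_d]; exact Submodule.zero_mem _⟩))
  obtain ⟨u, hu, hdu⟩ := mem_cob.1 (hM.dimLE 𝕜 m (by omega) (mem_coc.2
    ⟨Submodule.sub_mem _ hF (CS_mono inter_subset_left hv), by rwa [d_sub]⟩))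
  refine ⟨w + u, ?_⟩
  refine (((mem_CS_empty.1 hdu).2.on_mono (subset_univ K)).add
    (null_on_of_mem_CS_compl (CS_mono inter_subset_right hv))).of_eq_on fun l hl hC => ?_
  have h2 := hFf l hl hC.1
  simp only [Pi.sub_apply, Pi.add_apply, d_add', h2]
  ring

lemma Mfd.kills_compl_box (hM : Mfd n ({z}ᶜ : Set X)) (hA : Acyc 𝕜 ({z}ᶜ : Set X))
    (hA' : Acyc (Additive 𝕜ˣ) ({z}ᶜ : Set X)) {φ : (Fin n → ℝ) → X} (hφ : IsOpenEmbedding φ)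
    {a b : Fin n → ℝ} (hne : (obox a b).Nonempty) (hB : φ '' Icc a b ⊆ {z}ᶜ) :
    Kills 𝕜 (φ '' obox a b)ᶜ (φ '' obox a b)ᶜ := by
  have hBo : IsOpen (φ '' obox a b) := hφ.isOpenMap _ isOpen_obox
  have hK := hBo.isClosed_compl.isCompact
  have hBB : φ '' obox a b ⊆ φ '' Icc a b := image_mono obox_subset_Icc
  intro k f hf
  rcases k with _ | m
  · refine ⟨0, ?_⟩
    obtain ⟨ε, hε, h⟩ := hf
    have hz : z ∈ (φ '' obox a b)ᶜ := fun h => hB (hBB h) rfl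
    have h1 := h [z] rfl ⟨by simpa using hz, by simpa using hε⟩
    rw [d_cons] at h1
    rw [d_zero, sub_zero, null_on_zero]
    simpa [d_nil] using h1
  obtain ⟨F, hF, w, hFd, hFf⟩ := exists_extension_compl hK z hf
  rw [compl_compl] at hFd
  obtain ⟨C, hC, hCM, hFC⟩ := exists_mem_CS_of_mem hF
  have hI : IsCompact (φ '' Icc a b) := isCompact_Icc.image hφ.continuous
  obtain ⟨δ, hδ, hδM⟩ := (hC.union hI).exists_cthickening_subset_open hM.isOpen
    (union_subset hCM hB)
  set V := Metric.thickening δ (C ∪ φ '' Icc a b) with hV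
  have hCV : C ∪ φ '' Icc a b ⊆ V := Metric.self_subset_thickening hδ _
  have hBV : φ '' obox a b ⊆ V := (hBB.trans subset_union_right).trans hCV
  obtain ⟨U, hKU, _, Λ, hΛ, hh, hdual⟩ := hM.exists_duality hA hA'
    (Metric.isClosed_cthickening.isCompact) hδM
  have hVK := Metric.thickening_subset_cthickening δ (C ∪ φ '' Icc a b)
  have hVU := hVK.trans hKU
  have hFV := hFC V (subset_union_left.trans hCV)
  obtain ⟨g₀, hg₀, hΛg₀⟩ := hΛ.2 _ (hBV.trans hVU) hBo (hne.image φ)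
  have hFcoc : d F ∈ coc 𝕜 (φ '' obox a b) (m + 1) :=
    mem_coc.2 ⟨hFd, by rw [d_d]; exact Submodule.zero_mem _⟩
  have hFcob : d F ∈ cob 𝕜 (φ '' obox a b) (m + 1) := by
    by_cases hmn : m + 1 = n
    swap
    · exact coc_box_le_cob 𝕜 hφ hne hmn hFcoc
    subst hmn
    obtain ⟨u, hu, _, hgen⟩ := exists_generator_box 𝕜 hφ hne
    have hΛB : ∀ x ∈ cob 𝕜 (φ '' obox a b) (m + 1), Λ x = 0 := fun x hx =>
      hΛ.1 x (cob_mono (hBV.trans hVU) hx)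
    have hΛu : Λ u ≠ 0 := by
      intro h0
      obtain ⟨y, hy, x, hx, rfl⟩ := Submodule.mem_sup.1 (hgen hg₀)
      obtain ⟨c, rfl⟩ := Submodule.mem_span_singleton.1 hy
      exact hΛg₀ (by rw [map_add, map_smul, h0, hΛB x hx, smul_zero, add_zero])
    obtain ⟨y, hy, x, hx, hyx⟩ := Submodule.mem_sup.1 (hgen hFcoc)
    obtain ⟨c, rfl⟩ := Submodule.mem_span_singleton.1 hy
    have h1 : Λ (d F) = 0 := hΛ.1 _ (d_mem_cob (CS_mono hVU hFV))
    rw [← hyx, map_add, map_smul, hΛB x hx, add_zero, smul_eq_mul] at h1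
    rw [← hyx, (mul_eq_zero.1 h1).resolve_right hΛu, zero_smul, zero_add]
    exact hx
  obtain ⟨v, hv, hdv⟩ := mem_cob.1 hFcob
  have hFv : F - v ∈ coc 𝕜 V m :=
    mem_coc.2 ⟨Submodule.sub_mem _ hFV (CS_mono hBV hv), by rwa [d_sub]⟩
  obtain ⟨g, hg, hΛg⟩ : ∃ g ∈ coc 𝕜 (φ '' obox a b) m, Λ (F - v - g) = 0 := by
    by_cases hmn : m = n
    · subst hmn
      refine ⟨(Λ (F - v) / Λ g₀) • g₀, Submodule.smul_mem _ _ hg₀, ?_⟩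
      rw [map_sub, map_smul, smul_eq_mul, div_mul_cancel₀ _ hΛg₀, sub_self]
    · refine ⟨0, Submodule.zero_mem _, ?_⟩
      rw [sub_zero, ← hh, hom_ne_of_mem_CS (mem_coc.1 hFv).1 (by omega), map_zero]
  obtain ⟨u, hu, hdu⟩ := mem_cob.1 (hdual V hVK Metric.isOpen_thickening m _
    (Submodule.sub_mem _ hFv (coc_mono hBV hg)) hΛg)
  have hnull : ∀ x ∈ CS 𝕜 (φ '' obox a b) (m + 1), Null (Germ.on (φ '' obox a b)ᶜ) (m + 1) x :=
    fun x hx => null_on_of_mem_CS_compl (by rwa [compl_compl])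
  refine ⟨w + u, ?_⟩
  refine ((((mem_CS_empty.1 hdu).2.on_mono (subset_univ _)).add (hnull v hv)).add
    (hnull g (mem_coc.1 hg).1)).of_eq_on fun l hl hC => ?_
  have h2 := hFf l hl hC.1
  simp only [Pi.sub_apply, Pi.add_apply, d_add', h2]
  ring

/-- The one-point compactification of an acyclic manifold is acyclic away from any point. -/
lemma Mfd.acyc_compl_singleton (hM : Mfd n ({z}ᶜ : Set X)) (hA : Acyc 𝕜 ({z}ᶜ : Set X))
    (hA' : Acyc (Additive 𝕜ˣ) ({z}ᶜ : Set X)) {y : X} (hy : y ≠ z) : Acyc 𝕜 ({y}ᶜ : Set X) := by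
  intro L hL hLy
  obtain ⟨φ, hφ, ⟨e, rfl⟩, hφM⟩ := hM y hy
  obtain ⟨a, b, he, hab⟩ := exists_box hφ (hM.isOpen.inter hL.isClosed.isOpen_compl)
    (e := e) ⟨hy, fun h => hLy h rfl⟩
  have hLK : L ⊆ (φ '' obox a b)ᶜ := fun x hx hxB =>
    (hab (image_mono obox_subset_Icc hxB)).2 hx
  exact ⟨(φ '' obox a b)ᶜ, (hφ.isOpenMap _ isOpen_obox).isClosed_compl.isCompact,
    compl_subset_compl.2 (singleton_subset_iff.2 (mem_image_of_mem φ he)), hLK,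
    (hM.kills_compl_box hA hA' hφ ⟨e, he⟩ (hab.trans inter_subset_left)).mono subset_rfl hLK⟩

end Punctured

section FixedPoints

variable {M X : Type*} [TopologicalSpace M] [MetricSpace X] {ι : M → X}

/-- A contractible open subspace is acyclic. -/
lemma acyc_range [ContractibleSpace M] (R : Type*) [AddCommGroup R] (hι : IsOpenEmbedding ι) :
    Acyc R (range ι) := by
  classical
  obtain ⟨p, ⟨H⟩⟩ := id_nullhomotopic M
  intro K hK hKr
  set s : X → M := Function.invFun ι with hs
  have : Nonempty M := ⟨p⟩
  have hsι : ∀ x, s (ι x) = x := Function.leftInverse_invFun hι.injective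
  have hsc : ContinuousOn s (range ι) := by
    rintro _ ⟨x, rfl⟩
    refine ContinuousAt.continuousWithinAt ?_
    rw [hι.continuousAt_iff.symm]
    exact continuousAt_id.congr (Eventually.of_forall fun y => (hsι y).symm)
  set h : ℝ → X → X := fun t x => ι (H (projIcc 0 1 zero_le_one t, s x)) with hh
  have hc : ContinuousOn (Function.uncurry h) (Icc 0 1 ×ˢ K) := by
    have hs' : ContinuousOn (fun q : ℝ × X => s q.2) (Icc 0 1 ×ˢ K) :=
      hsc.comp continuousOn_snd fun x hx => hKr hx.2
    have hp : ContinuousOn (fun q : ℝ × X => projIcc (0 : ℝ) 1 zero_le_one q.1) (Icc 0 1 ×ˢ K) :=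
      (continuous_projIcc.comp continuous_fst).continuousOn
    exact (hι.continuous.comp H.continuous).comp_continuousOn (hp.prodMk hs')
  have hKs : ∀ x ∈ K, ι (s x) = x := fun x hx => by
    obtain ⟨y, rfl⟩ := hKr hx
    rw [hsι]
  have h0 : ∀ x ∈ K, h 0 x = x := fun x hx => by
    simp only [hh, projIcc_left]
    exact (congrArg ι (H.apply_zero (s x))).trans (hKs x hx)
  have h1 : ∀ x ∈ K, h 1 x = ι p := fun x hx => by
    simp only [hh, projIcc_right]
    exact congrArg ι (H.apply_one (s x))
  set K' := Function.uncurry h '' (Icc 0 1 ×ˢ K) ∪ {ι p} with hK'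
  have hm : ∀ t ∈ Icc (0 : ℝ) 1, ∀ x ∈ K, h t x ∈ K' := fun t ht x hx =>
    Or.inl ⟨(t, x), ⟨ht, hx⟩, rfl⟩
  refine ⟨K', ((isCompact_Icc.prod hK).image_of_continuousOn hc).union isCompact_singleton, ?_,
    fun x hx => ?_, fun k => ?_⟩
  · rintro _ (⟨⟨t, x⟩, _, rfl⟩ | rfl)
    · exact mem_range_self _
    · exact mem_range_self _
  · rw [← h0 x hx]
    exact hm 0 (by simp) x hx
  · exact KillsAt.of_homotopy hK (kills_singleton (ι p) k) (singleton_subset_iff.2 (Or.inr rfl)) h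
      hc hm h0 h1

variable [CompactSpace X]

lemma exists_mfd_range [PreconnectedSpace M] [Nonempty M]
    (hM : ∀ x : M, ∃ (n : ℕ) (ψ : (Fin n → ℝ) → M), IsOpenEmbedding ψ ∧ x ∈ range ψ)
    (hι : IsOpenEmbedding ι) : ∃ n, Mfd n (range ι) := by
  choose n ψ hψ hx using hM
  have hn : IsLocallyConstant n := IsLocallyConstant.iff_exists_open n |>.2 fun x =>
    ⟨range (ψ x), (hψ x).isOpen_range, hx x, fun y hy => dim_eq (hι.comp (hψ y)) (hι.comp (hψ x))
      (x := ι y) (by rw [range_comp]; exact mem_image_of_mem ι (hx y))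
      (by rw [range_comp]; exact mem_image_of_mem ι hy)⟩
  obtain ⟨x₀⟩ := ‹Nonempty M›
  refine ⟨n x₀, ?_⟩
  rintro _ ⟨x, rfl⟩
  rw [hn.apply_eq_of_preconnectedSpace x₀ x]
  exact ⟨ι ∘ ψ x, hι.comp (hψ x), by rw [range_comp]; exact mem_image_of_mem ι (hx x),
    range_comp_subset_range _ _⟩

/-- Fixed points of a `p`-group on the one-point compactification of a contractible manifold. -/
lemma exists_fixed_eq_singleton [ContractibleSpace M]
    (hM : ∀ x : M, ∃ (n : ℕ) (ψ : (Fin n → ℝ) → M), IsOpenEmbedding ψ ∧ x ∈ range ψ)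
    (hι : IsOpenEmbedding ι) {z : X} (hz : range ι = {z}ᶜ) {p : ℕ} (hp : p.Prime) {G : Type*}
    [Group G] [Finite G] (hG : IsPGroup p G) (act : G →* Equiv.Perm X)
    (hact : ∀ g, Continuous (act g)) (hactz : ∀ g, act g z = z) {F : Set X} (hF : IsCompact F)
    (hFz : {z}ᶜ ∩ {x | ∀ g, act g x = x} = F) : ∃ y, F = {y} := by
  have := Fact.mk hp
  obtain ⟨n, hn⟩ := exists_mfd_range hM hι
  have hA := acyc_range (ZMod p) hι
  have hA' := acyc_range (Additive (ZMod p)ˣ) hι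
  rw [hz] at hn hA hA'
  have hdim : CohDimLE (ZMod p) X n := hn.cohDimLE
  have hinv : ∀ y, (∀ g, act g y = y) → ∀ g, ∀ x ∈ ({y}ᶜ : Set X), act g x ∈ ({y}ᶜ : Set X) :=
    fun y hy g x hx h => hx ((act g).injective (h.trans (hy g).symm))
  obtain ⟨L, _, hLF, _, hL⟩ := hFz ▸ (hA.fixed_group hp hG act hact hdim (hinv z hactz)) ∅
    isCompact_empty (empty_subset _)
  obtain ⟨y, hyL⟩ := Kills.nonempty (hL 0)
  have hyF := hLF hyL
  obtain ⟨hyz, hyfix⟩ : y ∈ ({z}ᶜ ∩ {x | ∀ g, act g x = x} : Set X) := hFz ▸ hyF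
  refine ⟨y, Acyc.eq_singleton (𝕜 := ZMod p) (z := z) hF ?_ hyF ?_⟩
  · rw [← hFz]
    exact fun h => h.1 rfl
  · have h1 := (hn.acyc_compl_singleton hA hA' hyz).fixed_group hp hG act hact hdim (hinv y hyfix)
    convert h1 using 1
    rw [← hFz]
    ext x
    by_cases hx : x = z
    · subst hx
      simp [hactz, Ne.symm hyz]
    · simp [hx, and_comm]

end FixedPoints

section OnePoint

variable {M : Type*} [TopologicalSpace M]

lemma secondCountableTopology_onePoint [SecondCountableTopology M] [T2Space M]
    [LocallyCompactSpace M] : SecondCountableTopology (OnePoint M) := by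
  let E : CompactExhaustion M := default
  have hE : ∀ m, IsOpen ((fun x : M => (x : OnePoint M)) '' E m)ᶜ := fun m =>
    (OnePoint.isClosed_image_coe.2 ⟨(E.isCompact m).isClosed, E.isCompact m⟩).isOpen_compl
  refine TopologicalSpace.IsTopologicalBasis.secondCountableTopology
    (b := (fun U : Set M => (fun x : M => (x : OnePoint M)) '' U) '' TopologicalSpace.countableBasis M ∪
      range fun m => ((fun x : M => (x : OnePoint M)) '' E m)ᶜ) ?_
    (((TopologicalSpace.countable_countableBasis M).image _).union (countable_range _))
  refine TopologicalSpace.isTopologicalBasis_of_isOpen_of_nhds ?_ fun a U ha hU => ?_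
  · rintro _ (⟨U, hU, rfl⟩ | ⟨m, rfl⟩)
    · exact OnePoint.isOpenEmbedding_coe.isOpenMap _ (TopologicalSpace.isOpen_of_mem_countableBasis hU)
    · exact hE m
  · induction a using OnePoint.rec with
    | infty =>
      obtain ⟨m, hm⟩ := E.exists_superset_of_isCompact ((OnePoint.isOpen_iff_of_mem ha).1 hU).2
      refine ⟨_, Or.inr ⟨m, rfl⟩, by simp, fun x hx => ?_⟩
      induction x using OnePoint.rec with
      | infty => exact ha
      | coe x =>
        by_contra hxU
        exact hx (mem_image_of_mem _ (hm hxU))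
    | coe a =>
      obtain ⟨V, hV, haV, hVU⟩ := (TopologicalSpace.isBasis_countableBasis M).exists_subset_of_mem_open
        (show a ∈ (fun x : M => (x : OnePoint M)) ⁻¹' U from ha)
        (hU.preimage OnePoint.continuous_coe)
      exact ⟨_, Or.inl ⟨V, hV, rfl⟩, mem_image_of_mem _ haV, image_subset_iff.2 hVU⟩

lemma exists_chart {n : ℕ} {U : Set M} {V : Set (Fin n → ℝ)} (hU : IsOpen U) (hV : IsOpen V)
    (e : U ≃ₜ V) {x : M} (hx : x ∈ U) :
    ∃ ψ : (Fin n → ℝ) → M, IsOpenEmbedding ψ ∧ x ∈ range ψ := by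
  have hj : IsOpenEmbedding (fun v : V => (e.symm v : M)) :=
    hU.isOpenEmbedding_subtypeVal.comp e.symm.isOpenEmbedding
  set φ : (Fin n → ℝ) → M := Function.extend Subtype.val (fun v : V => (e.symm v : M)) fun _ => x
    with hφ
  have hφV : ∀ v : V, φ v = e.symm v := fun v => Subtype.val_injective.extend_apply _ _ v
  have hopen : ∀ W ⊆ V, IsOpen W → IsOpen (φ '' W) := fun W hW hWo => by
    have : φ '' W = (fun v : V => (e.symm v : M)) '' (Subtype.val ⁻¹' W) := by
      ext y
      constructor
      · rintro ⟨v, hv, rfl⟩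
        exact ⟨⟨v, hW hv⟩, hv, (hφV ⟨v, hW hv⟩).symm⟩
      · rintro ⟨v, hv, rfl⟩
        exact ⟨v, hv, hφV v⟩
    rw [this]
    exact hj.isOpenMap _ (hWo.preimage continuous_subtype_val)
  have hc : ContinuousOn φ V := by
    rw [continuousOn_iff_continuous_domRestrict]
    exact hj.continuous.congr fun v => (hφV v).symm
  have hi : InjOn φ V := fun v hv w hw h => congrArg Subtype.val
    (hj.injective (((hφV ⟨v, hv⟩).symm.trans h).trans (hφV ⟨w, hw⟩)))
  obtain ⟨ψ, hψ, h, _⟩ := exists_small_chart hopen hc hi hV (e ⟨x, hx⟩).2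
  exact ⟨ψ, hψ, by rwa [hφV, e.symm_apply_apply] at h⟩

lemma locallyCompactSpace_of_charts [T2Space M]
    (hM : ∀ x : M, ∃ (n : ℕ) (ψ : (Fin n → ℝ) → M), IsOpenEmbedding ψ ∧ x ∈ range ψ) :
    LocallyCompactSpace M := by
  have : WeaklyLocallyCompactSpace M := ⟨fun x => by
    obtain ⟨n, ψ, hψ, v, rfl⟩ := hM x
    exact ⟨ψ '' Metric.closedBall v 1, (isCompact_closedBall v 1).image hψ.continuous,
      hψ.isOpenMap.image_mem_nhds (Metric.closedBall_mem_nhds v one_pos)⟩⟩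
  infer_instance

/-- The action on the one-point compactification. -/
noncomputable def onePointAct (G M : Type*) [Group G] [TopologicalSpace M] [MulAction G M]
    [ContinuousConstSMul G M] : G →* Equiv.Perm (OnePoint M) where
  toFun g := (Homeomorph.smul g : M ≃ₜ M).onePointCongr.toEquiv
  map_one' := by
    ext x
    induction x using OnePoint.rec with
    | infty => rfl
    | coe x => exact congrArg OnePoint.some (one_smul G x)
  map_mul' g h := by
    ext x
    induction x using OnePoint.rec with
    | infty => rfl
    | coe x => exact congrArg OnePoint.some (mul_smul g h x)

/-- The fixed points of a `p`-group acting on a contractible manifold. -/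
theorem exists_fixedPoints_eq_singleton {p : ℕ} (hp : p.Prime) {G : Type*} [Group G] [Finite G]
    (hpG : IsPGroup p G) [SecondCountableTopology M] [T2Space M]
    (hM : ∀ x : M, ∃ (n : ℕ) (U : Set M) (V : Set (Fin n → ℝ)),
      IsOpen U ∧ x ∈ U ∧ IsOpen V ∧ Nonempty (U ≃ₜ V)) [ContractibleSpace M]
    [MulAction G M] (hcont : ∀ g : G, Continuous (fun x : M => g • x))
    (hcpt : IsCompact (MulAction.fixedPoints G M)) :
    ∃ x : M, MulAction.fixedPoints G M = {x} := by
  have hch : ∀ x : M, ∃ (n : ℕ) (ψ : (Fin n → ℝ) → M), IsOpenEmbedding ψ ∧ x ∈ range ψ := by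
    intro x
    obtain ⟨n, U, V, hU, hx, hV, ⟨e⟩⟩ := hM x
    exact ⟨n, exists_chart hU hV e hx⟩
  have : LocallyCompactSpace M := locallyCompactSpace_of_charts hch
  have : SecondCountableTopology (OnePoint M) := secondCountableTopology_onePoint
  have : ContinuousConstSMul G M := ⟨hcont⟩
  let : MetricSpace (OnePoint M) := TopologicalSpace.metrizableSpaceMetric (OnePoint M)
  obtain ⟨y, hy⟩ := exists_fixed_eq_singleton hch (OnePoint.isOpenEmbedding_coe (X := M))
    (z := OnePoint.infty) (OnePoint.compl_infty).symm hp hpG (onePointAct G M)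
    (fun g => (Homeomorph.smul g : M ≃ₜ M).onePointCongr.continuous) (fun g => rfl)
    (F := (fun x : M => (x : OnePoint M)) '' MulAction.fixedPoints G M)
    (hcpt.image OnePoint.continuous_coe) (by
      ext x
      induction x using OnePoint.rec with
      | infty => simp
      | coe x =>
        have h1 : ∀ g : G, onePointAct G M g (x : OnePoint M) = (g • x : M) := fun g => rfl
        simp [h1, MulAction.mem_fixedPoints])
  obtain ⟨x, hx, rfl⟩ : y ∈ (fun x : M => (x : OnePoint M)) '' MulAction.fixedPoints G M := by
    rw [hy]; rfl
  refine ⟨x, eq_singleton_iff_unique_mem.2 ⟨hx, fun w hw => ?_⟩⟩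
  have h1 : (w : OnePoint M) ∈ (fun x : M => (x : OnePoint M)) '' MulAction.fixedPoints G M :=
    mem_image_of_mem _ hw
  rw [hy] at h1
  exact OnePoint.coe_injective h1

end OnePoint

end AlexanderSpanier

/-- If a finite `p`-group `G` acts continuously on a contractible topological
manifold `M`, if the fixed-point set `M^G` is compact, then it consists of exactly one point. -/
theorem fixedPoints_compact_eq_singleton (p : ℕ) (hp : p.Prime)
    (G M : Type) [Group G] [Finite G] (hpG : IsPGroup p G)
    [TopologicalSpace M] (hM : IsTopologicalManifold M) [ContractibleSpace M]
    [MulAction G M] (hcont : ∀ g : G, Continuous (fun x : M => g • x))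
    (hcpt : IsCompact (MulAction.fixedPoints G M)) :
    ∃ x : M, MulAction.fixedPoints G M = {x} := by
  obtain ⟨_, _, hM⟩ := hM
  exact AlexanderSpanier.exists_fixedPoints_eq_singleton hp hpG hM hcont hcpt
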